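/- arXiv:2304.01189 — 2 statements merged into one kernel-verified Lean document; each statement's English description precedes it below -/
import Mathlib

section
/- There exists a universal constant C > 0 such that the following holds: for every bounded measurable A ⊆ ℝ with |A| > 0 and |co(A)| ≥ C|A|, and every θ ∈ [0,1), if |A+A| ≤ (3+θ)|A| then there exist a finite arithmetic progression X ⊆ ℝ and a closed interval I ⊆ ℝ such that A ⊆ X+I and |((X+I) ∩ co(A)) \ A| ≤ θ|A|. -/
open Set Pointwise MeasureTheory

/-- Translates of a set of finite measure vary continuously in measure. -/
theorem tendsto_measure_symmDiff_preimage_add_right {G : Type*} [AddCommGroup G]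
    [TopologicalSpace G] [IsTopologicalAddGroup G] [MeasurableSpace G] [BorelSpace G]
    (μ : Measure G) [μ.InnerRegularCompactLTTop] [IsLocallyFiniteMeasure μ]
    [μ.IsAddRightInvariant] {s : Set G} (hs : MeasurableSet s) (hμs : μ s ≠ ⊤) (e₀ : G) :
    Filter.Tendsto (fun e => μ (symmDiff ((· + e) ⁻¹' s) ((· + e₀) ⁻¹' s)))
      (nhds e₀) (nhds 0) := by
  let F : C(G, C(G, G)) := ContinuousMap.curry ⟨fun p : G × G => p.2 + p.1, by fun_prop⟩
  have hF : ∀ e : G, ⇑(F e) = (· + e) := fun e => rfl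
  have := tendsto_measure_symmDiff_preimage_nhds_zero (μ := μ) (ν := μ) (f := F) (g := F e₀)
    (s := s) (F.continuous.tendsto e₀)
    (Filter.Eventually.of_forall fun e => by rw [hF]; exact measurePreserving_add_right μ e)
    (by rw [hF]; exact measurePreserving_add_right μ e₀) hs.nullMeasurableSet hμs
  simpa [hF] using this

namespace AddCircle

variable {P : ℝ} [hP : Fact (0 < P)]

theorem measureReal_univ_eq : (volume : Measure (AddCircle P)).real univ = P := by
  rw [Measure.real, AddCircle.measure_univ, ENNReal.toReal_ofReal hP.out.le]

theorem continuous_measureReal_inter_preimage_add {X Y : Set (AddCircle P)}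
    (hX : MeasurableSet X) (hY : MeasurableSet Y) :
    Continuous fun e : AddCircle P => volume.real (Y ∩ (· + e) ⁻¹' X) := by
  rw [continuous_iff_continuousAt]
  intro e₀
  have h0 := tendsto_measure_symmDiff_preimage_add_right (volume : Measure (AddCircle P))
    hX (measure_ne_top _ _) e₀
  have h1 : Filter.Tendsto (fun e => (volume : Measure (AddCircle P)).real
      (symmDiff ((· + e) ⁻¹' X) ((· + e₀) ⁻¹' X))) (nhds e₀) (nhds 0) := by
    have := (ENNReal.tendsto_toReal ENNReal.zero_ne_top).comp h0
    simpa [Function.comp_def, Measure.real] using this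
  rw [ContinuousAt, tendsto_iff_dist_tendsto_zero]
  refine squeeze_zero (fun _ => dist_nonneg) (fun e => ?_) h1
  have hm : ∀ e, MeasurableSet ((· + e) ⁻¹' X) := fun e => hX.preimage (measurable_add_const e)
  rw [Real.dist_eq]
  refine (abs_measureReal_sub_le_measureReal_symmDiff (hY.inter (hm e)).nullMeasurableSet
    (hY.inter (hm e₀)).nullMeasurableSet).trans ?_
  refine measureReal_mono ?_
  rw [← Set.inter_symmDiff_distrib_left]
  exact inter_subset_right

theorem lintegral_measure_inter_preimage_add {X Y : Set (AddCircle P)}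
    (hX : MeasurableSet X) :
    ∫⁻ e : AddCircle P, volume (Y ∩ (· + e) ⁻¹' X) = volume X * volume Y := by
  have hm : ∀ e, MeasurableSet ((· + e) ⁻¹' X) := fun e => hX.preimage (measurable_add_const e)
  have h1 : ∀ e : AddCircle P, volume (Y ∩ (· + e) ⁻¹' X)
      = ∫⁻ y in Y, X.indicator 1 (y + e) := by
    intro e
    rw [inter_comm, ← Measure.restrict_apply (hm e), ← lintegral_indicator_one (hm e)]
    rfl
  simp_rw [h1]
  rw [lintegral_lintegral_swap]
  · simp_rw [lintegral_add_left_eq_self (fun x => X.indicator (1 : AddCircle P → ENNReal) x),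
      lintegral_indicator_one hX]
    simp
  · have hX1 : Measurable (X.indicator (1 : AddCircle P → ENNReal)) :=
      measurable_const.indicator hX
    exact (hX1.comp (measurable_snd.add measurable_fst)).aemeasurable

theorem exists_measureReal_inter_preimage_add_eq {X Y : Set (AddCircle P)}
    (hX : MeasurableSet X) (hY : MeasurableSet Y) :
    ∃ e : AddCircle P, volume.real (Y ∩ (· + e) ⁻¹' X) = volume.real X * volume.real Y / P := by
  have hc := continuous_measureReal_inter_preimage_add hX hY
  have hint : Integrable (fun e : AddCircle P => volume.real (Y ∩ (· + e) ⁻¹' X)) :=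
    hc.integrable_of_hasCompactSupport (HasCompactSupport.of_compactSpace _)
  have hne : (volume : Measure (AddCircle P)) ≠ 0 := NeZero.ne _
  have hav : ⨍ e : AddCircle P, volume.real (Y ∩ (· + e) ⁻¹' X)
      = volume.real X * volume.real Y / P := by
    rw [average_eq, measureReal_univ_eq]
    have : ∫ e : AddCircle P, volume.real (Y ∩ (· + e) ⁻¹' X)
        = volume.real X * volume.real Y := by
      simp only [Measure.real]
      rw [integral_toReal, lintegral_measure_inter_preimage_add hX, ENNReal.toReal_mul]
      · have h := hc.measurable.ennreal_ofReal
        simp only [Measure.real, ENNReal.ofReal_toReal (measure_ne_top _ _)] at h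
        exact h.aemeasurable
      · exact Filter.Eventually.of_forall fun e => measure_lt_top _ _
    rw [this, smul_eq_mul]; field_simp
  have h := mem_range_of_exists_le_of_exists_ge hc (exists_le_average hne hint)
    (exists_average_le hne hint)
  rw [hav] at h
  exact h

theorem measureReal_le_of_add_subset_left {X Y Z : Set (AddCircle P)} (hY : Y.Nonempty)
    (h : X + Y ⊆ Z) : volume.real X ≤ volume.real Z := by
  obtain ⟨y, hy⟩ := hY
  have : volume.real X = volume.real ((· + (-y)) ⁻¹' X) := by
    simp [Measure.real, measure_preimage_add_right]
  rw [this]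
  refine measureReal_mono fun x hx => h ?_
  exact ⟨x + -y, hx, y, hy, by simp⟩

/-- Raikov's inequality (the continuous Cauchy-Davenport inequality on the circle). -/
theorem min_le_measureReal_add {X Y : Set (AddCircle P)} (hX : MeasurableSet X)
    (hY : MeasurableSet Y) (hXne : X.Nonempty) (hYne : Y.Nonempty) :
    min P (volume.real X + volume.real Y) ≤ volume.real (X + Y) := by
  by_contra! hlt
  set c := volume.real X + volume.real Y with hc
  set v := volume.real (X + Y) with hv
  have hvP : v < P := hlt.trans_le (min_le_left _ _)
  have hvc : v < c := hlt.trans_le (min_le_right _ _)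
  have hP0 := hP.out
  have hXv : volume.real X ≤ v := measureReal_le_of_add_subset_left hYne le_rfl
  have hYv : volume.real Y ≤ v := measureReal_le_of_add_subset_left hXne (by rw [add_comm])
  have hε : 0 < (c - v) * (1 - v / P) := by
    refine mul_pos (by linarith) ?_
    rw [sub_pos, div_lt_one hP0]; exact hvP
  have key : ∀ n : ℕ, ∃ X' Y' : Set (AddCircle P), MeasurableSet X' ∧ MeasurableSet Y' ∧
      X' + Y' ⊆ X + Y ∧ volume.real X' + volume.real Y' = c ∧ 0 < volume.real X' ∧
      0 < volume.real Y' ∧ n * ((c - v) * (1 - v / P)) ≤ volume.real X' := by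
    intro n
    induction n with
    | zero =>
      exact ⟨X, Y, hX, hY, le_rfl, hc.symm, by linarith, by linarith, by simp⟩
    | succ n ih =>
      obtain ⟨X', Y', hX', hY', hsub, hsum, hXp, hYp, hn⟩ := ih
      obtain ⟨e, he⟩ := exists_measureReal_inter_preimage_add_eq hX' hY'
      have hYpre : MeasurableSet ((· + (-e)) ⁻¹' Y') := hY'.preimage (measurable_add_const _)
      have hXpre : MeasurableSet ((· + e) ⁻¹' X') := hX'.preimage (measurable_add_const _)
      have hne : ∀ {W : Set (AddCircle P)}, 0 < volume.real W → W.Nonempty := by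
        intro W hW
        rw [nonempty_iff_ne_empty]; rintro rfl; simp at hW
      have hXv' : volume.real X' ≤ v := measureReal_le_of_add_subset_left (hne hYp) hsub
      have hinter : volume.real (X' ∩ (· + (-e)) ⁻¹' Y') = volume.real (Y' ∩ (· + e) ⁻¹' X') := by
        have : (· + e) ⁻¹' (X' ∩ (· + (-e)) ⁻¹' Y') = Y' ∩ (· + e) ⁻¹' X' := by
          ext z; simp [and_comm]
        rw [← this]; simp only [Measure.real, measure_preimage_add_right]
      have hunion :
          volume.real (X' ∪ (· + (-e)) ⁻¹' Y') + volume.real (Y' ∩ (· + e) ⁻¹' X') = c := by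
        rw [← hinter, measureReal_union_add_inter hYpre, ← hsum]
        simp [Measure.real, measure_preimage_add_right]
      refine ⟨X' ∪ (· + (-e)) ⁻¹' Y', Y' ∩ (· + e) ⁻¹' X', hX'.union hYpre, hY'.inter hXpre,
        ?_, hunion, ?_, ?_, ?_⟩
      · rintro _ ⟨x, hx | hx, y, ⟨hy1, hy2⟩, rfl⟩
        · exact hsub ⟨x, hx, y, hy1, rfl⟩
        · exact hsub ⟨y + e, hy2, x + -e, hx, by dsimp only; abel⟩
      · exact hXp.trans_le (measureReal_mono subset_union_left)
      · rw [he]; positivity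
      · rw [he] at hunion
        have h1 : (c - v) * (1 - v / P) ≤ volume.real Y' * (1 - volume.real X' / P) := by
          have h2 : volume.real X' / P ≤ v / P := by gcongr
          have h3 : v / P < 1 := by rwa [div_lt_one hP0]
          refine mul_le_mul (by linarith) (by linarith) (by linarith) hYp.le
        have h4 : volume.real Y' * (1 - volume.real X' / P)
          = volume.real Y' - volume.real X' * volume.real Y' / P := by ring
        push_cast
        linarith
  obtain ⟨n, hn⟩ := exists_nat_gt (v / ((c - v) * (1 - v / P)))
  rw [div_lt_iff₀ hε] at hn
  obtain ⟨X', Y', -, -, hsub, -, -, hYp, hn'⟩ := key n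
  have hY'ne : Y'.Nonempty := by
    rw [nonempty_iff_ne_empty]; rintro rfl; simp at hYp
  have := measureReal_le_of_add_subset_left hY'ne hsub
  linarith

end AddCircle

section WeightedDoubling

open scoped NNReal

theorem setIntegral_indicator_Iic_eq {R k : ℝ} (hk : 0 ≤ k) (hkR : k ≤ R) :
    ∫ u in Ioc 0 R, (Iic k).indicator (1 : ℝ → ℝ) u = k := by
  rw [setIntegral_indicator measurableSet_Iic]
  have : Ioc 0 R ∩ Iic k = Ioc 0 k := by
    ext x; simp only [mem_inter_iff, mem_Ioc, mem_Iic]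
    constructor
    · rintro ⟨⟨h1, h2⟩, h3⟩; exact ⟨h1, h3⟩
    · rintro ⟨h1, h2⟩; exact ⟨⟨h1, h2.trans hkR⟩, h2⟩
  rw [this]
  simp [hk]

/-- Comparison of sums through the cardinalities of superlevel sets. -/
theorem mul_sum_le_sum_of_card_superlevel {H : Type*} [Fintype H] {k n : H → ℝ≥0} {α : ℝ}
    (h : ∀ u : ℝ≥0, 0 < u → α * (Finset.univ.filter fun g => u ≤ k g).card
      ≤ (Finset.univ.filter fun g => u ≤ n g).card) :
    α * ∑ g, (k g : ℝ) ≤ ∑ g, (n g : ℝ) := by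
  set R : ℝ := ∑ g, (k g : ℝ) + ∑ g, (n g : ℝ) with hR
  have key : ∀ f : H → ℝ≥0, (∀ g, (f g : ℝ) ≤ R) →
      ∑ g, (f g : ℝ) =
        ∫ u in Ioc 0 R, ∑ g, (Iic (f g : ℝ)).indicator (1 : ℝ → ℝ) u := by
    intro f hf
    rw [integral_finsetSum]
    · exact Finset.sum_congr rfl fun g _ => (setIntegral_indicator_Iic_eq (f g).2 (hf g)).symm
    · intro g _
      exact (integrable_const (1 : ℝ)).indicator measurableSet_Iic
  have hint : ∀ f : H → ℝ≥0, IntegrableOn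
      (fun u => ∑ g, (Iic (f g : ℝ)).indicator (1 : ℝ → ℝ) u) (Ioc 0 R) := fun f =>
    integrable_finsetSum _ fun g _ => (integrable_const (1 : ℝ)).indicator measurableSet_Iic
  have hle : ∀ (f : H → ℝ≥0) g, (f g : ℝ) ≤ ∑ g, (f g : ℝ) := fun f g =>
    Finset.single_le_sum (f := fun g => (f g : ℝ)) (fun i _ => (f i).2) (Finset.mem_univ g)
  have hpos : ∀ (f : H → ℝ≥0), 0 ≤ ∑ g, (f g : ℝ) := fun f =>
    Finset.sum_nonneg fun i _ => (f i).2
  rw [key k fun g => by linarith [hle k g, hpos n], key n fun g => by linarith [hle n g, hpos k],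
    ← integral_const_mul]
  refine setIntegral_mono_on ((hint k).const_mul α) (hint n) measurableSet_Ioc fun u hu => ?_
  have hcard : ∀ f : H → ℝ≥0, ∑ g, (Iic (f g : ℝ)).indicator (1 : ℝ → ℝ) u
      = (Finset.univ.filter fun g => (⟨u, hu.1.le⟩ : ℝ≥0) ≤ f g).card := by
    intro f
    simp only [indicator, mem_Iic, Pi.one_apply]
    rw [Finset.sum_boole]
    rfl
  rw [hcard, hcard]
  exact h ⟨u, hu.1.le⟩ hu.1

theorem exists_addSubgroup_of_card_add_self_lt {H : Type*} [AddCommGroup H] [Fintype H]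
    [DecidableEq H] {S : Finset H} (h : ((S + S).card : ℝ) < 3 / 2 * S.card) :
    ∃ V : AddSubgroup H, (Nat.card V : ℝ) < 3 / 2 * S.card ∧ ∀ x ∈ S, ∀ y ∈ S, x - y ∈ V := by
  classical
  let A : Finset (Multiplicative H) := S.map Multiplicative.ofAdd.toEmbedding
  have hA : A.card = S.card := Finset.card_map _
  have hAA : (A * A).card = (S + S).card := by
    have : A * A = (S + S).map Multiplicative.ofAdd.toEmbedding := by
      ext z
      simp only [A, Finset.mem_mul, Finset.mem_map, Finset.mem_add]
      constructor
      · rintro ⟨_, ⟨x, hx, rfl⟩, _, ⟨y, hy, rfl⟩, rfl⟩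
        exact ⟨x + y, ⟨x, hx, y, hy, rfl⟩, rfl⟩
      · rintro ⟨_, ⟨x, hx, y, hy, rfl⟩, rfl⟩
        exact ⟨_, ⟨x, hx, rfl⟩, _, ⟨y, hy, rfl⟩, rfl⟩
    rw [this, Finset.card_map]
  have h' : ((A * A).card : ℚ) < (3 / 2 : ℚ) * A.card := by
    rw [hAA, hA]
    have h2 : 2 * (S + S).card < 3 * S.card := by
      have : (2 : ℝ) * (S + S).card < 3 * S.card := by linarith
      exact_mod_cast this
    have h3 : (2 : ℚ) * (S + S).card < 3 * S.card := by exact_mod_cast h2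
    linarith
  obtain ⟨V, _, hV, hsub⟩ := Finset.doubling_lt_three_halves h'
  refine ⟨Subgroup.toAddSubgroup' V, ?_, ?_⟩
  · rw [hA] at hV
    have : Nat.card (Subgroup.toAddSubgroup' V) = Fintype.card V := by
      rw [← Nat.card_eq_fintype_card]; rfl
    rw [this]
    have h2 : 2 * Fintype.card V < 3 * S.card := by
      have : (2 : ℚ) * Fintype.card V < 3 * S.card := by linarith
      exact_mod_cast this
    have h3 : (2 : ℝ) * Fintype.card V < 3 * S.card := by exact_mod_cast h2
    linarith
  · intro x hx y hy
    have hy' : Multiplicative.ofAdd y ∈ A := Finset.mem_map_of_mem _ hy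
    have hx' : Multiplicative.ofAdd x ∈ A := Finset.mem_map_of_mem _ hx
    have := (hsub _ hy').1 hx'
    rw [Set.mem_smul_set_iff_inv_smul_mem] at this
    change (Multiplicative.ofAdd (x - y)) ∈ V
    rw [ofAdd_sub, div_eq_mul_inv, mul_comm]
    simpa using this

theorem two_mul_card_le_card_add {H : Type*} [AddCommGroup H] [DecidableEq H] {T U : Finset H}
    {x y : H} (hx : x ∈ T) (hy : y ∈ T) (hxy : x - y ∉ U - U) : 2 * U.card ≤ (T + U).card := by
  have hdis : Disjoint (x +ᵥ U) (y +ᵥ U) := by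
    rw [Finset.disjoint_left]
    intro z hz hz'
    rw [Finset.mem_vadd_finset] at hz hz'
    obtain ⟨p, hp, rfl⟩ := hz
    obtain ⟨q, hq, hpq⟩ := hz'
    refine hxy (Finset.mem_sub.2 ⟨q, hq, p, hp, ?_⟩)
    simp only [vadd_eq_add] at hpq
    rw [sub_eq_sub_iff_add_eq_add, add_comm q y, hpq]
  calc 2 * U.card = ((x +ᵥ U) ∪ (y +ᵥ U)).card := by
        rw [Finset.card_union_of_disjoint hdis, Finset.card_vadd_finset, Finset.card_vadd_finset,
          two_mul]
    _ ≤ (T + U).card := by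
        refine Finset.card_le_card (Finset.union_subset ?_ ?_)
        · exact Finset.vadd_finset_subset_add hx
        · exact Finset.vadd_finset_subset_add hy

/-- A weighted `3/2`-type doubling estimate in a finite abelian group. -/
theorem three_mul_sum_le_sum_of_generating {H : Type*} [AddCommGroup H] [Fintype H]
    [DecidableEq H] {S : Finset H} (hS : S.Nonempty)
    (hgen : ∀ V : AddSubgroup H, (∀ x ∈ S, ∀ y ∈ S, x - y ∈ V) → V = ⊤)
    (hcard : 3 * S.card ≤ 2 * Fintype.card H) {f c : H → ℝ≥0} (hf : ∀ i, i ∉ S → f i = 0)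
    (hc : ∀ i ∈ S, ∀ j ∈ S, f i + f j ≤ c (i + j)) :
    3 * ∑ g, (f g : ℝ) ≤ ∑ g, (c g : ℝ) := by
  classical
  let L : ℝ≥0 → Finset H := fun u => S.filter fun i => u ≤ f i
  have hLmono : ∀ {u v}, u ≤ v → L v ⊆ L u := fun huv x hx => by
    simp only [L, Finset.mem_filter] at hx ⊢
    exact ⟨hx.1, huv.trans hx.2⟩
  have hLS : ∀ u, L u ⊆ S := fun u => Finset.filter_subset _ _
  -- the last level at which the difference set is still full
  let D : Finset ℝ≥0 := (S.image f).filter fun u => S - S ⊆ L u - L u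
  have hD : D.Nonempty := by
    obtain ⟨i, hi, hmin⟩ := S.exists_min_image f hS
    refine ⟨f i, Finset.mem_filter.2 ⟨Finset.mem_image_of_mem f hi, ?_⟩⟩
    have : L (f i) = S := Finset.filter_true_of_mem hmin
    rw [this]
  obtain ⟨us, husD, hus⟩ := D.exists_max_image id hD
  simp only [id] at hus
  have hTT : S - S ⊆ L us - L us := (Finset.mem_filter.1 husD).2
  have hlow : ∀ t ≤ us, S - S ⊆ L t - L t := fun t ht =>
    hTT.trans (Finset.sub_subset_sub (hLmono ht) (hLmono ht))
  have hhigh : ∀ u, us < u → ¬ S - S ⊆ L u - L u := by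
    intro u hu hsub
    have hne : (L u).Nonempty := by
      have : (L u - L u).Nonempty := (hS.sub hS).mono hsub
      exact this.of_sub_left
    obtain ⟨i, hi, hmin⟩ := (L u).exists_min_image f hne
    have hi' := Finset.mem_filter.1 hi
    have hsame : L u ⊆ L (f i) := fun x hx =>
      Finset.mem_filter.2 ⟨hLS _ hx, hmin x hx⟩
    have : f i ∈ D := Finset.mem_filter.2 ⟨Finset.mem_image_of_mem f hi'.1,
      hsub.trans (Finset.sub_subset_sub hsame hsame)⟩
    exact absurd (hus _ this) (not_le.2 (hu.trans_le hi'.2))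
  obtain ⟨i₀, hi₀, hmax⟩ := S.exists_max_image f hS
  have hus0 : us ≤ f i₀ := by
    obtain ⟨j, hj, hj'⟩ := Finset.mem_image.1 (Finset.mem_filter.1 husD).1
    rw [← hj']; exact hmax j hj
  let h : H → ℝ≥0 := fun g => min (f g) us
  let k : H → ℝ≥0 := fun g => f g - us
  let m : H → ℝ≥0 := fun g =>
    ((S ×ˢ S).filter fun p => p.1 + p.2 = g).sup fun p => min (h p.1) (h p.2)
  let n : H → ℝ≥0 := fun g =>
    ((L us ×ˢ S).filter fun p => p.1 + p.2 = g).sup fun p => k p.2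
  have hmem : ∀ {u g}, 0 < u → u ≤ f g → g ∈ S := fun hu hg => by
    by_contra hgS
    rw [hf _ hgS] at hg
    exact absurd hg (not_le.2 hu)
  have hm : (3 / 2 : ℝ) * ∑ g, (h g : ℝ) ≤ ∑ g, (m g : ℝ) := by
    refine mul_sum_le_sum_of_card_superlevel fun u hu => ?_
    by_cases huu : u ≤ us
    · have h1 : (Finset.univ.filter fun g => u ≤ h g) = L u := by
        ext g
        simp only [h, L, Finset.mem_filter, Finset.mem_univ, true_and, le_min_iff]
        exact ⟨fun hg => ⟨hmem hu hg.1, hg.1⟩, fun hg => ⟨hg.2, huu⟩⟩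
      have h2 : L u + L u ⊆ Finset.univ.filter fun g => u ≤ m g := by
        intro g hg
        obtain ⟨x, hx, y, hy, rfl⟩ := Finset.mem_add.1 hg
        refine Finset.mem_filter.2 ⟨Finset.mem_univ _, ?_⟩
        have hx' := Finset.mem_filter.1 hx
        have hy' := Finset.mem_filter.1 hy
        have : min (h x) (h y) ≤ m (x + y) :=
          Finset.le_sup (f := fun p : H × H => min (h p.1) (h p.2)) (b := (x, y))
            (Finset.mem_filter.2 ⟨Finset.mem_product.2 ⟨hx'.1, hy'.1⟩, rfl⟩)
        exact (le_min (le_min hx'.2 huu) (le_min hy'.2 huu)).trans this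
      rw [h1]
      refine le_trans ?_ (Nat.cast_le.2 (Finset.card_le_card h2))
      by_contra! hlt
      obtain ⟨V, hV, hVsub⟩ := exists_addSubgroup_of_card_add_self_lt hlt
      have hVtop : V = ⊤ := hgen V fun x hx y hy => by
        obtain ⟨p, hp, q, hq, hpq⟩ := Finset.mem_sub.1 (hlow u huu (Finset.sub_mem_sub hx hy))
        rw [← hpq]; exact hVsub p hp q hq
      subst hVtop
      have h5 : Nat.card (⊤ : AddSubgroup H) = Fintype.card H := by
        rw [AddSubgroup.card_top, Nat.card_eq_fintype_card]
      rw [h5] at hV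
      have h6 : ((L u).card : ℝ) ≤ S.card := Nat.cast_le.2 (Finset.card_le_card (hLS u))
      have h7 : (3 : ℝ) * S.card ≤ 2 * Fintype.card H := by exact_mod_cast hcard
      linarith
    · have h1 : (Finset.univ.filter fun g => u ≤ h g) = ∅ := by
        refine Finset.filter_eq_empty_iff.2 fun g _ hg => huu (hg.trans (min_le_right _ _))
      rw [h1]; simp
  have hn : (2 : ℝ) * ∑ g, (k g : ℝ) ≤ ∑ g, (n g : ℝ) := by
    refine mul_sum_le_sum_of_card_superlevel fun u hu => ?_
    have hiff : ∀ g, u ≤ k g ↔ us + u ≤ f g := fun g => by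
      simp only [k]
      constructor
      · intro hle
        have : us ≤ f g := by
          by_contra! hlt
          rw [tsub_eq_zero_of_le hlt.le] at hle
          exact absurd hle (not_le.2 hu)
        exact (le_tsub_iff_left this).1 hle
      · intro hle
        exact (le_tsub_iff_left (le_self_add.trans hle)).2 hle
    have h1 : (Finset.univ.filter fun g => u ≤ k g) = L (us + u) := by
      ext g
      simp only [L, Finset.mem_filter, Finset.mem_univ, true_and, hiff]
      exact ⟨fun hg => ⟨hmem (add_pos_of_nonneg_of_pos zero_le hu) hg, hg⟩, fun hg => hg.2⟩
    have h2 : L us + L (us + u) ⊆ Finset.univ.filter fun g => u ≤ n g := by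
      intro g hg
      obtain ⟨x, hx, y, hy, rfl⟩ := Finset.mem_add.1 hg
      refine Finset.mem_filter.2 ⟨Finset.mem_univ _, ?_⟩
      have hy' := Finset.mem_filter.1 hy
      have : k y ≤ n (x + y) :=
        Finset.le_sup (f := fun p : H × H => k p.2) (b := (x, y))
          (Finset.mem_filter.2 ⟨Finset.mem_product.2 ⟨hx, hy'.1⟩, rfl⟩)
      exact ((hiff y).2 hy'.2).trans this
    rw [h1]
    refine le_trans ?_ (Nat.cast_le.2 (Finset.card_le_card h2))
    have hnot : ¬ L us - L us ⊆ L (us + u) - L (us + u) := fun hsub =>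
      hhigh (us + u) (lt_add_of_pos_right _ hu) (hTT.trans hsub)
    obtain ⟨z, hz, hz'⟩ := Finset.not_subset.1 hnot
    obtain ⟨x, hx, y, hy, rfl⟩ := Finset.mem_sub.1 hz
    exact_mod_cast two_mul_card_le_card_add hx hy hz'
  have hl : ∑ g, (k (g - i₀) : ℝ) = ∑ g, (k g : ℝ) :=
    Equiv.sum_comp (Equiv.subRight i₀) (fun g => (k g : ℝ))
  have hfhk : ∀ g, (f g : ℝ) = h g + k g := fun g => by
    rw [← NNReal.coe_add]; congr 1
    simp only [h, k]
    rcases le_total (f g) us with hle | hle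
    · rw [min_eq_left hle, tsub_eq_zero_of_le hle, add_zero]
    · rw [min_eq_right hle, add_tsub_cancel_of_le hle]
  have hhS : ∀ g, (h g : ℝ) ≤ us := fun g => NNReal.coe_le_coe.2 (min_le_right _ _)
  have hkle : ∀ g ∈ S, (k g : ℝ) ≤ k i₀ := fun g hg =>
    NNReal.coe_le_coe.2 (tsub_le_tsub_right (hmax g hg) us)
  have hmle : ∀ g, (m g : ℝ) ≤ us := fun g => NNReal.coe_le_coe.2 <|
    Finset.sup_le fun p _ => (min_le_left _ _).trans (min_le_right _ _)
  have hnle : ∀ g, (n g : ℝ) ≤ k i₀ := fun g => NNReal.coe_le_coe.2 <|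
    Finset.sup_le fun p hp =>
      hkle p.2 (Finset.mem_product.1 (Finset.mem_filter.1 hp).1).2
  have hkpos : ∀ g, 0 < k g → g ∈ S ∧ (f g : ℝ) = us + k g := fun g hg => by
    have hlt : us < f g := tsub_pos_iff_lt.1 hg
    refine ⟨hmem (zero_le.trans_lt hlt) le_rfl, ?_⟩
    rw [← NNReal.coe_add]; congr 1
    exact (add_tsub_cancel_of_le hlt.le).symm
  have hpt : ∀ g, 2 * (m g : ℝ) + n g + k (g - i₀) ≤ c g := by
    intro g
    rcases eq_or_lt_of_le (zero_le (a := k (g - i₀))) with hl0 | hl0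
    · rcases eq_or_lt_of_le (zero_le (a := n g)) with hn0 | hn0
      · rw [← hl0, ← hn0]
        rcases ((S ×ˢ S).filter fun p => p.1 + p.2 = g).eq_empty_or_nonempty with he | he
        · have : m g = 0 := by simp only [m]; rw [he]; rfl
          rw [this]; simp
        · obtain ⟨p, hp, hpm⟩ := Finset.exists_mem_eq_sup _ he
            fun p : H × H => min (h p.1) (h p.2)
          have hp' := Finset.mem_filter.1 hp
          have hp'' := Finset.mem_product.1 hp'.1
          have h1 := hc _ hp''.1 _ hp''.2
          rw [hp'.2] at h1
          have h2 : m g ≤ f p.1 := hpm.le.trans ((min_le_left _ _).trans (min_le_left _ _))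
          have h3 : m g ≤ f p.2 := hpm.le.trans ((min_le_right _ _).trans (min_le_left _ _))
          have h1' : (f p.1 : ℝ) + f p.2 ≤ c g := by exact_mod_cast h1
          have h2' : (m g : ℝ) ≤ f p.1 := by exact_mod_cast h2
          have h3' : (m g : ℝ) ≤ f p.2 := by exact_mod_cast h3
          simp only [NNReal.coe_zero]
          linarith
      · rw [← hl0]
        rcases ((L us ×ˢ S).filter fun p => p.1 + p.2 = g).eq_empty_or_nonempty with he | he
        · have : n g = 0 := by simp only [n]; rw [he]; rfl
          exact absurd this hn0.ne'
        · obtain ⟨p, hp, hpn⟩ := Finset.exists_mem_eq_sup _ he fun p : H × H => k p.2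
          have hp' := Finset.mem_filter.1 hp
          have hp'' := Finset.mem_product.1 hp'.1
          have h1 := hc _ (hLS _ hp''.1) _ hp''.2
          rw [hp'.2] at h1
          have hng : n g = k p.2 := hpn
          have h2 := (hkpos p.2 (hng ▸ hn0)).2
          have h3 : (us : ℝ) ≤ f p.1 := by exact_mod_cast (Finset.mem_filter.1 hp''.1).2
          have h1' : (f p.1 : ℝ) + f p.2 ≤ c g := by exact_mod_cast h1
          rw [hng]
          have := hmle g
          simp only [NNReal.coe_zero]
          linarith
    · obtain ⟨h1, h2⟩ := hkpos _ hl0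
      have h3 := hc _ hi₀ _ h1
      rw [add_sub_cancel] at h3
      have h3' : (f i₀ : ℝ) + f (g - i₀) ≤ c g := by exact_mod_cast h3
      have h4 : (f i₀ : ℝ) = us + k i₀ := by
        rw [← NNReal.coe_add]; congr 1
        exact (add_tsub_cancel_of_le hus0).symm
      have := hmle g
      have := hnle g
      linarith
  have hsum : ∑ g, (2 * (m g : ℝ) + n g + k (g - i₀)) ≤ ∑ g, (c g : ℝ) :=
    Finset.sum_le_sum fun g _ => hpt g
  rw [Finset.sum_add_distrib, Finset.sum_add_distrib, ← Finset.mul_sum, hl] at hsum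
  have hsf : ∑ g, (f g : ℝ) = ∑ g, (h g : ℝ) + ∑ g, (k g : ℝ) := by
    rw [← Finset.sum_add_distrib]; exact Finset.sum_congr rfl fun g _ => hfhk g
  rw [hsf]
  linarith

/-- An averaging argument over the representations of `g` as a sum of two elements of `S`. -/
theorem exists_representation_le_add {H : Type*} [AddCommGroup H] [Fintype H] [DecidableEq H]
    {S : Finset H} (hcard : 2 * Fintype.card H < 3 * S.card) {f : H → ℝ}
    (hf : ∀ i, i ∉ S → f i = 0) {a : ℝ} (ha : ∀ i, f i ≤ a) (g : H) :
    ∃ n : ℝ, 0 ≤ n ∧ n ≤ Fintype.card H - S.card ∧ n < S.card ∧ ∃ i ∈ S, g - i ∈ S ∧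
      2 * (∑ i, f i - n * a) ≤ (S.card - n) * (f i + f (g - i)) := by
  set T := S.filter fun i => g - i ∈ S with hT
  set U := S.filter fun i => g - i ∉ S with hU
  have hTU : T.card + U.card = S.card := Finset.card_filter_add_card_filter_not _
  have hUc : U.card ≤ Fintype.card H - S.card := by
    rw [← Finset.card_compl]
    refine Finset.card_le_card_of_injOn (fun i => g - i) (fun i hi => ?_)
      (fun x _ y _ hxy => sub_right_injective hxy)
    simpa using (Finset.mem_filter.1 hi).2
  have hSH : S.card ≤ Fintype.card H := Finset.card_le_univ S
  have hUlt : U.card < S.card := by omega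
  have hTc : (T.card : ℝ) = S.card - U.card := by
    rw [eq_sub_iff_add_eq]; exact_mod_cast hTU
  have hTne : T.Nonempty := Finset.card_pos.1 (by omega)
  have hUr : (U.card : ℝ) ≤ Fintype.card H - S.card := by
    have : U.card + S.card ≤ Fintype.card H := by omega
    rw [le_sub_iff_add_le]; exact_mod_cast this
  have hsumT : ∑ i ∈ T, f (g - i) = ∑ i ∈ T, f i := by
    refine Finset.sum_bij' (fun i _ => g - i) (fun i _ => g - i) ?_ ?_ ?_ ?_ ?_
    all_goals simp +contextual [hT]
  have hsumF : ∑ i, f i = ∑ i ∈ T, f i + ∑ i ∈ U, f i := by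
    rw [Finset.sum_filter_add_sum_filter_not]
    exact (Finset.sum_subset (Finset.subset_univ S) fun i _ hi => hf i hi).symm
  have hsumU : ∑ i ∈ U, f i ≤ U.card * a := by
    have := Finset.sum_le_card_nsmul U f a fun i _ => ha i
    simpa using this
  have hex : ∃ i ∈ T, 2 * (∑ i, f i - U.card * a) / T.card ≤ f i + f (g - i) := by
    refine Finset.exists_le_of_sum_le hTne ?_
    rw [Finset.sum_const, nsmul_eq_mul, Finset.sum_add_distrib, hsumT]
    have : (T.card : ℝ) ≠ 0 := by exact_mod_cast (Finset.card_pos.2 hTne).ne'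
    rw [mul_div_cancel₀ _ this]
    linarith
  obtain ⟨i, hi, hle⟩ := hex
  have hi' := Finset.mem_filter.1 hi
  refine ⟨U.card, Nat.cast_nonneg _, hUr, by exact_mod_cast hUlt, i, hi'.1, hi'.2, ?_⟩
  have hTpos : (0 : ℝ) < T.card := by exact_mod_cast Finset.card_pos.2 hTne
  rw [div_le_iff₀ hTpos] at hle
  rw [← hTc]; linarith

theorem exists_representation_two_mul_sum_le {H : Type*} [AddCommGroup H] [Fintype H]
    [DecidableEq H] {S : Finset H} (hcard : 2 * Fintype.card H < 3 * S.card) {f : H → ℝ}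
    (hf0 : ∀ i, 0 ≤ f i) (hf : ∀ i, i ∉ S → f i = 0)
    (ha : ∀ i, Fintype.card H * f i ≤ 2 * ∑ i, f i) (g : H) :
    ∃ i ∈ S, g - i ∈ S ∧ 2 * ∑ i, f i ≤ Fintype.card H * (f i + f (g - i)) := by
  have hM : (0 : ℝ) < Fintype.card H := by exact_mod_cast Fintype.card_pos_iff.2 ⟨g⟩
  set F := ∑ i, f i with hF
  set M : ℝ := (Fintype.card H : ℝ)
  have ha' : ∀ i, f i ≤ 2 * F / M := fun i => by
    rw [le_div_iff₀ hM]; linarith [ha i]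
  obtain ⟨n, hn0, hnq, hnS, i, hi, hi', hle⟩ := exists_representation_le_add hcard hf ha' g
  refine ⟨i, hi, hi', ?_⟩
  have hF0 : 0 ≤ F := Finset.sum_nonneg fun i _ => hf0 i
  have hpos : (0 : ℝ) < S.card - n := by linarith
  refine le_of_mul_le_mul_left ?_ hpos
  have h1 : M * (2 * (F - n * (2 * F / M))) = 2 * M * F - 4 * n * F := by
    field_simp; ring
  have h2 := mul_le_mul_of_nonneg_left hle hM.le
  rw [h1] at h2
  have h3 : 0 ≤ F * (M - S.card - n) := mul_nonneg hF0 (by linarith)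
  nlinarith

/-- Either the sums are large, or the weights are close to being equidistributed. -/
theorem three_mul_sum_le_sum_or_equidistributed {H : Type*} [AddCommGroup H] [Fintype H]
    [DecidableEq H] {S : Finset H} (hS : S.Nonempty)
    (hgen : ∀ V : AddSubgroup H, (∀ x ∈ S, ∀ y ∈ S, x - y ∈ V) → V = ⊤)
    {f c : H → ℝ} (hf0 : ∀ i, 0 ≤ f i) (hc0 : ∀ i, 0 ≤ c i) (hf : ∀ i, i ∉ S → f i = 0)
    (hc : ∀ i ∈ S, ∀ j ∈ S, f i + f j ≤ c (i + j)) :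
    3 * ∑ g, f g ≤ ∑ g, c g ∨ (2 * Fintype.card H < 3 * S.card ∧
      ∀ i, Fintype.card H * f i ≤ 2 * ∑ g, f g) := by
  by_cases hcard : 3 * S.card ≤ 2 * Fintype.card H
  · left
    have := three_mul_sum_le_sum_of_generating (f := fun i => (f i).toNNReal)
      (c := fun i => (c i).toNNReal) hS hgen hcard (fun i hi => by simp [hf i hi])
      (fun i hi j hj => by
        rw [← Real.toNNReal_add (hf0 i) (hf0 j)]
        exact Real.toNNReal_le_toNNReal (hc i hi j hj))
    simpa [Real.coe_toNNReal _ (hf0 _), Real.coe_toNNReal _ (hc0 _)] using this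
  rw [not_le] at hcard
  by_cases hall : ∀ i, Fintype.card H * f i ≤ 2 * ∑ g, f g
  · exact Or.inr ⟨hcard, hall⟩
  left
  obtain ⟨i₀, hi₀, hmax⟩ := S.exists_max_image f hS
  set a := f i₀ with ha
  set F := ∑ g, f g with hF
  set M : ℝ := (Fintype.card H : ℝ) with hM
  have hmax' : ∀ i, f i ≤ a := fun i => by
    by_cases hi : i ∈ S
    · exact hmax i hi
    · rw [hf i hi]; exact hf0 _
  have hMa : 2 * F < M * a := by
    push Not at hall
    obtain ⟨i, hi⟩ := hall
    exact hi.trans_le (mul_le_mul_of_nonneg_left (hmax' i) (Nat.cast_nonneg _))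
  set U := S.image fun g => i₀ + g with hU
  have hUcard : U.card = S.card := Finset.card_image_of_injective _ (add_right_injective i₀)
  have hsumU : S.card * a + F ≤ ∑ g ∈ U, c g := by
    rw [hU, Finset.sum_image (fun x _ y _ hxy => add_right_injective i₀ hxy)]
    have h1 : ∑ g ∈ S, (a + f g) ≤ ∑ g ∈ S, c (i₀ + g) :=
      Finset.sum_le_sum fun g hg => hc i₀ hi₀ g hg
    rw [Finset.sum_add_distrib, Finset.sum_const, nsmul_eq_mul] at h1
    have h2 : ∑ g ∈ S, f g = F := Finset.sum_subset (Finset.subset_univ S) fun i _ hi => hf i hi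
    rw [h2] at h1
    exact h1
  have hsplit : ∑ g, c g = ∑ g ∈ U, c g + ∑ g ∈ Uᶜ, c g := (Finset.sum_add_sum_compl U c).symm
  have hcpos : 0 ≤ ∑ g ∈ Uᶜ, c g := Finset.sum_nonneg fun i _ => hc0 i
  rcases le_or_gt (2 * F) (S.card * a) with h2 | h2
  · linarith
  have hq : (Uᶜ.card : ℝ) = M - S.card := by
    rw [Finset.card_compl, Nat.cast_sub (Finset.card_le_univ _), hUcard]
  have hq0 : (0 : ℝ) ≤ M - S.card := by rw [← hq]; positivity
  have hcM : 2 * M < 3 * S.card := by rw [hM]; exact_mod_cast hcard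
  have ha0 : 0 ≤ a := hf0 _
  have hcg : ∀ g, 2 * F - S.card * a ≤ (M - S.card) * c g := by
    intro g
    obtain ⟨n, hn0, hnq, hnS, i, hi, hi', hle⟩ := exists_representation_le_add hcard hf hmax' g
    have h3 := hc i hi _ hi'
    rw [add_sub_cancel] at h3
    have hpos : (0 : ℝ) < S.card - n := by linarith
    refine le_of_mul_le_mul_left ?_ hpos
    have h4 : 2 * (F - n * a) ≤ (S.card - n) * c g :=
      hle.trans (mul_le_mul_of_nonneg_left h3 hpos.le)
    have h5 := mul_le_mul_of_nonneg_left h4 hq0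
    have h6 : 2 * F - S.card * a ≤ (M - S.card) * a := by linarith
    have h7 := mul_le_mul_of_nonneg_left h6 (show (0 : ℝ) ≤ S.card - n - (M - S.card) by linarith)
    have h8 : 0 ≤ (M - S.card) * a * (M - S.card - n) :=
      mul_nonneg (mul_nonneg hq0 ha0) (by linarith)
    nlinarith
  have hsumc : 2 * F - S.card * a ≤ ∑ g ∈ Uᶜ, c g := by
    rcases eq_or_lt_of_le hq0 with hq0' | hq0'
    · exfalso
      nlinarith
    · have h3 : ∑ g ∈ Uᶜ, (2 * F - S.card * a) ≤ ∑ g ∈ Uᶜ, (M - S.card) * c g :=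
        Finset.sum_le_sum fun g _ => hcg g
      rw [Finset.sum_const, nsmul_eq_mul, hq, ← Finset.mul_sum] at h3
      exact le_of_mul_le_mul_left h3 hq0'
  linarith

end WeightedDoubling

namespace AddCircle

theorem measurableSet_image_coe {P : ℝ} {Z : Set ℝ} (hZ : MeasurableSet Z) :
    MeasurableSet (((↑) : ℝ → AddCircle P) '' Z) := by
  have h : ((↑) : ℝ → AddCircle P) ⁻¹' (((↑) : ℝ → AddCircle P) '' Z)
      = ⋃ n : ℤ, (fun x => x + n • P) ⁻¹' Z := by
    ext x
    simp only [mem_preimage, mem_image, mem_iUnion]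
    constructor
    · rintro ⟨z, hz, hzx⟩
      rw [← sub_eq_zero, ← AddCircle.coe_sub, AddCircle.coe_eq_zero_iff] at hzx
      obtain ⟨n, hn⟩ := hzx
      refine ⟨n, ?_⟩
      have : x + n • P = z := by rw [hn]; abel
      rwa [this]
    · rintro ⟨n, hn⟩
      exact ⟨_, hn, by rw [AddCircle.coe_add, AddCircle.coe_zsmul, AddCircle.coe_period,
        smul_zero, add_zero]⟩
  have h2 : MeasurableSet (((↑) : ℝ → AddCircle P) ⁻¹' (((↑) : ℝ → AddCircle P) '' Z)) := by
    rw [h]; exact MeasurableSet.iUnion fun n => hZ.preimage (measurable_add_const _)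
  exact MeasurableSet.congr h2 rfl

variable {P : ℝ} [hP : Fact (0 < P)]

theorem preimage_image_coe_inter_Ioc {a : ℝ} {Z : Set ℝ} (hZ : Z ⊆ Ioc a (a + P)) :
    ((↑) : ℝ → AddCircle P) ⁻¹' (((↑) : ℝ → AddCircle P) '' Z) ∩ Ioc a (a + P) = Z := by
  ext x
  constructor
  · rintro ⟨⟨z, hz, hzx⟩, hx⟩
    rwa [← (coe_eq_coe_iff_of_mem_Ioc (hZ hz) hx).1 hzx]
  · exact fun hx => ⟨⟨x, hx, rfl⟩, hZ hx⟩

theorem volume_eq_volume_preimage_inter (a : ℝ) {U : Set (AddCircle P)} (hU : MeasurableSet U) :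
    volume U = volume (((↑) : ℝ → AddCircle P) ⁻¹' U ∩ Ioc a (a + P)) :=
  add_projection_respects_measure P a hU

theorem volume_image_coe_of_subset_Ioc {a : ℝ} {Z : Set ℝ} (hZm : MeasurableSet Z)
    (hZ : Z ⊆ Ioc a (a + P)) : volume (((↑) : ℝ → AddCircle P) '' Z) = volume Z := by
  rw [volume_eq_volume_preimage_inter a (measurableSet_image_coe hZm),
    preimage_image_coe_inter_Ioc hZ]

theorem volume_image_coe_le (Z : Set ℝ) :
    volume (((↑) : ℝ → AddCircle P) '' Z) ≤ volume Z := by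
  set W := toMeasurable volume Z
  have hW : MeasurableSet W := measurableSet_toMeasurable _ _
  have hI : ∀ n : ℤ, MeasurableSet (W ∩ Ioc (0 + n • P) (0 + (n + 1) • P)) := fun n =>
    hW.inter measurableSet_Ioc
  have hWu : W = ⋃ n : ℤ, W ∩ Ioc (0 + n • P) (0 + (n + 1) • P) := by
    rw [← inter_iUnion, iUnion_Ioc_add_zsmul hP.out, inter_univ]
  calc volume (((↑) : ℝ → AddCircle P) '' Z)
      ≤ volume (((↑) : ℝ → AddCircle P) '' W) :=
        measure_mono (image_mono (subset_toMeasurable _ _))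
    _ ≤ ∑' n : ℤ, volume (((↑) : ℝ → AddCircle P) '' (W ∩ Ioc (0 + n • P) (0 + (n + 1) • P))) := by
        conv_lhs => rw [hWu, image_iUnion]
        exact measure_iUnion_le _
    _ = ∑' n : ℤ, volume (W ∩ Ioc (0 + n • P) (0 + (n + 1) • P)) := by
        refine tsum_congr fun n => volume_image_coe_of_subset_Ioc (a := 0 + n • P) (hI n) ?_
        refine inter_subset_right.trans (Ioc_subset_Ioc_right ?_)
        rw [add_smul, one_smul, add_assoc]
    _ = volume W := by
        conv_rhs => rw [hWu]
        refine (measure_iUnion (fun i j hij => ?_) hI).symm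
        exact (pairwise_disjoint_Ioc_add_zsmul (0 : ℝ) P hij).mono inter_subset_right
          inter_subset_right
    _ = volume Z := measure_toMeasurable Z

end AddCircle

/-- The one-dimensional Brunn-Minkowski inequality for bounded measurable sets. -/
theorem Real.volume_real_add_le_of_isBounded {X Y Z : Set ℝ} {a b : ℝ} (hX : MeasurableSet X)
    (hY : MeasurableSet Y) (hXne : X.Nonempty) (hYne : Y.Nonempty) (hXb : X ⊆ Ioc a b)
    (hYb : Y ⊆ Ioc a b) (hZ : X + Y ⊆ Z) (hZf : volume Z ≠ ⊤) :
    volume.real X + volume.real Y ≤ volume.real Z := by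
  have hab : a < b := by
    obtain ⟨x, hx⟩ := hXne
    exact (hXb hx).1.trans_le (hXb hx).2
  have : Fact (0 < 2 * (b - a)) := ⟨by linarith⟩
  let π : ℝ → AddCircle (2 * (b - a)) := (↑)
  have hsub : Ioc a b ⊆ Ioc a (a + 2 * (b - a)) := Ioc_subset_Ioc_right (by linarith)
  have h1 : volume.real (π '' X) = volume.real X := by
    rw [Measure.real, AddCircle.volume_image_coe_of_subset_Ioc hX (hXb.trans hsub), Measure.real]
  have h2 : volume.real (π '' Y) = volume.real Y := by
    rw [Measure.real, AddCircle.volume_image_coe_of_subset_Ioc hY (hYb.trans hsub), Measure.real]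
  have h3 := AddCircle.min_le_measureReal_add (AddCircle.measurableSet_image_coe hX)
    (AddCircle.measurableSet_image_coe (P := 2 * (b - a)) hY) (hXne.image _) (hYne.image _)
  have hlen : ∀ W : Set ℝ, W ⊆ Ioc a b → volume.real W ≤ b - a := fun W hW => by
    refine (measureReal_mono hW (by simp)).trans ?_
    rw [Real.volume_real_Ioc_of_le hab.le]
  rw [h1, h2, min_eq_right (by linarith [hlen X hXb, hlen Y hYb])] at h3
  refine h3.trans ?_
  have h4 : (π '' X) + (π '' Y) ⊆ π '' Z := by
    rintro _ ⟨_, ⟨x, hx, rfl⟩, _, ⟨y, hy, rfl⟩, rfl⟩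
    exact ⟨x + y, hZ (add_mem_add hx hy), rfl⟩
  refine (measureReal_mono h4).trans ?_
  exact ENNReal.toReal_mono hZf (AddCircle.volume_image_coe_le Z)

/-- The homomorphism `ℤ/M → ℝ/(Ms)ℤ` sending `1` to `s`. -/
noncomputable def AddCircle.stepHom (M : ℕ) (s : ℝ) : ZMod M →+ AddCircle (M * s) :=
  ZMod.lift M ⟨zmultiplesHom _ (s : AddCircle (M * s)), by
    rw [zmultiplesHom_apply, natCast_zsmul, ← AddCircle.coe_nsmul, nsmul_eq_mul,
      AddCircle.coe_period]⟩

theorem AddCircle.stepHom_intCast (M : ℕ) (s : ℝ) (k : ℤ) :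
    AddCircle.stepHom M s (k : ZMod M) = ((k * s : ℝ) : AddCircle (M * s)) := by
  rw [AddCircle.stepHom, ZMod.lift_coe]
  simp only [zmultiplesHom_apply]
  rw [← AddCircle.coe_zsmul, zsmul_eq_mul]

theorem AddCircle.stepHom_natCast (M : ℕ) (s : ℝ) (k : ℕ) :
    AddCircle.stepHom M s (k : ZMod M) = ((k * s : ℝ) : AddCircle (M * s)) := by
  have := AddCircle.stepHom_intCast M s k
  simpa using this

theorem AddCircle.stepHom_eq_val (M : ℕ) [NeZero M] (s : ℝ) (g : ZMod M) :
    AddCircle.stepHom M s g = ((g.val * s : ℝ) : AddCircle (M * s)) := by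
  rw [← AddCircle.stepHom_natCast, ZMod.natCast_zmod_val]

theorem ZMod.sum_val {M : ℕ} [NeZero M] {β : Type*} [AddCommMonoid β] (F : ℕ → β) :
    ∑ g : ZMod M, F g.val = ∑ k ∈ Finset.range M, F k := by
  refine Finset.sum_nbij' (fun g => g.val) (fun k => (k : ZMod M)) ?_ ?_ ?_ ?_ ?_
  · intro g _; exact Finset.mem_range.2 (ZMod.val_lt g)
  · intro k _; exact Finset.mem_univ _
  · intro g _; exact ZMod.natCast_zmod_val g
  · intro k hk; exact ZMod.val_cast_of_lt (Finset.mem_range.1 hk)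
  · intro g _; rfl

theorem volume_inter_Ioc_add_mul (s a : ℝ) (hs : 0 ≤ s) (E : Set ℝ) (n : ℕ) :
    volume (E ∩ Ioc a (a + n * s)) =
      ∑ k ∈ Finset.range n, volume (E ∩ Ioc (a + k * s) (a + (k + 1) * s)) := by
  induction n with
  | zero => simp
  | succ n ih =>
    rw [Finset.sum_range_succ, ← ih]
    have h : E ∩ Ioc a (a + (n + 1 : ℕ) * s) ∩ Iic (a + n * s) = E ∩ Ioc a (a + n * s) := by
      rw [inter_assoc, Ioc_inter_Iic, min_eq_right]
      push_cast; nlinarith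
    have hdiff : (E ∩ Ioc a (a + (n + 1 : ℕ) * s)) \ Iic (a + n * s)
        = E ∩ Ioc (a + n * s) (a + (n + 1) * s) := by
      ext x
      simp only [mem_sdiff, mem_inter_iff, mem_Ioc, mem_Iic, not_le]
      push_cast
      have : 0 ≤ n * s := by positivity
      constructor
      · rintro ⟨⟨h1, h2, h3⟩, h4⟩; exact ⟨h1, h4, h3⟩
      · rintro ⟨h1, h2, h3⟩; exact ⟨⟨h1, by linarith, h3⟩, h2⟩
    rw [← measure_inter_add_sdiff (E ∩ Ioc a (a + (n + 1 : ℕ) * s)) (measurableSet_Iic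
      (a := a + n * s)), h, hdiff]

/-- Decomposition of a subset of `ℝ/(Ms)ℤ` into rows indexed by `ℤ/M`. -/
theorem AddCircle.volume_eq_sum_rows {M : ℕ} [NeZero M] {s : ℝ} [Fact (0 < M * s)] (a : ℝ)
    {E : Set (AddCircle (M * s))} (hE : MeasurableSet E) :
    volume E = ∑ g : ZMod M, volume
      {y : ℝ | y ∈ Ioc a (a + s) ∧ AddCircle.stepHom M s g + (y : AddCircle (M * s)) ∈ E} := by
  have hs : 0 ≤ s := by
    have h1 : 0 < M * s := Fact.out
    have h2 : (0 : ℝ) < M := by exact_mod_cast NeZero.pos M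
    exact (pos_of_mul_pos_right h1 h2.le).le
  rw [volume_eq_volume_preimage_inter a hE, volume_inter_Ioc_add_mul _ _ hs,
    ← ZMod.sum_val (M := M) fun k => volume (((↑) : ℝ → AddCircle (M * s)) ⁻¹' E ∩
      Ioc (a + k * s) (a + (k + 1) * s))]
  refine Finset.sum_congr rfl fun g _ => ?_
  rw [← measure_preimage_add_right volume (g.val * s : ℝ)]
  congr 1
  ext y
  simp only [mem_preimage, mem_inter_iff, mem_Ioc, mem_ofPred_eq, stepHom_eq_val,
    ← AddCircle.coe_add]
  rw [and_comm, add_comm y]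
  refine and_congr ⟨fun h => ⟨by linarith [h.1], by linarith [h.2]⟩,
    fun h => ⟨by linarith [h.1], by linarith [h.2]⟩⟩ Iff.rfl

/-- Gluing a family of rows indexed by `ℤ/M` into subsets of the long circle `ℝ/(Mℓ)ℤ`: going once
along a row of length `ℓ` moves the row index by `w`. -/
def foldRows {M : ℕ} (ℓ : ℝ) (w : ZMod M) (B : ZMod M → Set ℝ) (g : ZMod M) :
    Set (AddCircle (M * ℓ)) :=
  ⋃ j : ZMod M, (fun y : ℝ => AddCircle.stepHom M ℓ j + (y : AddCircle (M * ℓ))) '' B (g - j * w)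

theorem foldRows_add_subset {M : ℕ} {ℓ : ℝ} {w : ZMod M} {B C : ZMod M → Set ℝ}
    (h : ∀ i j, B i + B j ⊆ C (i + j)) (g g' : ZMod M) :
    foldRows ℓ w B g + foldRows ℓ w B g' ⊆ foldRows ℓ w C (g + g') := by
  rintro _ ⟨x, hx, y, hy, rfl⟩
  obtain ⟨i, p, hp, rfl⟩ := mem_iUnion.1 hx
  obtain ⟨j, q, hq, rfl⟩ := mem_iUnion.1 hy
  refine mem_iUnion.2 ⟨i + j, p + q, ?_, ?_⟩
  · have : g + g' - (i + j) * w = (g - i * w) + (g' - j * w) := by ring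
    rw [this]
    exact h _ _ (add_mem_add hp hq)
  · simp only [map_add, AddCircle.coe_add]
    abel

theorem image_stepHom_add_coe {M : ℕ} {ℓ : ℝ} (j : ZMod M) (Z : Set ℝ) :
    (fun y : ℝ => AddCircle.stepHom M ℓ j + (y : AddCircle (M * ℓ))) '' Z =
      (fun x => -AddCircle.stepHom M ℓ j + x) ⁻¹' (((↑) : ℝ → AddCircle (M * ℓ)) '' Z) := by
  ext x
  simp only [mem_image, mem_preimage]
  refine exists_congr fun y => and_congr_right fun _ => ?_
  rw [eq_comm, eq_comm (a := (y : AddCircle (M * ℓ))), neg_add_eq_iff_eq_add]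

theorem foldRows_subset_foldRows {M : ℕ} {ℓ : ℝ} {w : ZMod M} (C : ZMod M → Set ℝ)
    (g : ZMod M) :
    foldRows ℓ w C g ⊆
      foldRows ℓ w (fun h => (C h ∩ Iio ℓ) ∪ (fun y => ℓ + y) ⁻¹' (C (h + w) ∩ Ici ℓ)) g := by
  intro x hx
  obtain ⟨j, y, hy, rfl⟩ := mem_iUnion.1 hx
  rcases lt_or_ge y ℓ with hyl | hyl
  · exact mem_iUnion.2 ⟨j, y, Or.inl ⟨hy, hyl⟩, rfl⟩
  · refine mem_iUnion.2 ⟨j + 1, y - ℓ, Or.inr ?_, ?_⟩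
    · have : g - (j + 1) * w + w = g - j * w := by ring
      simp only [mem_preimage, this, add_sub_cancel]
      exact ⟨hy, hyl⟩
    · have h1 := AddCircle.stepHom_natCast M ℓ 1
      simp only [Nat.cast_one, one_mul] at h1
      simp only [map_add, h1, AddCircle.coe_sub]
      abel

theorem measurableSet_foldRows {M : ℕ} [NeZero M] {ℓ : ℝ} {w : ZMod M} {B : ZMod M → Set ℝ}
    (hB : ∀ g, MeasurableSet (B g)) (g : ZMod M) :
    MeasurableSet (foldRows ℓ w B g) := by
  refine MeasurableSet.iUnion fun j => ?_
  rw [image_stepHom_add_coe]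
  exact (AddCircle.measurableSet_image_coe (hB _)).preimage (measurable_const_add _)

section

variable {M : ℕ} [NeZero M] {ℓ : ℝ} [hMℓ : Fact (0 < M * ℓ)] {w : ZMod M} {B : ZMod M → Set ℝ}

theorem volume_foldRows_le (g : ZMod M) :
    volume (foldRows ℓ w B g) ≤ ∑ j : ZMod M, volume (B (g - j * w)) := by
  refine (measure_iUnion_fintype_le _ _).trans (Finset.sum_le_sum fun j _ => ?_)
  rw [image_stepHom_add_coe, measure_preimage_add]
  exact AddCircle.volume_image_coe_le _

theorem le_volume_foldRows (hB : ∀ g, MeasurableSet (B g)) (hBsub : ∀ g, B g ⊆ Icc 0 ℓ)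
    (g : ZMod M) : ∑ j : ZMod M, volume (B (g - j * w)) ≤ volume (foldRows ℓ w B g) := by
  rw [AddCircle.volume_eq_sum_rows 0 (measurableSet_foldRows hB g)]
  refine Finset.sum_le_sum fun j _ => ?_
  have h0 : volume (B (g - j * w)) = volume (B (g - j * w) \ {0}) :=
    (measure_sdiff_null (measure_singleton 0)).symm
  rw [h0]
  refine measure_mono fun y hy => ⟨?_, mem_iUnion.2 ⟨j, y, hy.1, rfl⟩⟩
  have := hBsub _ hy.1
  exact ⟨lt_of_le_of_ne this.1 (Ne.symm hy.2), by linarith [this.2]⟩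

end

theorem ZMod.sum_sum_sub_mul {M : ℕ} [NeZero M] (F : ZMod M → ℝ) (w : ZMod M) :
    ∑ g : ZMod M, ∑ j : ZMod M, F (g - j * w) = M * ∑ g, F g := by
  rw [Finset.sum_comm]
  have : ∀ j : ZMod M, ∑ g : ZMod M, F (g - j * w) = ∑ g, F g := fun j =>
    Equiv.sum_comp (Equiv.subRight (j * w)) F
  simp [this, ZMod.card]

/-- The doubling estimate for families of rows. -/
theorem sum_volume_rows_dichotomy {M : ℕ} [NeZero M] {ℓ : ℝ} (hℓ : 0 < ℓ)
    {B C : ZMod M → Set ℝ} (hB : ∀ g, MeasurableSet (B g)) (hBsub : ∀ g, B g ⊆ Icc 0 ℓ)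
    (hC : ∀ g, MeasurableSet (C g)) (hCf : ∀ g, volume (C g) ≠ ⊤)
    (hadd : ∀ i j, B i + B j ⊆ C (i + j)) {u v : ZMod M}
    (hu : ∀ j, volume (B j \ C (u + j)) = 0)
    (hv : ∀ j, volume (B j \ (fun y => ℓ + y) ⁻¹' C (v + j)) = 0)
    (hne : ∃ i, (B i).Nonempty)
    (hgen : ∀ V : AddSubgroup (ZMod M),
      (∀ x y, (B x).Nonempty → (B y).Nonempty → x - y ∈ V) → V = ⊤) :
    3 * ∑ g, volume.real (B g) ≤ ∑ g, volume.real (C g) ∨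
      ∑ g, volume.real (B g) + M * ℓ ≤ ∑ g, volume.real (C g) := by
  classical
  have hMpos : (0 : ℝ) < M := by exact_mod_cast NeZero.pos M
  have hfact : Fact (0 < M * ℓ) := ⟨by positivity⟩
  have hBf : ∀ g, volume (B g) ≠ ⊤ := fun g =>
    ((measure_mono (hBsub g)).trans_lt (by simp)).ne
  set S : Finset (ZMod M) := Finset.univ.filter fun i => (B i).Nonempty with hSdef
  have hSmem : ∀ i, i ∈ S ↔ (B i).Nonempty := fun i => by simp [hSdef]
  have hzero : ∀ i, i ∉ S → volume.real (B i) = 0 := fun i hi => by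
    rw [hSmem, not_nonempty_iff_eq_empty] at hi
    simp [hi]
  have hS : S.Nonempty := by
    obtain ⟨i, hi⟩ := hne
    exact ⟨i, (hSmem i).2 hi⟩
  have hdich := three_mul_sum_le_sum_or_equidistributed hS
    (fun V hV => hgen V fun x y hx hy => hV x ((hSmem x).2 hx) y ((hSmem y).2 hy))
    (f := fun g => volume.real (B g)) (c := fun g => volume.real (C g))
    (fun _ => measureReal_nonneg) (fun _ => measureReal_nonneg) hzero
    (fun i hi j hj => by
      have hsub : ∀ g, B g ⊆ Ioc (-1) ℓ := fun g x hx =>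
        ⟨by linarith [(hBsub g hx).1], (hBsub g hx).2⟩
      exact Real.volume_real_add_le_of_isBounded (hB i) (hB j) ((hSmem i).1 hi)
        ((hSmem j).1 hj) (hsub i) (hsub j) (hadd i j) (hCf _))
  rcases hdich with h3 | ⟨hcard, heq⟩
  · exact Or.inl h3
  rw [ZMod.card] at hcard heq
  set F := ∑ g, volume.real (B g) with hF
  set w := v - u with hw
  set B' := foldRows ℓ w B with hB'
  set R : ZMod M → Set ℝ :=
    fun h => (C h ∩ Iio ℓ) ∪ (fun y => ℓ + y) ⁻¹' (C (h + w) ∩ Ici ℓ) with hR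
  have hB'val : ∀ g, volume.real (B' g) = ∑ j : ZMod M, volume.real (B (g - j * w)) := fun g => by
    have := le_antisymm (volume_foldRows_le (ℓ := ℓ) (w := w) (B := B) g)
      (le_volume_foldRows hB hBsub g)
    rw [Measure.real, this, ENNReal.toReal_sum fun j _ => hBf _]
    rfl
  have hB'sum : ∑ g, volume.real (B' g) = M * F := by
    simp_rw [hB'val]
    exact ZMod.sum_sum_sub_mul (fun g => volume.real (B g)) w
  set S' : Finset (ZMod M) := Finset.univ.filter fun i => (B' i).Nonempty with hS'def
  have hS'mem : ∀ i, i ∈ S' ↔ (B' i).Nonempty := fun i => by simp [hS'def]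
  have hSS' : S ⊆ S' := fun i hi => by
    obtain ⟨y, hy⟩ := (hSmem i).1 hi
    exact (hS'mem i).2 ⟨_, mem_iUnion.2 ⟨0, y, by simpa using hy, rfl⟩⟩
  have hcard' : 2 * Fintype.card (ZMod M) < 3 * S'.card := by
    rw [ZMod.card]
    have := Finset.card_le_card hSS'
    omega
  have hbig : ∀ g, min (M * ℓ) (2 * F) ≤ volume.real (foldRows ℓ w C g) := by
    intro g
    obtain ⟨i, hi, hi', hle⟩ := exists_representation_two_mul_sum_le hcard'
      (f := fun g => volume.real (B' g)) (fun _ => measureReal_nonneg)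
      (fun i hi => by
        rw [hS'mem, not_nonempty_iff_eq_empty] at hi
        simp [hi])
      (fun i => by
        rw [hB'sum, ZMod.card, hB'val, Finset.mul_sum]
        refine (Finset.sum_le_card_nsmul _ _ (2 * F) fun j _ => heq _).trans ?_
        rw [Finset.card_univ, ZMod.card, nsmul_eq_mul]
        linarith) g
    rw [hB'sum, ZMod.card] at hle
    have hle' : 2 * F ≤ volume.real (B' i) + volume.real (B' (g - i)) :=
      le_of_mul_le_mul_left (by linarith) hMpos
    have h1 := AddCircle.min_le_measureReal_add (measurableSet_foldRows (ℓ := ℓ) (w := w) hB i)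
      (measurableSet_foldRows (ℓ := ℓ) (w := w) hB (g - i)) ((hS'mem _).1 hi) ((hS'mem _).1 hi')
    have h2 := foldRows_add_subset (ℓ := ℓ) (w := w) hadd i (g - i)
    rw [add_sub_cancel] at h2
    exact (min_le_min le_rfl hle').trans (h1.trans (measureReal_mono h2))
  have hRbound : ∀ h, volume (R h) ≠ ⊤ ∧ volume.real (R h) ≤ volume.real (C h ∩ Iio ℓ) +
      volume.real (C (h + w) ∩ Ici ℓ) - volume.real (B (h - u)) := by
    intro h
    have hQm : MeasurableSet ((fun y => ℓ + y) ⁻¹' (C (h + w) ∩ Ici ℓ)) :=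
      ((hC _).inter measurableSet_Ici).preimage (measurable_const_add ℓ)
    have hQv : volume ((fun y => ℓ + y) ⁻¹' (C (h + w) ∩ Ici ℓ)) = volume (C (h + w) ∩ Ici ℓ) :=
      measure_preimage_add _ _ _
    have hPf : volume (C h ∩ Iio ℓ) ≠ ⊤ := measure_ne_top_of_subset inter_subset_left (hCf h)
    have hQf : volume ((fun y => ℓ + y) ⁻¹' (C (h + w) ∩ Ici ℓ)) ≠ ⊤ := by
      rw [hQv]; exact measure_ne_top_of_subset inter_subset_left (hCf _)
    refine ⟨measure_union_ne_top hPf hQf, ?_⟩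
    have h1 := measureReal_union_add_inter (μ := volume) (s := C h ∩ Iio ℓ) hQm hPf hQf
    have h2 : volume.real ((fun y => ℓ + y) ⁻¹' (C (h + w) ∩ Ici ℓ))
        = volume.real (C (h + w) ∩ Ici ℓ) := by rw [Measure.real, hQv]; rfl
    have h3 : volume.real (B (h - u)) ≤ volume.real
        ((C h ∩ Iio ℓ) ∩ (fun y => ℓ + y) ⁻¹' (C (h + w) ∩ Ici ℓ)) := by
      refine ENNReal.toReal_mono (measure_ne_top_of_subset inter_subset_left hPf) ?_
      have hnull : volume (B (h - u) \ ((C h ∩ Iio ℓ) ∩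
          (fun y => ℓ + y) ⁻¹' (C (h + w) ∩ Ici ℓ))) = 0 := by
        have hu' := hu (h - u)
        have hv' := hv (h - u)
        rw [add_sub_cancel] at hu'
        have hvw : v + (h - u) = h + w := by rw [hw]; ring
        rw [hvw] at hv'
        refine measure_mono_null (t := (B (h - u) \ C h) ∪
          (B (h - u) \ (fun y => ℓ + y) ⁻¹' C (h + w)) ∪ {ℓ}) ?_
          (measure_union_null (measure_union_null hu' hv') (measure_singleton ℓ))
        rintro y ⟨hy, hy'⟩
        by_contra hcon
        simp only [mem_union, mem_sdiff, mem_preimage, mem_singleton_iff, not_or, not_and,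
          not_not] at hcon
        refine hy' ⟨⟨hcon.1.1 hy, lt_of_le_of_ne (hBsub _ hy).2 hcon.2⟩, hcon.1.2 hy, ?_⟩
        simp only [mem_Ici]
        linarith [(hBsub _ hy).1]
      exact measure_mono_ae (ae_le_set.2 hnull)
    linarith
  have hCsplit : ∀ h, volume.real (C h) =
      volume.real (C h ∩ Iio ℓ) + volume.real (C h ∩ Ici ℓ) := fun h => by
    rw [← measureReal_inter_add_sdiff (s := C h) (measurableSet_Iio (a := ℓ)) (hCf h), ← compl_Iio]
    rfl
  have hRsum : ∑ h, volume.real (R h) ≤ ∑ h, volume.real (C h) - F := by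
    refine (Finset.sum_le_sum fun h _ => (hRbound h).2).trans_eq ?_
    rw [Finset.sum_sub_distrib, Finset.sum_add_distrib]
    have e1 : ∑ h, volume.real (C (h + w) ∩ Ici ℓ) = ∑ h, volume.real (C h ∩ Ici ℓ) :=
      Equiv.sum_comp (Equiv.addRight w) fun h => volume.real (C h ∩ Ici ℓ)
    have e2 : ∑ h, volume.real (B (h - u)) = F :=
      Equiv.sum_comp (Equiv.subRight u) fun h => volume.real (B h)
    rw [e1, e2, ← Finset.sum_add_distrib]
    simp_rw [← hCsplit]
  have hfoldC : ∀ g, volume.real (foldRows ℓ w C g) ≤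
      ∑ j : ZMod M, volume.real (R (g - j * w)) := by
    intro g
    have h1 := (measure_mono (foldRows_subset_foldRows (ℓ := ℓ) (w := w) C g)).trans
      (volume_foldRows_le (ℓ := ℓ) (w := w) (B := R) g)
    have h2 := ENNReal.toReal_mono
      (ENNReal.sum_ne_top.2 fun j _ => (hRbound (g - j * w)).1) h1
    rwa [ENNReal.toReal_sum fun j _ => (hRbound (g - j * w)).1] at h2
  have hfinal : M * min (M * ℓ) (2 * F) ≤ M * (∑ h, volume.real (C h) - F) := by
    calc M * min (M * ℓ) (2 * F) = ∑ g : ZMod M, min (M * ℓ) (2 * F) := by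
          rw [Finset.sum_const, Finset.card_univ, ZMod.card, nsmul_eq_mul]
      _ ≤ ∑ g : ZMod M, ∑ j : ZMod M, volume.real (R (g - j * w)) :=
          Finset.sum_le_sum fun g _ => (hbig g).trans (hfoldC g)
      _ = M * ∑ h, volume.real (R h) := ZMod.sum_sum_sub_mul (fun g => volume.real (R g)) w
      _ ≤ _ := mul_le_mul_of_nonneg_left hRsum hMpos.le
  have hfin := le_of_mul_le_mul_left hfinal hMpos
  rcases min_le_iff.1 hfin with h | h
  · right; linarith
  · left; linarith

/-- If `X + Y ⊆ Z`, then almost all of the translate of `Y` by a limit point of `X` is in `Z`. -/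
theorem volume_sdiff_preimage_add_eq_zero_of_mem_closure {X Y Z : Set ℝ} (h : X + Y ⊆ Z)
    (hY : MeasurableSet Y) (hYf : volume Y ≠ ⊤) {x : ℝ} (hx : x ∈ closure X) :
    volume (Y \ (fun y => x + y) ⁻¹' Z) = 0 := by
  obtain ⟨u, huX, hux⟩ := mem_closure_iff_seq_limit.1 hx
  have h1 := (tendsto_measure_symmDiff_preimage_add_right volume hY hYf (-x)).comp hux.neg
  have h2 : ∀ n, volume (Y \ (fun y => x + y) ⁻¹' Z) ≤
      volume (symmDiff ((· + -u n) ⁻¹' Y) ((· + -x) ⁻¹' Y)) := by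
    intro n
    rw [← measure_preimage_add_right volume (-x) (Y \ (fun y => x + y) ⁻¹' Z)]
    refine measure_mono fun y hy => Or.inr ⟨hy.1, fun hy' => hy.2 ?_⟩
    have h3 := h (add_mem_add (huX n) hy')
    simp only [mem_preimage]
    convert h3 using 1
    ring
  exact le_antisymm (ge_of_tendsto' h1 h2) zero_le

theorem volume_image_coe_add_image_coe_add_le {L : ℝ} [hL : Fact (0 < L)] {A : Set ℝ}
    (hA : MeasurableSet A) (hAsub : A ⊆ Icc 0 L) (h0 : 0 ∈ closure A) (hL' : L ∈ closure A) :
    volume (((↑) : ℝ → AddCircle L) '' A + ((↑) : ℝ → AddCircle L) '' A) + volume A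
      ≤ volume (A + A) := by
  set π : ℝ → AddCircle L := (↑)
  have hAf : volume A ≠ ⊤ := measure_ne_top_of_subset hAsub (by simp)
  set D := toMeasurable volume (A + A)
  have hD : MeasurableSet D := measurableSet_toMeasurable _ _
  have hDsub : A + A ⊆ D := subset_toMeasurable _ _
  have hu := volume_sdiff_preimage_add_eq_zero_of_mem_closure hDsub hA hAf h0
  have hv := volume_sdiff_preimage_add_eq_zero_of_mem_closure hDsub hA hAf hL'
  set Q := (fun y => L + y) ⁻¹' (D ∩ Ici L) with hQ
  have hQm : MeasurableSet Q := (hD.inter measurableSet_Ici).preimage (measurable_const_add L)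
  have hsub : π '' A + π '' A ⊆ π '' ((D ∩ Iio L) ∪ Q) := by
    rintro _ ⟨_, ⟨x, hx, rfl⟩, _, ⟨y, hy, rfl⟩, rfl⟩
    have hxy := hDsub (add_mem_add hx hy)
    rcases lt_or_ge (x + y) L with hlt | hge
    · exact ⟨x + y, Or.inl ⟨hxy, hlt⟩, rfl⟩
    · refine ⟨x + y - L, Or.inr ?_, ?_⟩
      · simp only [hQ, mem_preimage, add_sub_cancel]
        exact ⟨hxy, hge⟩
      · simp only [π, AddCircle.coe_sub, AddCircle.coe_add, AddCircle.coe_period, sub_zero]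
  have hinter : volume A ≤ volume ((D ∩ Iio L) ∩ Q) := by
    refine measure_mono_ae (ae_le_set.2 ?_)
    refine measure_mono_null (t := (A \ (fun y => 0 + y) ⁻¹' D) ∪
      (A \ (fun y => L + y) ⁻¹' D) ∪ {L}) ?_
      (measure_union_null (measure_union_null hu hv) (measure_singleton L))
    rintro y ⟨hy, hy'⟩
    by_contra hcon
    simp only [mem_union, mem_sdiff, mem_preimage, mem_singleton_iff, not_or, not_and,
      not_not, zero_add] at hcon
    refine hy' ⟨⟨hcon.1.1 hy, lt_of_le_of_ne (hAsub hy).2 hcon.2⟩, hcon.1.2 hy, ?_⟩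
    simp only [mem_Ici]
    linarith [(hAsub hy).1]
  calc volume (π '' A + π '' A) + volume A
      ≤ volume ((D ∩ Iio L) ∪ Q) + volume ((D ∩ Iio L) ∩ Q) :=
        add_le_add ((measure_mono hsub).trans (AddCircle.volume_image_coe_le _)) hinter
    _ = volume (D ∩ Iio L) + volume Q := measure_union_add_inter _ hQm
    _ = volume (D ∩ Iio L) + volume (D \ Iio L) := by
        rw [hQ, measure_preimage_add, sdiff_eq, compl_Iio]
    _ = volume D := measure_inter_add_sdiff _ measurableSet_Iio
    _ = volume (A + A) := measure_toMeasurable _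

theorem volume_image_coe_eq_of_subset_Icc {L : ℝ} [hL : Fact (0 < L)] {A : Set ℝ}
    (hA : MeasurableSet A) (hAsub : A ⊆ Icc 0 L) :
    volume (((↑) : ℝ → AddCircle L) '' A) = volume A := by
  refine le_antisymm (AddCircle.volume_image_coe_le A) ?_
  rw [← measure_sdiff_null (s := A) (t := {0}) (measure_singleton 0),
    ← AddCircle.volume_image_coe_of_subset_Ioc (P := L) (a := 0)
      (hA.diff (measurableSet_singleton 0))]
  · exact measure_mono (image_mono sdiff_subset)
  · intro x hx
    exact ⟨lt_of_le_of_ne (hAsub hx.1).1 (Ne.symm hx.2), by linarith [(hAsub hx.1).2]⟩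

/-- A subset of `ℤ/m` together with `0` that lies in a proper subgroup lies in the multiples of
some `d > 1` dividing `m`. -/
theorem ZMod.exists_dvd_of_addSubgroup {m : ℕ} [NeZero m] {V : AddSubgroup (ZMod m)}
    (hV : V ≠ ⊤) : ∃ d : ℕ, 1 < d ∧ d ∣ m ∧ ∀ k : ℤ, (k : ZMod m) ∈ V → (d : ℤ) ∣ k := by
  obtain ⟨a, ha⟩ := Int.subgroup_cyclic (V.comap (Int.castAddHom (ZMod m)))
  have hmem : ∀ k : ℤ, (k : ZMod m) ∈ V ↔ a ∣ k := fun k => by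
    have : k ∈ V.comap (Int.castAddHom (ZMod m)) ↔ (k : ZMod m) ∈ V := Iff.rfl
    rw [← this, ha, AddSubgroup.mem_closure_singleton]
    simp only [smul_eq_mul, dvd_def, mul_comm, eq_comm]
  have hm : a ∣ (m : ℤ) := (hmem m).1 (by simp)
  refine ⟨a.natAbs, ?_, by rwa [← Int.natCast_dvd_natCast, Int.natAbs_dvd], fun k hk => by
    rw [Int.natAbs_dvd]; exact (hmem k).1 hk⟩
  by_contra! hle
  have ha0 : a ≠ 0 := by
    rintro rfl
    rw [zero_dvd_iff] at hm
    exact NeZero.ne m (by exact_mod_cast hm)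
  have ha1 : a.natAbs = 1 := by
    have := Int.natAbs_pos.2 ha0
    omega
  refine hV (eq_top_iff.2 fun x _ => ?_)
  have h := (hmem (x.val : ℤ)).2 (by rw [← Int.natAbs_dvd, ha1]; simp)
  simpa using h

theorem Int.eq_of_abs_mul_sub_lt {s : ℝ} (hs : 0 < s) {n : ℤ} (h : |(n : ℝ) * s| < s) : n = 0 := by
  rw [abs_mul, abs_of_pos hs] at h
  have h1 : |(n : ℝ)| < 1 := by
    by_contra! h1
    nlinarith
  rw [← Int.abs_lt_one_iff]
  exact_mod_cast h1

/-- A set with small doubling contained in a thin neighbourhood of `sℤ`, with `s` maximal, has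
offsets modulo `s` in an interval of the expected length. -/
theorem exists_Icc_of_near_multiples {m : ℕ} [NeZero m] {s : ℝ} (hs : 0 < s) {A : Set ℝ}
    (hA : MeasurableSet A) (hAsub : A ⊆ Icc 0 (m * s)) (h0 : 0 ∈ closure A)
    (hL : m * s ∈ closure A) (hpos : 0 < volume A) (hdbl : volume (A + A) < 4 * volume A)
    (hnear : ∀ x ∈ A, ∃ k : ℤ, |x - k * s| ≤ s / 8)
    (hmin : ∀ d : ℕ, 1 < d → d ∣ m → ¬ ∀ x ∈ A, ∃ k : ℤ, |x - k * (d * s)| ≤ d * s / 8) :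
    ∃ a b : ℝ, a ≤ b ∧ Icc a b ⊆ Icc (-(s / 8)) (s / 8) ∧
      (∀ x ∈ A, ∃ k : ℤ, x - k * s ∈ Icc a b) ∧
      ENNReal.ofReal (m * (b - a)) + 2 * volume A ≤ volume (A + A) := by
  have hmpos : (0 : ℝ) < m := by exact_mod_cast NeZero.pos m
  have hfact : Fact (0 < m * s) := ⟨by positivity⟩
  have hAf : volume A ≠ ⊤ := ((measure_mono hAsub).trans_lt measure_Icc_lt_top).ne
  set π : ℝ → AddCircle (m * s) := (↑) with hπ
  set W := toMeasurable volume (π '' A + π '' A) with hWdef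
  have hW : MeasurableSet W := measurableSet_toMeasurable _ _
  have hWsub : π '' A + π '' A ⊆ W := subset_toMeasurable _ _
  have hWvol : volume W = volume (π '' A + π '' A) := measure_toMeasurable _
  have hπA : MeasurableSet (π '' A) := AddCircle.measurableSet_image_coe hA
  have hπAvol : volume (π '' A) = volume A := volume_image_coe_eq_of_subset_Icc hA hAsub
  let row : Set (AddCircle (m * s)) → ZMod m → Set ℝ := fun E g =>
    {y | y ∈ Ioc (-(s / 2)) (-(s / 2) + s) ∧ AddCircle.stepHom m s g + (y : AddCircle (m * s)) ∈ E}
  have hrowm : ∀ E, MeasurableSet E → ∀ g, MeasurableSet (row E g) := fun E hE g =>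
    measurableSet_Ioc.inter
      (hE.preimage (AddCircle.measurable_mk'.const_add (AddCircle.stepHom m s g)))
  have hrowf : ∀ E g, volume (row E g) ≠ ⊤ := fun E g =>
    ((measure_mono (t := Ioc (-(s / 2)) (-(s / 2) + s)) fun y hy => hy.1).trans_lt
      measure_Ioc_lt_top).ne
  have hrowsum : ∀ E, MeasurableSet E → ∑ g, volume.real (row E g) = volume.real E := fun E hE => by
    rw [Measure.real, AddCircle.volume_eq_sum_rows (-(s / 2)) hE,
      ENNReal.toReal_sum fun g _ => hrowf E g]
    rfl
  set B := row (π '' A) with hB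
  set C := row W with hC
  -- membership in a row of `A`
  have hBmem : ∀ g y, y ∈ B g → |y| ≤ s / 8 ∧ ∃ k : ℤ, (k : ZMod m) = g ∧ k * s + y ∈ A := by
    rintro g y ⟨⟨hy1, hy2⟩, x, hx, hxy⟩
    obtain ⟨k, hk⟩ := hnear x hx
    rw [AddCircle.stepHom_eq_val, ← AddCircle.coe_add, hπ, ← sub_eq_zero, ← AddCircle.coe_sub,
      AddCircle.coe_eq_zero_iff] at hxy
    obtain ⟨n, hn⟩ := hxy
    rw [zsmul_eq_mul] at hn
    have hint : ((k - g.val - n * m : ℤ) : ℝ) * s = y - (x - k * s) := by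
      push_cast; linarith
    rw [abs_le] at hk
    have hzero : k - g.val - n * m = 0 := Int.eq_of_abs_mul_sub_lt hs (by
      rw [hint, abs_lt]; constructor <;> linarith [hk.1, hk.2])
    rw [hzero] at hint
    have hyx : y = x - k * s := by
      simp only [Int.cast_zero, zero_mul] at hint; linarith
    refine ⟨by rw [hyx, abs_le]; exact hk, k, ?_, by rw [hyx]; simpa using hx⟩
    have hk' : k = g.val + n * m := by linarith
    rw [hk']; simp
  have hAmem : ∀ x ∈ A, ∀ k : ℤ, |x - k * s| ≤ s / 8 → x - k * s ∈ B (k : ZMod m) := by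
    intro x hx k hk
    rw [abs_le] at hk
    refine ⟨⟨by linarith [hk.1], by linarith [hk.2]⟩, x, hx, ?_⟩
    rw [AddCircle.stepHom_intCast, ← AddCircle.coe_add, add_sub_cancel]
  set O : Set ℝ := ⋃ g, B g with hO
  have hOsub : O ⊆ Icc (-(s / 8)) (s / 8) := iUnion_subset fun g y hy => abs_le.1 (hBmem g y hy).1
  have hOne : O.Nonempty := by
    obtain ⟨x, hx⟩ := nonempty_of_measure_ne_zero hpos.ne'
    obtain ⟨k, hk⟩ := hnear x hx
    exact ⟨_, mem_iUnion.2 ⟨_, hAmem x hx k hk⟩⟩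
  have hObb : BddBelow O := bddBelow_Icc.mono hOsub
  have hOba : BddAbove O := bddAbove_Icc.mono hOsub
  set a := sInf O with ha
  set b := sSup O with hb
  have hBab : ∀ g, B g ⊆ Icc a b := fun g y hy =>
    ⟨csInf_le hObb (mem_iUnion.2 ⟨g, hy⟩), le_csSup hOba (mem_iUnion.2 ⟨g, hy⟩)⟩
  have hclos : closure O = ⋃ g, closure (B g) := closure_iUnion_of_finite _
  have hac : a ∈ closure O := csInf_mem_closure hOne hObb
  have hbc : b ∈ closure O := csSup_mem_closure hOne hOba
  have hIcc : ∀ y ∈ closure O, y ∈ Icc (-(s / 8)) (s / 8) := fun y hy =>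
    closure_minimal hOsub isClosed_Icc hy
  have hab : a ≤ b := csInf_le_csSup hOne hObb hOba
  obtain ⟨u, hu⟩ := mem_iUnion.1 (hclos ▸ hac)
  obtain ⟨v, hv⟩ := mem_iUnion.1 (hclos ▸ hbc)
  have hBC : ∀ i j, B i + B j ⊆ C (i + j) := by
    rintro i j _ ⟨y, hy, z, hz, rfl⟩
    have h1 := abs_le.1 (hBmem i y hy).1
    have h2 := abs_le.1 (hBmem j z hz).1
    refine ⟨⟨by dsimp only; linarith [h1.1, h2.1], by dsimp only; linarith [h1.2, h2.2]⟩,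
      hWsub ⟨_, hy.2, _, hz.2, ?_⟩⟩
    simp only [map_add, AddCircle.coe_add]
    abel
  have hBm : ∀ g, MeasurableSet (B g) := hrowm _ hπA
  have hCm : ∀ g, MeasurableSet (C g) := hrowm _ hW
  have hBsum : ∑ g, volume.real (B g) = volume.real A := by
    rw [hrowsum _ hπA, Measure.real, hπAvol]; rfl
  have hCsum : ∑ g, volume.real (C g) = volume.real W := hrowsum _ hW
  have hApos : 0 < volume.real A := ENNReal.toReal_pos hpos.ne' hAf
  have hlt : a < b := by
    by_contra! hle
    have hz : ∀ g, volume.real (B g) = 0 := fun g => by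
      refine le_antisymm ?_ measureReal_nonneg
      refine (measureReal_mono (hBab g) (by simp)).trans ?_
      rw [Real.volume_real_Icc]; simp [hle]
    simp only [hz, Finset.sum_const_zero] at hBsum
    linarith
  -- the row containing points close to zero
  have hzero : (B 0).Nonempty := by
    obtain ⟨x, hx, hx'⟩ := Metric.mem_closure_iff.1 h0 (s / 8) (by positivity)
    rw [Real.dist_eq, zero_sub, abs_neg] at hx'
    have := hAmem x hx 0 (by simpa using hx'.le)
    exact ⟨_, by simpa using this⟩
  have hdich := sum_volume_rows_dichotomy (M := m) (ℓ := b - a) (by linarith)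
    (B := fun g => (fun z => a + z) ⁻¹' B g) (C := fun g => (fun z => 2 * a + z) ⁻¹' C g)
    (fun g => (hBm g).preimage (measurable_const_add a))
    (fun g z hz => by
      have := hBab g hz
      exact ⟨by linarith [this.1], by linarith [this.2]⟩)
    (fun g => (hCm g).preimage (measurable_const_add _))
    (fun g => by rw [measure_preimage_add]; exact hrowf _ _)
    (by
      rintro i j _ ⟨y, hy, z, hz, rfl⟩
      have := hBC i j (add_mem_add hy hz)
      simp only [mem_preimage]
      convert this using 1
      ring)
    (u := u) (v := v)
    (fun j => by
      have := volume_sdiff_preimage_add_eq_zero_of_mem_closure (hBC u j) (hBm j) (hrowf _ _) hu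
      rw [← measure_preimage_add volume a] at this
      convert this using 2
      ext z
      simp only [mem_sdiff, mem_preimage]
      rw [show 2 * a + z = a + (a + z) by ring])
    (fun j => by
      have := volume_sdiff_preimage_add_eq_zero_of_mem_closure (hBC v j) (hBm j) (hrowf _ _) hv
      rw [← measure_preimage_add volume a] at this
      convert this using 2
      ext z
      simp only [mem_sdiff, mem_preimage]
      rw [show 2 * a + (b - a + z) = b + (a + z) by ring])
    ⟨0, by
      obtain ⟨y, hy⟩ := hzero
      exact ⟨y - a, by simpa using hy⟩⟩
    (by
      intro V hV
      by_contra hVtop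
      obtain ⟨d, hd1, hdm, hd⟩ := ZMod.exists_dvd_of_addSubgroup hVtop
      refine hmin d hd1 hdm fun x hx => ?_
      obtain ⟨k, hk⟩ := hnear x hx
      have hne : ∀ g, (B g).Nonempty → ((fun z => a + z) ⁻¹' B g).Nonempty := fun g hg => by
        obtain ⟨y, hy⟩ := hg
        exact ⟨y - a, by simpa using hy⟩
      have hkV := hV (k : ZMod m) 0 (hne _ ⟨_, hAmem x hx k hk⟩) (hne _ hzero)
      rw [sub_zero] at hkV
      obtain ⟨q, hq⟩ := hd k hkV
      refine ⟨q, ?_⟩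
      have : (k : ℝ) * s = q * (d * s) := by rw [hq]; push_cast; ring
      rw [← this]
      refine hk.trans ?_
      have : (1 : ℝ) ≤ d := by exact_mod_cast hd1.le
      gcongr
      nlinarith)
  have hB' : ∀ g, volume.real ((fun z => a + z) ⁻¹' B g) = volume.real (B g) := fun g => by
    simp only [Measure.real, measure_preimage_add]
  have hC' : ∀ g, volume.real ((fun z => 2 * a + z) ⁻¹' C g) = volume.real (C g) := fun g => by
    simp only [Measure.real, measure_preimage_add]
  simp only [hB', hC', hBsum, hCsum] at hdich
  have hfold := volume_image_coe_add_image_coe_add_le hA hAsub h0 hL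
  change volume (π '' A + π '' A) + volume A ≤ volume (A + A) at hfold
  rw [← hWvol] at hfold
  have hAAf : volume (A + A) ≠ ⊤ := (hdbl.trans_le le_top).ne
  have hWf : volume W ≠ ⊤ := measure_ne_top _ _
  have hWr : volume W = ENNReal.ofReal (volume.real W) := (ENNReal.ofReal_toReal hWf).symm
  have hAr : volume A = ENNReal.ofReal (volume.real A) := (ENNReal.ofReal_toReal hAf).symm
  refine ⟨a, b, hab, fun y hy => ⟨(hIcc a hac).1.trans hy.1, hy.2.trans (hIcc b hbc).2⟩,
    fun x hx => ?_, ?_⟩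
  · obtain ⟨k, hk⟩ := hnear x hx
    exact ⟨k, hBab _ (hAmem x hx k hk)⟩
  rcases hdich with h3 | h3
  · exfalso
    refine absurd (hfold.trans_lt hdbl) (not_lt.2 ?_)
    rw [hWr, hAr, show (4 : ENNReal) = ENNReal.ofReal 4 by simp,
      ← ENNReal.ofReal_mul (by norm_num), ← ENNReal.ofReal_add measureReal_nonneg hApos.le]
    exact ENNReal.ofReal_le_ofReal (by linarith)
  · refine le_trans ?_ hfold
    rw [two_mul, ← add_assoc]
    gcongr
    rw [hWr, hAr, ← ENNReal.ofReal_add (by nlinarith) hApos.le]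
    exact ENNReal.ofReal_le_ofReal (by linarith)

section Growth

open Finset

variable {G : Type*} [AddCommGroup G] [DecidableEq G]

/-- The `r`-fold sumset of `A`. -/
def iterSumset (A : Finset G) : ℕ → Finset G
  | 0 => {0}
  | r + 1 => A + iterSumset A r

theorem iterSumset_subset_image (F : Finset G) (r : ℕ) :
    iterSumset F r ⊆ (Fintype.piFinset fun _ : F => Finset.range (r + 1)).image
      fun c => ∑ f : F, c f • (f : G) := by
  induction r with
  | zero =>
    intro x hx
    rw [iterSumset, Finset.mem_singleton] at hx
    exact Finset.mem_image.2 ⟨fun _ => 0, by simp, by simp [hx]⟩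
  | succ r ih =>
    intro x hx
    obtain ⟨f, hf, y, hy, rfl⟩ := Finset.mem_add.1 hx
    obtain ⟨c, hc, rfl⟩ := Finset.mem_image.1 (ih hy)
    refine Finset.mem_image.2 ⟨c + Pi.single ⟨f, hf⟩ 1, ?_, ?_⟩
    · rw [Fintype.mem_piFinset] at hc ⊢
      intro g
      have h1 := Finset.mem_range.1 (hc g)
      have h2 : Pi.single (M := fun _ : F => ℕ) ⟨f, hf⟩ 1 g ≤ 1 := by
        rw [Pi.single_apply]; split_ifs <;> simp
      rw [Finset.mem_range, Pi.add_apply]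
      omega
    · simp only [Pi.add_apply, add_smul, Finset.sum_add_distrib]
      rw [add_comm]
      congr 1
      rw [Finset.sum_eq_single ⟨f, hf⟩] <;> simp +contextual

theorem card_iterSumset_le_pow (F : Finset G) (r : ℕ) : #(iterSumset F r) ≤ (r + 1) ^ #F := by
  refine (Finset.card_le_card (iterSumset_subset_image F r)).trans
    (Finset.card_image_le.trans ?_)
  simp

/-- A finite set with small doubling has iterated sumsets of polynomial growth. -/
theorem card_iterSumset_le {K : ℕ} {A : Finset G} (hA : A.Nonempty) (hK : #(A + A) ≤ K * #A)
    (r : ℕ) : #(iterSumset A r) ≤ (r + 1) ^ K ^ 4 * (K ^ 2 * #A) := by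
  have hA0 : (0 : ℚ≥0) < #A := by exact_mod_cast hA.card_pos
  have hKq : (#(A + A) / #A : ℚ≥0) ≤ K := by
    rw [div_le_iff₀ hA0]; exact_mod_cast hK
  have hdiff : #(A - A) ≤ K ^ 2 * #A := by
    have := pluennecke_ruzsa_inequality_nsmul_sub_nsmul_add hA A 1 1
    rw [one_nsmul] at this
    have : (#(A - A) : ℚ≥0) ≤ K ^ 2 * #A := this.trans (by gcongr)
    exact_mod_cast this
  have hthree : #(A + A - A + A) ≤ K ^ 4 * #A := by
    have := pluennecke_ruzsa_inequality_nsmul_sub_nsmul_add hA A 3 1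
    rw [one_nsmul, show 3 • A = A + A + A by rw [succ_nsmul, two_nsmul],
      add_sub_right_comm] at this
    have : (#(A + A - A + A) : ℚ≥0) ≤ K ^ 4 * #A := this.trans (by gcongr)
    exact_mod_cast this
  obtain ⟨F, -, hFcard, hF⟩ := ruzsa_covering_add (K := ((K ^ 4 : ℕ) : ℝ)) hA
    (by exact_mod_cast hthree)
  have hcover : ∀ r, iterSumset A r + (A - A) ⊆ iterSumset F r + (A - A) := by
    intro r
    induction r with
    | zero => exact subset_rfl
    | succ r ih =>
      calc A + iterSumset A r + (A - A) = iterSumset A r + (A + A - A) := by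
            rw [add_comm A, add_assoc, add_sub_assoc]
        _ ⊆ iterSumset A r + (F + (A - A)) := Finset.add_subset_add_left hF
        _ = F + (iterSumset A r + (A - A)) := by rw [add_left_comm]
        _ ⊆ F + (iterSumset F r + (A - A)) := Finset.add_subset_add_left ih
        _ = F + iterSumset F r + (A - A) := by rw [add_assoc]
  calc #(iterSumset A r) ≤ #(iterSumset A r + (A - A)) :=
        Finset.card_le_card_add_right (hA.sub hA)
    _ ≤ #(iterSumset F r + (A - A)) := Finset.card_le_card (hcover r)
    _ ≤ #(iterSumset F r) * #(A - A) := Finset.card_add_le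
    _ ≤ (r + 1) ^ K ^ 4 * (K ^ 2 * #A) := by
        gcongr
        exact (card_iterSumset_le_pow F r).trans
          (Nat.pow_le_pow_right (by omega) (by exact_mod_cast hFcard))

/-- The number of representations of an element as a sum of `r` elements of `A`. -/
def repCount (A : Finset G) : ℕ → G → ℝ
  | 0, x => if x = 0 then 1 else 0
  | r + 1, x => ∑ a ∈ A, repCount A r (x - a)

theorem repCount_eq_zero {A : Finset G} {r : ℕ} {x : G} (hx : x ∉ iterSumset A r) :
    repCount A r x = 0 := by
  induction r generalizing x with
  | zero => simpa [repCount, iterSumset] using hx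
  | succ r ih =>
    refine Finset.sum_eq_zero fun a ha => ih fun h => hx ?_
    rw [iterSumset, ← add_sub_cancel a x]
    exact Finset.add_mem_add ha h

end Growth

section Fourier

open Finset ComplexConjugate

variable {G : Type*} [AddCommGroup G] [Fintype G] [DecidableEq G]

theorem AddChar.sum_norm_sq_sum_mul (f : G → ℝ) :
    ∑ ψ : AddChar G ℂ, ‖∑ x, (f x : ℂ) * ψ x‖ ^ 2 = Fintype.card G * ∑ x, f x ^ 2 := by
  have key : ∀ ψ : AddChar G ℂ, ((‖∑ x, (f x : ℂ) * ψ x‖ ^ 2 : ℝ) : ℂ) =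
      ∑ x, ∑ y, (f x : ℂ) * f y * ψ (x - y) := fun ψ => by
    push_cast
    rw [← Complex.mul_conj', map_sum, Finset.sum_mul_sum]
    refine Finset.sum_congr rfl fun x _ => Finset.sum_congr rfl fun y _ => ?_
    rw [map_mul, Complex.conj_ofReal, sub_eq_add_neg, AddChar.map_add_eq_mul,
      AddChar.map_neg_eq_conj]
    ring
  have : ((∑ ψ : AddChar G ℂ, ‖∑ x, (f x : ℂ) * ψ x‖ ^ 2 : ℝ) : ℂ) =
      ((Fintype.card G * ∑ x, f x ^ 2 : ℝ) : ℂ) := by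
    rw [Complex.ofReal_sum, Finset.sum_congr rfl fun ψ _ => key ψ, Finset.sum_comm]
    push_cast
    rw [Finset.mul_sum]
    refine Finset.sum_congr rfl fun x _ => ?_
    rw [Finset.sum_comm]
    simp_rw [← Finset.mul_sum, AddChar.sum_apply_eq_ite, sub_eq_zero]
    simp
    ring
  exact_mod_cast this

theorem sum_repCount_mul (A : Finset G) (ψ : AddChar G ℂ) (r : ℕ) :
    ∑ x, (repCount A r x : ℂ) * ψ x = (∑ a ∈ A, ψ a) ^ r := by
  induction r with
  | zero =>
    rw [Finset.sum_eq_single 0] <;> simp +contextual [repCount]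
  | succ r ih =>
    simp only [repCount, Complex.ofReal_sum, Finset.sum_mul]
    rw [Finset.sum_comm, pow_succ', Finset.sum_mul, ← ih]
    refine Finset.sum_congr rfl fun a _ => ?_
    rw [← Equiv.sum_comp (Equiv.addRight a), Finset.mul_sum]
    refine Finset.sum_congr rfl fun x _ => ?_
    simp only [Equiv.coe_addRight, add_sub_cancel_right, AddChar.map_add_eq_mul]
    ring

theorem sum_repCount (A : Finset G) (r : ℕ) : ∑ x, repCount A r x = (#A : ℝ) ^ r := by
  have := sum_repCount_mul A (0 : AddChar G ℂ) r
  simp only [AddChar.zero_apply, mul_one, Finset.sum_const, nsmul_eq_mul] at this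
  exact_mod_cast this

theorem card_mul_pow_le_card_iterSumset_mul (A : Finset G) (r : ℕ) :
    (Fintype.card G : ℝ) * (#A : ℝ) ^ (2 * r) ≤
      #(iterSumset A r) * ∑ ψ : AddChar G ℂ, ‖∑ a ∈ A, ψ a‖ ^ (2 * r) := by
  have hpars := AddChar.sum_norm_sq_sum_mul (repCount A r)
  simp_rw [sum_repCount_mul, norm_pow, ← pow_mul, mul_comm r 2] at hpars
  rw [hpars]
  have hsupp : ∑ x ∈ iterSumset A r, repCount A r x = (#A : ℝ) ^ r := by
    rw [← sum_repCount]
    exact Finset.sum_subset (Finset.subset_univ _) fun x _ hx => repCount_eq_zero hx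
  have hcs := sq_sum_le_card_mul_sum_sq (s := iterSumset A r) (f := repCount A r)
  rw [hsupp, ← pow_mul, mul_comm r 2] at hcs
  calc (Fintype.card G : ℝ) * (#A : ℝ) ^ (2 * r)
      ≤ Fintype.card G * (#(iterSumset A r) * ∑ x ∈ iterSumset A r, repCount A r x ^ 2) := by
        gcongr
    _ ≤ Fintype.card G * (#(iterSumset A r) * ∑ x, repCount A r x ^ 2) := by
        gcongr
        exact Finset.subset_univ _
    _ = _ := by ring

theorem AddChar.sum_norm_sq_sum_finset (A : Finset G) :
    ∑ ψ : AddChar G ℂ, ‖∑ a ∈ A, ψ a‖ ^ 2 = Fintype.card G * #A := by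
  have := AddChar.sum_norm_sq_sum_mul (fun x : G => if x ∈ A then (1 : ℝ) else 0)
  simpa [apply_ite, ite_pow] using this

end Fourier

open Finset in
/-- A sparse set of small doubling in a finite abelian group has a nontrivial Fourier coefficient
of nearly maximal size. -/
theorem exists_addChar_norm_sum_ge {ε : ℝ} (hε : 0 < ε) (hε1 : ε < 1) (K : ℕ) :
    ∃ C : ℝ, 0 < C ∧ ∀ (G : Type) [AddCommGroup G] [Fintype G] [DecidableEq G] (A : Finset G),
      A.Nonempty → #(A + A) ≤ K * #A → C * #A ≤ Fintype.card G →
      ∃ ψ : AddChar G ℂ, ψ ≠ 0 ∧ (1 - ε) * #A ≤ ‖∑ a ∈ A, ψ a‖ := by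
  set q : ℝ := 1 - ε with hq
  have hq0 : 0 < q := by linarith
  have hq1 : q < 1 := by linarith
  have hlim := tendsto_pow_const_mul_const_pow_of_lt_one (K ^ 4) (r := q ^ 2) (by positivity)
    (by nlinarith)
  obtain ⟨n, hn, hn2⟩ := ((hlim.eventually_lt_const
    (show (0 : ℝ) < q ^ 4 / (2 * (K ^ 2 + 1)) by positivity)).and
    (Filter.eventually_ge_atTop 2)).exists
  obtain ⟨s, rfl⟩ := Nat.exists_eq_add_of_le' hn2
  set D : ℝ := ((s + 2 : ℕ) : ℝ) ^ K ^ 4 * (K ^ 2 + 1) with hD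
  have hDpos : 0 < D := by positivity
  have hDq : D * (q ^ 2) ^ s ≤ 1 / 2 := by
    have h4 : (q ^ 2) ^ (s + 2) = (q ^ 2) ^ s * q ^ 4 := by ring
    rw [h4, ← mul_assoc, lt_div_iff₀ (by positivity)] at hn
    have : D * (q ^ 2) ^ s * 2 * q ^ 4 < 1 * q ^ 4 := by rw [hD]; linarith
    have := lt_of_mul_lt_mul_right this (by positivity)
    linarith
  refine ⟨2 * D + 1, by positivity, fun G _ _ _ A hA hdbl hN => ?_⟩
  by_contra! hsmall
  have hApos : (0 : ℝ) < #A := by exact_mod_cast hA.card_pos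
  have hT : (#(iterSumset A (s + 1)) : ℝ) ≤ D * #A := by
    have := card_iterSumset_le hA hdbl (s + 1)
    have : (#(iterSumset A (s + 1)) : ℝ) ≤ ((s + 2 : ℕ) : ℝ) ^ K ^ 4 * (K ^ 2 * #A) := by
      exact_mod_cast this
    refine this.trans ?_
    rw [hD, mul_assoc]
    gcongr
    linarith
  have hsum : ∑ ψ : AddChar G ℂ, ‖∑ a ∈ A, ψ a‖ ^ (2 * (s + 1)) ≤
      (#A : ℝ) ^ (2 * (s + 1)) + (q * #A) ^ (2 * s) * (Fintype.card G * #A) := by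
    rw [← AddChar.sum_norm_sq_sum_finset, ← Finset.add_sum_erase _ _ (Finset.mem_univ 0)]
    gcongr
    · simp
    · rw [Finset.mul_sum]
      refine (Finset.sum_le_sum fun ψ hψ => ?_).trans
        (Finset.sum_le_sum_of_subset_of_nonneg (Finset.erase_subset _ _)
          fun _ _ _ => by positivity)
      rw [mul_add, pow_add, mul_one]
      gcongr
      exact (hsmall ψ (Finset.ne_of_mem_erase hψ)).le
  have hmain := card_mul_pow_le_card_iterSumset_mul A (s + 1)
  set N : ℝ := (Fintype.card G : ℝ) with hNdef
  have hNpos : 0 < N := by rw [hNdef]; exact_mod_cast Fintype.card_pos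
  have h1 : N * (#A : ℝ) ^ (2 * (s + 1)) ≤
      (D * #A) * ((#A : ℝ) ^ (2 * (s + 1)) + (q * #A) ^ (2 * s) * (N * #A)) :=
    hmain.trans (by gcongr)
  have h2 : (D * #A) * ((#A : ℝ) ^ (2 * (s + 1)) + (q * #A) ^ (2 * s) * (N * #A)) =
      (D * #A + D * (q ^ 2) ^ s * N) * (#A : ℝ) ^ (2 * (s + 1)) := by
    rw [mul_pow, ← pow_mul]; ring
  rw [h2] at h1
  have h3 := le_of_mul_le_mul_right h1 (by positivity)
  nlinarith

namespace Circle

theorem dist_eq_norm_sub (a b : Circle) : dist a b = ‖(a : ℂ) - b‖ :=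
  (Subtype.dist_eq a b).trans (dist_eq_norm _ _)

theorem dist_mul_left (a b c : Circle) : dist (a * b) (a * c) = dist b c := by
  rw [dist_eq_norm_sub, dist_eq_norm_sub, coe_mul, coe_mul, ← mul_sub, norm_mul, norm_coe, one_mul]

theorem dist_mul_mul_le (a b c d : Circle) : dist (a * b) (c * d) ≤ dist a c + dist b d := by
  refine (dist_triangle _ (a * d) _).trans ?_
  rw [dist_mul_left, mul_comm a d, mul_comm c d, dist_mul_left, add_comm]

theorem dist_fourierChar_one (t : ℝ) :
    dist (Real.fourierChar t) 1 = 2 * |Real.sin (Real.pi * t)| := by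
  rw [dist_eq_norm_sub, coe_one, Real.fourierChar_apply, mul_comm,
    Complex.norm_exp_I_mul_ofReal_sub_one, norm_mul, Real.norm_eq_abs, Real.norm_eq_abs,
    abs_of_pos two_pos, show 2 * Real.pi * t / 2 = Real.pi * t by ring]

theorem dist_fourierChar_one_le_of_abs_le {s t : ℝ} (hst : |s| ≤ |t|) (ht : |t| ≤ 1 / 2) :
    dist (Real.fourierChar s) 1 ≤ dist (Real.fourierChar t) 1 := by
  have hpi := Real.pi_pos
  have key : ∀ x : ℝ, |x| ≤ 1 / 2 → |Real.sin (Real.pi * x)| = Real.sin (Real.pi * |x|) := by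
    intro x hx
    have : Real.pi * |x| = |Real.pi * x| := by rw [abs_mul, abs_of_pos hpi]
    rw [this, Real.abs_sin_eq_sin_abs_of_abs_le_pi]
    rw [← this]
    nlinarith
  rw [dist_fourierChar_one, dist_fourierChar_one, key s (hst.trans ht), key t ht]
  have h0 := abs_nonneg s
  gcongr
  refine Real.sin_le_sin_of_le_of_le_pi_div_two ?_ ?_ ?_ <;> nlinarith

/-- Unit complex numbers with a large sum are concentrated. -/
theorem exists_card_filter_dist_le {ι : Type*} (A : Finset ι) (z : ι → Circle) {ε r : ℝ}
    (hr : 0 < r) (h : (1 - ε) * A.card ≤ ‖∑ a ∈ A, (z a : ℂ)‖) :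
    ∃ u : Circle, ((A.filter fun a => r < dist (z a) u).card : ℝ) * r ^ 2 ≤ 2 * ε * A.card := by
  set S : ℂ := ∑ a ∈ A, (z a : ℂ) with hS
  obtain ⟨u, hu⟩ : ∃ u : Circle, S = ‖S‖ * u := by
    refine ⟨Circle.exp S.arg, ?_⟩
    rw [Circle.coe_exp, Complex.norm_mul_exp_arg_mul_I]
  refine ⟨u, ?_⟩
  have hsq : ∀ a, dist (z a) u ^ 2 = 2 - 2 * ((z a : ℂ) * (starRingEnd ℂ) u).re := fun a => by
    rw [dist_eq_norm_sub, ← Complex.normSq_eq_norm_sq, Complex.normSq_sub, Circle.normSq_coe,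
      Circle.normSq_coe]
    ring
  have hsum : ∑ a ∈ A, dist (z a) u ^ 2 = 2 * A.card - 2 * ‖S‖ := by
    simp_rw [hsq]
    rw [Finset.sum_sub_distrib, ← Finset.mul_sum, ← Complex.re_sum, ← Finset.sum_mul, ← hS]
    have : (S * (starRingEnd ℂ) u).re = ‖S‖ := by
      conv_lhs => rw [hu]
      rw [mul_assoc, Complex.mul_conj, Circle.normSq_coe]
      simp
    rw [this]
    simp [mul_comm]
  calc ((A.filter fun a => r < dist (z a) u).card : ℝ) * r ^ 2
      = ∑ a ∈ A.filter fun a => r < dist (z a) u, r ^ 2 := by simp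
    _ ≤ ∑ a ∈ A.filter fun a => r < dist (z a) u, dist (z a) u ^ 2 :=
        Finset.sum_le_sum fun a ha => by
          have := (Finset.mem_filter.1 ha).2
          gcongr
    _ ≤ ∑ a ∈ A, dist (z a) u ^ 2 :=
        Finset.sum_le_sum_of_subset_of_nonneg (Finset.filter_subset _ _)
          fun _ _ _ => by positivity
    _ ≤ _ := by rw [hsum]; linarith

end Circle

open Finset in
/-- A sparse finite set of integers with small doubling, most of which lies in long runs, is
concentrated near an arithmetic progression modulo `N`. -/
theorem exists_int_card_filter_le :
    ∃ C : ℝ, 0 < C ∧ ∀ (N : ℕ) (A : Finset ℤ), A.Nonempty → (∀ k ∈ A, 0 ≤ k ∧ k < N) →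
      #(A + A) ≤ 6 * #A → C * #A ≤ N → 2 * #(A ∪ (A + {1})) ≤ 3 * #A →
      ∃ (m : ℤ) (u : Circle) (B : Finset ℤ), m ≠ 0 ∧ B ⊆ A ∧ 32 * #B ≤ #A ∧
        ∀ k ∈ A \ B, ∀ t ∈ Set.Icc (0 : ℝ) 1,
          dist (Real.fourierChar (m * ((k + t) / N))) u ≤ 1 / 100 := by
  obtain ⟨C, hC, H⟩ := exists_addChar_norm_sum_ge (ε := 1 / 5760000) (by norm_num) (by norm_num) 6
  refine ⟨C, hC, fun N A hA hAN hdbl hN hrun => ?_⟩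
  have hN0 : NeZero N := by
    obtain ⟨k, hk⟩ := hA
    have := hAN k hk
    exact ⟨by rintro rfl; simp at this; omega⟩
  have hNpos : (0 : ℝ) < N := by exact_mod_cast NeZero.pos N
  have hinj : Set.InjOn (Int.cast : ℤ → ZMod N) A := by
    intro i hi j hj hij
    rw [ZMod.intCast_eq_intCast_iff] at hij
    have h1 := hAN i hi
    have h2 := hAN j hj
    rwa [Int.ModEq, Int.emod_eq_of_lt h1.1 h1.2, Int.emod_eq_of_lt h2.1 h2.2] at hij
  have hcard : #(A.image (Int.cast : ℤ → ZMod N)) = #A := Finset.card_image_of_injOn hinj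
  obtain ⟨ψ, hψ, hψsum⟩ := H (ZMod N) (A.image Int.cast) (hA.image _) (by
    have himg := Finset.image_add (Int.castAddHom (ZMod N)) (s := A) (t := A)
    rw [Int.coe_castAddHom] at himg
    rw [hcard, ← himg]
    exact Finset.card_image_le.trans hdbl) (by rwa [hcard, ZMod.card])
  obtain ⟨w, rfl⟩ := (AddChar.zmodAddEquiv (n := N)).surjective ψ
  have hw : w ≠ 0 := by rintro rfl; exact hψ (map_zero _)
  set m : ℤ := w.valMinAbs with hm
  have hmw : (m : ZMod N) = w := ZMod.coe_valMinAbs w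
  have hm0 : m ≠ 0 := by rwa [hm, Ne, ZMod.valMinAbs_eq_zero]
  have hmle : |(m : ℝ) / N| ≤ 1 / 2 := by
    have := ZMod.natAbs_valMinAbs_le w
    rw [abs_div, abs_of_pos hNpos, div_le_iff₀ hNpos, ← Int.cast_abs, Int.abs_eq_natAbs,
      Int.cast_natCast]
    have h2 : 2 * m.natAbs ≤ N := by omega
    have h3 : (2 : ℝ) * m.natAbs ≤ N := by exact_mod_cast h2
    linarith
  set z : ℤ → Circle := fun k => Real.fourierChar (m * (k / N)) with hz
  have hzψ : ∀ k : ℤ, AddChar.zmodAddEquiv w (k : ZMod N) = (z k : ℂ) := fun k => by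
    change ((AddChar.zmod N w (k : ZMod N) : Circle) : ℂ) = _
    rw [← hmw, AddChar.zmod_intCast, mul_div_assoc, ← Real.fourierChar_apply']
  rw [Finset.sum_image hinj, hcard, Finset.sum_congr rfl fun k _ => hzψ k] at hψsum
  obtain ⟨u, hu⟩ := Circle.exists_card_filter_dist_le A z (r := 1 / 300) (by norm_num) hψsum
  set B := A.filter fun k => 1 / 300 < dist (z k) u with hB
  have hBcard : 32 * #B ≤ #A := by
    have : (32 : ℝ) * #B ≤ #A := by linarith
    exact_mod_cast this
  have hgood : ∀ k ∈ A \ B, dist (z k) u ≤ 1 / 300 := fun k hk => by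
    rw [Finset.mem_sdiff, hB, Finset.mem_filter, not_and, not_lt] at hk
    exact hk.2 hk.1
  refine ⟨m, u, B, hm0, Finset.filter_subset _ _, hBcard, ?_⟩
  obtain ⟨k, hk, hk'⟩ : ∃ k, k ∈ A \ B ∧ k + 1 ∈ A \ B := by
    by_contra! hno
    have hdisj : Disjoint (A \ B) ((A \ B) + {1}) := by
      rw [Finset.disjoint_left]
      rintro x hx hx'
      obtain ⟨y, hy, _, h1, rfl⟩ := Finset.mem_add.1 hx'
      rw [Finset.mem_singleton.1 h1] at hx
      exact hno y hy hx
    have hle : #((A \ B) ∪ ((A \ B) + {1})) ≤ #(A ∪ (A + {1})) := by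
      refine Finset.card_le_card (Finset.union_subset_union Finset.sdiff_subset ?_)
      exact Finset.add_subset_add_right Finset.sdiff_subset
    rw [Finset.card_union_of_disjoint hdisj, Finset.card_add_singleton] at hle
    have h2 : #(A \ B) + #B = #A := Finset.card_sdiff_add_card_eq_card (Finset.filter_subset _ _)
    have := hA.card_pos
    omega
  have hstep : dist (Real.fourierChar ((m : ℝ) / N)) 1 ≤ 1 / 150 := by
    have hmul : z (k + 1) = z k * Real.fourierChar ((m : ℝ) / N) := by
      rw [hz, ← AddChar.map_add_eq_mul]
      exact congrArg Real.fourierChar (by push_cast; ring)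
    have := dist_triangle_right (z (k + 1)) (z k) u
    rw [hmul, ← mul_one (z k), mul_assoc, one_mul, Circle.dist_mul_left, mul_one, ← hmul] at this
    linarith [hgood _ hk, hgood _ hk']
  intro k hk t ht
  have hmul : Real.fourierChar (m * ((k + t) / N)) = z k * Real.fourierChar (m / N * t) := by
    rw [hz, ← AddChar.map_add_eq_mul]
    exact congrArg Real.fourierChar (by ring)
  have hsmall : dist (Real.fourierChar ((m : ℝ) / N * t)) 1 ≤ 1 / 150 := by
    refine (Circle.dist_fourierChar_one_le_of_abs_le ?_ hmle).trans hstep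
    rw [abs_mul, abs_of_nonneg ht.1]
    exact mul_le_of_le_one_right (abs_nonneg _) ht.2
  have := Circle.dist_mul_mul_le (z k) (Real.fourierChar (m / N * t)) u 1
  rw [mul_one, ← hmul] at this
  linarith [hgood k hk]

theorem card_mul_le_volume_real {δ : ℝ} (hδ : 0 < δ) {T : Finset ℤ} {Z : Set ℝ}
    (hZ : volume Z ≠ ⊤) (h : ∀ k ∈ T, Ico (k * δ) ((k + 1) * δ) ⊆ Z) :
    T.card * δ ≤ volume.real Z := by
  have hdisj : (T : Set ℤ).PairwiseDisjoint fun k : ℤ => Ico ((k : ℝ) * δ) ((k + 1) * δ) := by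
    intro i _ j _ hij
    have := pairwise_disjoint_Ico_zsmul δ hij
    simpa [Function.onFun, zsmul_eq_mul] using this
  calc T.card * δ = ∑ k ∈ T, volume.real (Ico ((k : ℝ) * δ) ((k + 1) * δ)) := by
        rw [Finset.sum_congr rfl fun k _ => Real.volume_real_Ico_of_le (by nlinarith)]
        simp [add_mul]
    _ = volume.real (⋃ k ∈ T, Ico ((k : ℝ) * δ) ((k + 1) * δ)) :=
        (measureReal_biUnion_finset hdisj (fun _ _ => measurableSet_Ico)
          fun _ _ => measure_Ico_lt_top.ne).symm
    _ ≤ volume.real Z := measureReal_mono (iUnion₂_subset h) hZ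

theorem volume_real_le_card_mul {δ : ℝ} (hδ : 0 < δ) {T : Finset ℤ} {Z : Set ℝ}
    (h : ∀ x ∈ Z, ∃ k ∈ T, x ∈ Ico ((k : ℝ) * δ) ((k + 1) * δ)) :
    volume.real Z ≤ T.card * δ := by
  calc volume.real Z ≤ volume.real (⋃ k ∈ T, Ico ((k : ℝ) * δ) ((k + 1) * δ)) := by
        refine measureReal_mono (fun x hx => mem_iUnion₂.2 <| by
          simpa only [exists_prop] using h x hx) ?_
        exact (measure_biUnion_lt_top T.finite_toSet fun _ _ => measure_Ico_lt_top).ne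
    _ ≤ ∑ k ∈ T, volume.real (Ico ((k : ℝ) * δ) ((k + 1) * δ)) :=
        measureReal_biUnion_finset_le _ _
    _ = T.card * δ := by
        rw [Finset.sum_congr rfl fun k _ => Real.volume_real_Ico_of_le (by nlinarith)]
        simp [add_mul]

/-- A sparse set of reals with small doubling has most of its mass near an arithmetic
progression. -/
theorem exists_int_volume_far_le :
    ∃ C : ℝ, 0 < C ∧ ∀ (L : ℝ) (A : Set ℝ), 0 < L → MeasurableSet A → A ⊆ Icc 0 L →
      0 < volume A → volume (A + A) ≤ 4 * volume A → C * volume.real A ≤ L →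
      ∃ (m : ℤ) (u : Circle), m ≠ 0 ∧
        volume.real {x ∈ A | 1 / 100 < dist (Real.fourierChar (m * (x / L))) u} ≤
          volume.real A / 8 := by
  obtain ⟨C, hC, H⟩ := exists_int_card_filter_le
  refine ⟨2 * C, by positivity, fun L A hL hA hAsub hpos hdbl hCL => ?_⟩
  have hAf : volume A ≠ ⊤ := ((measure_mono hAsub).trans_lt measure_Icc_lt_top).ne
  have ha : 0 < volume.real A := ENNReal.toReal_pos hpos.ne' hAf
  have hA' : volume (A ∩ Ico 0 L) = volume A := by
    refine measure_congr (ae_eq_set.2 ⟨measure_mono_null (fun x hx => hx.2 hx.1.1)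
      (measure_empty), ?_⟩)
    refine measure_mono_null (t := {L}) (fun x hx => ?_) (by simp)
    have h1 := hAsub hx.1
    have h2 : ¬ x < L := fun h => hx.2 ⟨hx.1, h1.1, h⟩
    exact le_antisymm h1.2 (not_lt.1 h2)
  obtain ⟨K, hKsub, hKc, hKvol⟩ := (hA.inter measurableSet_Ico).exists_lt_isCompact
    (μ := volume) (r := ENNReal.ofReal (19 / 20 * volume.real A)) (by
      rw [hA', ← ENNReal.ofReal_toReal hAf]
      exact (ENNReal.ofReal_lt_ofReal_iff ha).2 (by linarith))
  have hKf : volume K ≠ ⊤ := hKc.measure_lt_top.ne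
  have hKA : K ⊆ A := fun x hx => (hKsub hx).1
  set κ : ℝ := volume.real K with hκ
  have hKreal : volume K = ENNReal.ofReal κ := (ENNReal.ofReal_toReal hKf).symm
  have hκlow : 19 / 20 * volume.real A < κ :=
    (ENNReal.ofReal_lt_iff_lt_toReal (by positivity) hKf).1 hKvol
  have hκle : κ ≤ volume.real A := measureReal_mono hKA hAf
  have hκpos : 0 < κ := by linarith
  have hKK : volume (K + K) < ENNReal.ofReal (6 * κ) := by
    calc volume (K + K) ≤ 4 * volume A := (measure_mono (add_subset_add hKA hKA)).trans hdbl
      _ = ENNReal.ofReal (4 * volume.real A) := by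
        rw [ENNReal.ofReal_mul (by norm_num), Measure.real, ENNReal.ofReal_toReal hAf]; simp
      _ < _ := (ENNReal.ofReal_lt_ofReal_iff (by positivity)).2 (by linarith)
  have hev := ((tendsto_measure_cthickening_of_isCompact (μ := volume)
    (hKc.add hKc)).eventually_lt_const
    hKK).and ((tendsto_measure_cthickening_of_isCompact (μ := volume) hKc).eventually_lt_const
    (show volume K < ENNReal.ofReal (3 / 2 * κ) by
      rw [hKreal]; exact (ENNReal.ofReal_lt_ofReal_iff (by positivity)).2 (by linarith)))
  obtain ⟨r, ⟨hr1, hr2⟩, hr0⟩ := ((hev.filter_mono nhdsWithin_le_nhds).and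
    (self_mem_nhdsWithin : Ioi (0 : ℝ) ∈ nhdsWithin 0 (Ioi 0))).exists
  obtain ⟨N, hN⟩ := exists_nat_gt (2 * L / r)
  have hNpos : (0 : ℝ) < N := lt_trans (by positivity) hN
  set δ : ℝ := L / N with hδdef
  have hδ : 0 < δ := by positivity
  have hNδ : N * δ = L := by rw [hδdef]; field_simp
  have hδr : 2 * δ ≤ r := by
    rw [div_lt_iff₀ hr0] at hN
    rw [hδdef, ← mul_div_assoc, div_le_iff₀ hNpos]
    linarith
  have hthick : ∀ (S : Set ℝ) (x y : ℝ), x ∈ S → |y - x| ≤ 2 * δ → y ∈ Metric.cthickening r S :=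
    fun S x y hx hxy => Metric.mem_cthickening_of_dist_le y x r S hx
      (by rw [Real.dist_eq]; exact hxy.trans hδr)
  classical
  set T : Finset ℤ := (Finset.Ico 0 (N : ℤ)).filter fun k => ∃ x ∈ K, x ∈ Ico (k * δ) ((k + 1) * δ)
    with hT
  have hTmem : ∀ x ∈ K, ∃ k ∈ T, x ∈ Ico ((k : ℝ) * δ) ((k + 1) * δ) := by
    intro x hx
    have hx0 := (hKsub hx).2
    have hfl : x ∈ Ico ((⌊x / δ⌋ : ℝ) * δ) ((⌊x / δ⌋ + 1) * δ) := by
      constructor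
      · rw [← le_div_iff₀ hδ]; exact Int.floor_le _
      · rw [← div_lt_iff₀ hδ]; exact Int.lt_floor_add_one _
    refine ⟨⌊x / δ⌋, Finset.mem_filter.2 ⟨Finset.mem_Ico.2 ⟨?_, ?_⟩, x, hx, hfl⟩, hfl⟩
    · exact Int.floor_nonneg.2 (div_nonneg hx0.1 hδ.le)
    · rw [Int.floor_lt, div_lt_iff₀ hδ]
      push_cast
      rw [hNδ]
      exact hx0.2
  have hTK : ∀ k ∈ T, ∃ x ∈ K, x ∈ Ico ((k : ℝ) * δ) ((k + 1) * δ) := fun k hk =>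
    (Finset.mem_filter.1 hk).2
  have hκT : κ ≤ T.card * δ := volume_real_le_card_mul hδ hTmem
  have hsum : (T + T).card * δ ≤ 6 * κ := by
    refine (card_mul_le_volume_real hδ (hr1.trans_le le_top).ne ?_).trans
      (ENNReal.toReal_le_of_le_ofReal (by positivity) hr1.le)
    intro k hk y hy
    obtain ⟨i, hi, j, hj, rfl⟩ := Finset.mem_add.1 hk
    obtain ⟨x, hx, hxi⟩ := hTK i hi
    obtain ⟨z, hz, hzj⟩ := hTK j hj
    refine hthick _ (x + z) y (add_mem_add hx hz) ?_
    push_cast at hy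
    rw [abs_le]
    constructor <;> nlinarith [hy.1, hy.2, hxi.1, hxi.2, hzj.1, hzj.2]
  have hrun : (T ∪ (T + {1})).card * δ ≤ 3 / 2 * κ := by
    refine (card_mul_le_volume_real hδ (hr2.trans_le le_top).ne ?_).trans
      (ENNReal.toReal_le_of_le_ofReal (by positivity) hr2.le)
    intro k hk y hy
    rcases Finset.mem_union.1 hk with hk | hk
    · obtain ⟨x, hx, hxk⟩ := hTK k hk
      refine hthick _ x y hx ?_
      rw [abs_le]
      constructor <;> nlinarith [hy.1, hy.2, hxk.1, hxk.2]
    · obtain ⟨i, hi, j, hj, rfl⟩ := Finset.mem_add.1 hk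
      rw [Finset.mem_singleton] at hj
      subst hj
      obtain ⟨x, hx, hxi⟩ := hTK i hi
      refine hthick _ x y hx ?_
      push_cast at hy
      rw [abs_le]
      constructor <;> nlinarith [hy.1, hy.2, hxi.1, hxi.2]
  have hTle : T.card * δ ≤ 3 / 2 * κ := by
    refine le_trans ?_ hrun
    gcongr
    exact Finset.subset_union_left
  have hTne : T.Nonempty := by
    rw [← Finset.card_pos]
    by_contra! h0
    have : T.card = 0 := by omega
    rw [this] at hκT
    simp at hκT
    linarith
  obtain ⟨m, u, B, hm, hBT, hBcard, hgood⟩ := H N T hTne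
    (fun k hk => Finset.mem_Ico.1 (Finset.mem_filter.1 hk).1)
    (by
      have : ((T + T).card : ℝ) * δ ≤ (6 * T.card) * δ := by linarith
      exact_mod_cast le_of_mul_le_mul_right this hδ)
    (by
      have : C * T.card * δ ≤ N * δ := by
        rw [hNδ]
        nlinarith
      exact le_of_mul_le_mul_right this hδ)
    (by
      have : 2 * ((T ∪ (T + {1})).card : ℝ) * δ ≤ (3 * T.card) * δ := by linarith
      exact_mod_cast le_of_mul_le_mul_right this hδ)
  refine ⟨m, u, hm, ?_⟩
  set F : Set ℝ := {x ∈ A | 1 / 100 < dist (Real.fourierChar (m * (x / L))) u} with hF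
  have hsub : F ⊆ (A \ K) ∪ (F ∩ K) := fun x hx => by
    by_cases hxK : x ∈ K
    · exact Or.inr ⟨hx, hxK⟩
    · exact Or.inl ⟨hx.1, hxK⟩
  have hFK : volume.real (F ∩ K) ≤ B.card * δ := by
    refine volume_real_le_card_mul hδ fun x hx => ?_
    obtain ⟨k, hk, hxk⟩ := hTmem x hx.2
    refine ⟨k, ?_, hxk⟩
    by_contra hkB
    refine not_le.2 hx.1.2 ?_
    have := hgood k (Finset.mem_sdiff.2 ⟨hk, hkB⟩) (x / δ - k)
      ⟨by rw [sub_nonneg, le_div_iff₀ hδ]; exact hxk.1,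
        by rw [sub_le_iff_le_add', div_le_iff₀ hδ]; exact hxk.2.le⟩
    rwa [add_sub_cancel, div_div, mul_comm δ, hNδ] at this
  have hAK : volume.real (A \ K) = volume.real A - κ :=
    measureReal_sdiff hKA hKc.measurableSet hAf
  have hBr : (32 : ℝ) * B.card ≤ T.card := by exact_mod_cast hBcard
  have hfin : volume ((A \ K) ∪ (F ∩ K)) ≠ ⊤ :=
    ((measure_mono (union_subset sdiff_subset (fun x hx => hx.1.1))).trans_lt hAf.lt_top).ne
  calc volume.real F ≤ volume.real (A \ K) + volume.real (F ∩ K) :=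
        (measureReal_mono hsub hfin).trans (measureReal_union_le _ _)
    _ ≤ (volume.real A - κ) + B.card * δ := by rw [hAK]; gcongr
    _ ≤ volume.real A / 8 := by nlinarith

theorem Circle.exists_int_abs_sub_le {t : ℝ} (h : dist (Real.fourierChar t) 1 ≤ 28 / 100) :
    ∃ k : ℤ, |t - k| ≤ 1 / 8 := by
  refine ⟨round t, ?_⟩
  have hle : |t - round t| ≤ 1 / 2 := abs_sub_round t
  have hchar : dist (Real.fourierChar (t - round t)) 1 = dist (Real.fourierChar t) 1 := by
    rw [Circle.dist_fourierChar_one, Circle.dist_fourierChar_one, mul_sub,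
      mul_comm Real.pi (round t : ℝ),
      Real.sin_sub_int_mul_pi, abs_mul, abs_zpow, abs_neg, abs_one, one_zpow, one_mul]
  have hpi := Real.pi_pos
  have habs : |Real.sin (Real.pi * (t - round t))| = Real.sin (Real.pi * |t - round t|) := by
    have : Real.pi * |t - round t| = |Real.pi * (t - round t)| := by rw [abs_mul, abs_of_pos hpi]
    rw [this, Real.abs_sin_eq_sin_abs_of_abs_le_pi]
    rw [← this]
    nlinarith
  have hsin := Real.mul_le_sin (x := Real.pi * |t - round t|) (by positivity) (by nlinarith)
  rw [← hchar, Circle.dist_fourierChar_one, habs] at h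
  have : 2 / Real.pi * (Real.pi * |t - round t|) = 2 * |t - round t| := by field_simp
  linarith

namespace AddCircle

variable {P : ℝ} [hP : Fact (0 < P)]

theorem measureReal_add_add_le_of_separated {φ : AddCircle P → Circle} (hφ : Continuous φ)
    {X Y W Z : Set (AddCircle P)} {a b c : Circle} {α β γ : ℝ}
    (hX : ∀ x ∈ X, x ∈ Z ∧ dist (φ x) a ≤ α) (hY : ∀ x ∈ Y, x ∈ Z ∧ dist (φ x) b ≤ β)
    (hW : ∀ x ∈ W, x ∈ Z ∧ dist (φ x) c ≤ γ)
    (hab : α + β < dist a b) (hac : α + γ < dist a c) (hbc : β + γ < dist b c) :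
    volume.real X + volume.real Y + volume.real W ≤ volume.real Z := by
  have hsep : ∀ {x : AddCircle P} {p q : Circle} {r s : ℝ}, dist (φ x) p ≤ r → dist (φ x) q ≤ s →
      r + s < dist p q → False := fun {x p q r s} h1 h2 h3 => by
    have := dist_triangle_left p q (φ x)
    linarith
  have hmeas : ∀ (p : Circle) (r : ℝ), MeasurableSet {x | dist (φ x) p ≤ r} := fun p r =>
    (isClosed_le (hφ.dist continuous_const) continuous_const).measurableSet
  have h1 := measureReal_inter_add_sdiff (μ := volume) (s := Z) (hmeas a α)
  have h2 := measureReal_inter_add_sdiff (μ := volume) (s := Z \ {x | dist (φ x) a ≤ α}) (hmeas b β)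
  have hXle : volume.real X ≤ volume.real (Z ∩ {x | dist (φ x) a ≤ α}) :=
    measureReal_mono fun x hx => hX x hx
  have hYle : volume.real Y ≤
      volume.real ((Z \ {x | dist (φ x) a ≤ α}) ∩ {x | dist (φ x) b ≤ β}) :=
    measureReal_mono fun x hx => ⟨⟨(hY x hx).1, fun h => hsep h (hY x hx).2 hab⟩, (hY x hx).2⟩
  have hWle : volume.real W ≤
      volume.real ((Z \ {x | dist (φ x) a ≤ α}) \ {x | dist (φ x) b ≤ β}) :=
    measureReal_mono fun x hx => ⟨⟨(hW x hx).1, fun h => hsep h (hW x hx).2 hac⟩,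
      fun h => hsep h (hW x hx).2 hbc⟩
  linarith

/-- If most of a set of doubling less than three concentrates near a single value of a character,
then the whole set concentrates near a single value of the character or of its square. -/
theorem forall_dist_le_or_of_measureReal_le {φ : AddCircle P → Circle} (hφ : Continuous φ)
    (hadd : ∀ x y, φ (x + y) = φ x * φ y) {B : Set (AddCircle P)} (hB : MeasurableSet B)
    (hpos : 0 < volume.real B) (hsparse : 2 * volume.real B ≤ P)
    (hdbl : volume.real (B + B) < 3 * volume.real B) {u : Circle}
    (hfar : volume.real {x ∈ B | 1 / 100 < dist (φ x) u} ≤ volume.real B / 8) :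
    ∃ v : Circle, (∀ x ∈ B, dist (φ x) v ≤ 14 / 100) ∨ ∀ x ∈ B, dist (φ x ^ 2) v ≤ 14 / 100 := by
  have hmeas : ∀ r : ℝ, MeasurableSet {x ∈ B | dist (φ x) u ≤ r} := fun r =>
    hB.inter (isClosed_le (hφ.dist continuous_const) continuous_const).measurableSet
  have hsplit : ∀ r : ℝ, volume.real {x ∈ B | dist (φ x) u ≤ r} +
      volume.real {x ∈ B | r < dist (φ x) u} = volume.real B := fun r => by
    have := measureReal_inter_add_sdiff (μ := volume) (s := B)
      (isClosed_le (hφ.dist (continuous_const (y := u))) (continuous_const (y := r))).measurableSet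
    rw [← this]
    congr 2
    ext x
    simp
  set B₀ := {x ∈ B | dist (φ x) u ≤ 1 / 100} with hB₀
  set B₁ := {x ∈ B | dist (φ x) u ≤ 3 / 100} with hB₁
  set E := {x ∈ B | 3 / 100 < dist (φ x) u} with hE
  have hB₀vol := hsplit (1 / 100)
  have hB₁vol := hsplit (3 / 100)
  have hB₀pos : 0 < volume.real B₀ := by linarith
  have hB₀ne : B₀.Nonempty := nonempty_of_measureReal_ne_zero hB₀pos.ne'
  have hB₁ne : B₁.Nonempty := hB₀ne.mono fun x hx => ⟨hx.1, hx.2.trans (by norm_num)⟩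
  have hEm : MeasurableSet E := by
    have : E = B \ B₁ := by ext x; simp [hE, hB₁]
    rw [this]
    exact hB.diff (hmeas _)
  have hraikov : ∀ {X Y : Set (AddCircle P)}, MeasurableSet X → MeasurableSet Y → X.Nonempty →
      Y.Nonempty → X ⊆ B → Y ⊆ B → volume.real X + volume.real Y ≤ volume.real (X + Y) := by
    intro X Y hX hY hXne hYne hXB hYB
    have := AddCircle.min_le_measureReal_add hX hY hXne hYne
    rwa [min_eq_right] at this
    linarith [measureReal_mono (μ := volume) hXB, measureReal_mono (μ := volume) hYB]
  have hB₀B : B₀ ⊆ B := fun x hx => hx.1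
  have hB₁B : B₁ ⊆ B := fun x hx => hx.1
  have hEB : E ⊆ B := fun x hx => hx.1
  have hsum : ∀ {X Y : Set (AddCircle P)} {a b : Circle} {α β γ : ℝ}, X ⊆ B → Y ⊆ B →
      (∀ x ∈ X, dist (φ x) a ≤ α) → (∀ y ∈ Y, dist (φ y) b ≤ β) → α + β ≤ γ →
      ∀ z ∈ X + Y, z ∈ B + B ∧ dist (φ z) (a * b) ≤ γ := by
    rintro X Y a b α β γ hXB hYB hX hY hγ _ ⟨x, hx, y, hy, rfl⟩
    refine ⟨add_mem_add (hXB hx) (hYB hy), ?_⟩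
    rw [hadd]
    exact (Circle.dist_mul_mul_le _ _ _ _).trans ((add_le_add (hX x hx) (hY y hy)).trans hγ)
  rcases E.eq_empty_or_nonempty with hE0 | hEne
  · refine ⟨u, Or.inl fun x hx => ?_⟩
    by_contra! h
    have : x ∈ E := ⟨hx, by linarith⟩
    rw [hE0] at this
    exact this
  obtain ⟨y, hy⟩ := hEne
  have hclose : ∀ x ∈ E, dist (φ x) (φ y) ≤ 2 / 100 := by
    intro x hx
    by_contra! hxy
    have hshift : ∀ z ∈ E, ∀ w ∈ ({z} : Set (AddCircle P)) + B₀,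
        w ∈ B + B ∧ dist (φ w) (φ z * u) ≤ 1 / 100 := fun z hz =>
      hsum (α := 0) (singleton_subset_iff.2 hz.1) hB₀B
        (fun w hw => by rw [mem_singleton_iff.1 hw, dist_self]) (fun w hw => hw.2) (by norm_num)
    have := measureReal_add_add_le_of_separated hφ
      (hsum hB₀B hB₀B (fun w hw => hw.2) (fun w hw => hw.2) (by norm_num) (γ := 2 / 100))
      (hshift x hx) (hshift y hy)
      (by rw [mul_comm (φ x), Circle.dist_mul_left, dist_comm]; linarith [hx.2])
      (by rw [mul_comm (φ y), Circle.dist_mul_left, dist_comm]; linarith [hy.2])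
      (by rw [mul_comm (φ x), mul_comm (φ y), Circle.dist_mul_left]; linarith)
    have h0 := hraikov (hmeas _) (hmeas _) hB₀ne hB₀ne hB₀B hB₀B
    have h1 : ∀ z, volume.real ({z} + B₀) = volume.real B₀ := fun z => by
      rw [singleton_add, image_add_left, Measure.real, measure_preimage_add, Measure.real]
    rw [h1, h1] at this
    linarith
  by_cases hyu : dist (φ y) u ≤ 11 / 100
  · refine ⟨u, Or.inl fun x hx => ?_⟩
    by_cases hxE : x ∈ E
    · linarith [dist_triangle (φ x) (φ y) u, hclose x hxE]
    · by_contra! h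
      exact hxE ⟨hx, by linarith⟩
  by_cases hsq : dist (φ y * φ y) (u * u) ≤ 10 / 100
  · refine ⟨u * u, Or.inr fun x hx => ?_⟩
    rw [pow_two]
    by_cases hxE : x ∈ E
    · linarith [dist_triangle (φ x * φ x) (φ y * φ y) (u * u), hclose x hxE,
        Circle.dist_mul_mul_le (φ x) (φ x) (φ y) (φ y)]
    · have : dist (φ x) u ≤ 3 / 100 := by
        by_contra! h
        exact hxE ⟨hx, h⟩
      linarith [Circle.dist_mul_mul_le (φ x) (φ x) u u]
  · exfalso
    push Not at hyu hsq
    have hEne : E.Nonempty := ⟨y, hy⟩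
    have := measureReal_add_add_le_of_separated hφ
      (hsum hB₁B hB₁B (fun w hw => hw.2) (fun w hw => hw.2) (by norm_num) (γ := 6 / 100))
      (hsum hB₁B hEB (fun w hw => hw.2) hclose (by norm_num) (γ := 5 / 100))
      (hsum hEB hEB hclose hclose (by norm_num) (γ := 4 / 100))
      (by rw [Circle.dist_mul_left, dist_comm]; linarith)
      (by rw [dist_comm]; linarith)
      (by rw [mul_comm u, Circle.dist_mul_left, dist_comm]; linarith)
    have h1 := hraikov (hmeas _) (hmeas _) hB₁ne hB₁ne hB₁B hB₁B
    have h2 := hraikov (hmeas _) hEm hB₁ne hEne hB₁B hEB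
    have h3 := hraikov hEm hEm hEne hEne hEB hEB
    linarith

end AddCircle

/-- A sparse set of doubling less than four lies near a progression through its endpoints. -/
theorem exists_nat_near_multiples :
    ∃ C : ℝ, 0 < C ∧ ∀ (L : ℝ) (A : Set ℝ), 0 < L → MeasurableSet A → A ⊆ Icc 0 L →
      0 ∈ closure A → L ∈ closure A → 0 < volume A → volume (A + A) < 4 * volume A →
      C * volume.real A ≤ L →
      ∃ n : ℕ, 0 < n ∧ ∀ x ∈ A, ∃ k : ℤ, |x - k * (L / n)| ≤ L / n / 8 := by
  obtain ⟨C, hC, H⟩ := exists_int_volume_far_le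
  refine ⟨C + 2, by positivity, fun L A hL hA hAsub h0 hLc hpos hdbl hCL => ?_⟩
  have hfact : Fact (0 < L) := ⟨hL⟩
  have hAf : volume A ≠ ⊤ := ((measure_mono hAsub).trans_lt measure_Icc_lt_top).ne
  have ha : 0 < volume.real A := ENNReal.toReal_pos hpos.ne' hAf
  obtain ⟨m, u, hm, hfar⟩ := H L A hL hA hAsub hpos hdbl.le (by nlinarith)
  set π : ℝ → AddCircle L := (↑) with hπ
  set φ : AddCircle L → Circle := fun x => (m • x).toCircle with hφdef
  have hφ : Continuous φ := AddCircle.continuous_toCircle.comp (continuous_zsmul m)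
  have hadd : ∀ x y, φ (x + y) = φ x * φ y := fun x y => by
    simp only [hφdef, zsmul_add, AddCircle.toCircle_add]
  have hφπ : ∀ x : ℝ, φ (π x) = Real.fourierChar (m * (x / L)) := fun x => by
    simp only [hφdef, hπ]
    rw [← AddCircle.coe_zsmul, AddCircle.toCircle_apply_mk, Real.fourierChar_apply', zsmul_eq_mul]
    congr 1
    ring
  have hBvol : volume (π '' A) = volume A := volume_image_coe_eq_of_subset_Icc hA hAsub
  have hBreal : volume.real (π '' A) = volume.real A := by rw [Measure.real, hBvol, Measure.real]
  have hBdbl : volume.real (π '' A + π '' A) < 3 * volume.real (π '' A) := by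
    have hfold := (volume_image_coe_add_image_coe_add_le hA hAsub h0 hLc).trans_lt hdbl
    change volume (π '' A + π '' A) + volume A < 4 * volume A at hfold
    have := ENNReal.toReal_strict_mono (ENNReal.mul_ne_top (by simp) hAf) hfold
    rw [ENNReal.toReal_add (measure_ne_top _ _) hAf, ENNReal.toReal_mul] at this
    simp only [ENNReal.toReal_ofNat] at this
    change volume.real (π '' A + π '' A) + volume.real A < 4 * volume.real A at this
    rw [hBreal]
    linarith
  obtain ⟨v, hv⟩ := AddCircle.forall_dist_le_or_of_measureReal_le hφ hadd
    (AddCircle.measurableSet_image_coe hA) (u := u) (hBreal ▸ ha) (by rw [hBreal]; nlinarith) hBdbl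
    (by
      rw [hBreal]
      refine le_trans ?_ hfar
      have hsub : {x ∈ π '' A | 1 / 100 < dist (φ x) u} ⊆
          π '' {x ∈ A | 1 / 100 < dist (Real.fourierChar (m * (x / L))) u} := by
        rintro _ ⟨⟨x, hx, rfl⟩, hxu⟩
        exact ⟨x, ⟨hx, by rwa [← hφπ]⟩, rfl⟩
      refine (measureReal_mono hsub).trans
        (ENNReal.toReal_mono ?_ (AddCircle.volume_image_coe_le _))
      exact ((measure_mono fun x hx => hx.1).trans_lt hAf.lt_top).ne)
  obtain ⟨n, hn, hv⟩ : ∃ n : ℤ, n ≠ 0 ∧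
      ∀ x ∈ A, dist (Real.fourierChar (n * (x / L))) v ≤ 14 / 100 := by
    rcases hv with hv | hv
    · exact ⟨m, hm, fun x hx => by rw [← hφπ]; exact hv _ (mem_image_of_mem _ hx)⟩
    · refine ⟨2 * m, by simpa using hm, fun x hx => ?_⟩
      have := hv _ (mem_image_of_mem _ hx)
      rw [hφπ, ← AddChar.map_nsmul_eq_pow] at this
      convert this using 3
      push_cast
      ring
  have hv0 : dist 1 v ≤ 14 / 100 := by
    have hclosed : IsClosed {x : ℝ | dist (Real.fourierChar (n * (x / L))) v ≤ 14 / 100} :=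
      isClosed_le ((Real.continuous_fourierChar.comp (by fun_prop)).dist continuous_const)
        continuous_const
    have : dist (Real.fourierChar (n * ((0 : ℝ) / L))) v ≤ 14 / 100 :=
      closure_minimal hv hclosed h0
    rwa [zero_div, mul_zero, AddChar.map_zero_eq_one] at this
  have hnpos : (0 : ℝ) < n.natAbs := by exact_mod_cast Int.natAbs_pos.2 hn
  refine ⟨n.natAbs, Int.natAbs_pos.2 hn, fun x hx => ?_⟩
  obtain ⟨k, hk⟩ := Circle.exists_int_abs_sub_le (t := n * (x / L))
    (by linarith [dist_triangle_right (Real.fourierChar (n * (x / L))) 1 v, hv x hx])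
  refine ⟨n.sign * k, ?_⟩
  have habs : |(n : ℝ)| = n.natAbs := by rw [← Int.cast_abs, Int.abs_eq_natAbs, Int.cast_natCast]
  have hsign : (n : ℝ) * n.sign = n.natAbs := by
    rw [← habs, ← Int.cast_abs]
    exact_mod_cast Int.mul_sign_self n
  have hfac : n * (x / L) - k = n / L * (x - (n.sign * k : ℤ) * (L / n.natAbs)) := by
    push_cast
    field_simp
    linear_combination (L * k) * hsign
  rw [hfac, abs_mul, abs_div, habs, abs_of_pos hL] at hk
  rw [div_div, le_div_iff₀ (by positivity)]
  have := (div_mul_eq_mul_div (n.natAbs : ℝ) L _) ▸ hk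
  rw [div_le_iff₀ hL] at this
  linarith

theorem volume_progression_add_Icc_inter_Icc_le {m : ℕ} [NeZero m] {s a b : ℝ} (hs : 0 < s) :
    volume (((fun j : ℕ => (j : ℝ) * s) '' {j | j < m + 1} + Icc a b) ∩ Icc 0 (m * s)) ≤
      ENNReal.ofReal (m * (b - a)) := by
  have hmpos : (0 : ℝ) < m := by exact_mod_cast NeZero.pos m
  have hfact : Fact (0 < m * s) := ⟨by positivity⟩
  set U := (fun j : ℕ => (j : ℝ) * s) '' {j | j < m + 1} + Icc a b with hU
  have hUeq : U = ⋃ j ∈ Finset.range (m + 1), Icc (j * s + a) (j * s + b) := by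
    ext x
    simp only [hU, mem_add, mem_image, mem_iUnion, Finset.mem_range]
    constructor
    · rintro ⟨_, ⟨j, hj, rfl⟩, y, hy, rfl⟩
      exact ⟨j, hj, by linarith [hy.1], by linarith [hy.2]⟩
    · rintro ⟨j, hj, hx⟩
      exact ⟨j * s, ⟨j, hj, rfl⟩, x - j * s, ⟨by linarith [hx.1], by linarith [hx.2]⟩, by ring⟩
  have hUm : MeasurableSet U := by
    rw [hUeq]
    exact Finset.measurableSet_biUnion _ fun _ _ => measurableSet_Icc
  have hsub : ((↑) : ℝ → AddCircle (m * s)) '' (U ∩ Ioc 0 (0 + m * s)) ⊆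
      ⋃ j ∈ Finset.range m, ((↑) : ℝ → AddCircle (m * s)) '' Icc (j * s + a) (j * s + b) := by
    rintro _ ⟨x, ⟨hx, -⟩, rfl⟩
    rw [hUeq] at hx
    simp only [mem_iUnion, Finset.mem_range, Nat.lt_succ_iff_lt_or_eq] at hx ⊢
    obtain ⟨j, hj | rfl, hx⟩ := hx
    · exact ⟨j, hj, x, hx, rfl⟩
    · refine ⟨0, NeZero.pos j, x - j * s, ⟨?_, ?_⟩, ?_⟩
      · push_cast; linarith [hx.1]
      · push_cast; linarith [hx.2]
      · rw [AddCircle.coe_sub, AddCircle.coe_period, sub_zero]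
  calc volume (U ∩ Icc 0 (m * s)) = volume (U ∩ Ioc 0 (0 + m * s)) := by
        rw [zero_add]
        exact measure_congr ((ae_eq_refl U).inter Ioc_ae_eq_Icc.symm)
    _ = volume (((↑) : ℝ → AddCircle (m * s)) '' (U ∩ Ioc 0 (0 + m * s))) :=
        (AddCircle.volume_image_coe_of_subset_Ioc (hUm.inter measurableSet_Ioc)
          inter_subset_right).symm
    _ ≤ ∑ j ∈ Finset.range m,
          volume (((↑) : ℝ → AddCircle (m * s)) '' Icc (j * s + a) (j * s + b)) :=
        (measure_mono hsub).trans (measure_biUnion_finset_le _ _)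
    _ ≤ ∑ j ∈ Finset.range m, ENNReal.ofReal (b - a) := by
        refine Finset.sum_le_sum fun j _ => (AddCircle.volume_image_coe_le _).trans ?_
        rw [Real.volume_Icc, add_sub_add_left_eq_sub]
    _ = ENNReal.ofReal (m * (b - a)) := by
        rw [ENNReal.ofReal_mul hmpos.le, Finset.sum_const, Finset.card_range, nsmul_eq_mul,
          ENNReal.ofReal_natCast]

/-- The main estimate for sets whose convex hull has endpoints `0` and `L`. -/
theorem exists_progression_of_near_multiples {L : ℝ} (hL : 0 < L) {A : Set ℝ}
    (hA : MeasurableSet A) (hAsub : A ⊆ Icc 0 L) (h0 : 0 ∈ closure A) (hLc : L ∈ closure A)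
    (hpos : 0 < volume A) (hdbl : volume (A + A) < 4 * volume A)
    (hnear : ∃ n : ℕ, 0 < n ∧ ∀ x ∈ A, ∃ k : ℤ, |x - k * (L / n)| ≤ L / n / 8) :
    ∃ (s : ℝ) (n : ℕ) (a b : ℝ),
      A ⊆ (fun j : ℕ => (j : ℝ) * s) '' {j | j < n} + Icc a b ∧
      volume ((((fun j : ℕ => (j : ℝ) * s) '' {j | j < n} + Icc a b) ∩ Icc 0 L) \ A) +
        3 * volume A ≤ volume (A + A) := by
  classical
  obtain ⟨m, ⟨hm, hmA⟩, hmin⟩ : ∃ m : ℕ, (0 < m ∧ ∀ x ∈ A, ∃ k : ℤ, |x - k * (L / m)| ≤ L / m / 8) ∧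
      ∀ n < m, ¬ (0 < n ∧ ∀ x ∈ A, ∃ k : ℤ, |x - k * (L / n)| ≤ L / n / 8) :=
    ⟨Nat.find hnear, Nat.find_spec hnear, fun n hn => Nat.find_min hnear hn⟩
  have hmne : NeZero m := ⟨hm.ne'⟩
  have hmpos : (0 : ℝ) < m := by exact_mod_cast hm
  obtain ⟨s, rfl⟩ : ∃ s, L = m * s := ⟨L / m, by field_simp⟩
  have hs : 0 < s := pos_of_mul_pos_right hL hmpos.le
  have hms : m * s / m = s := by field_simp
  rw [hms] at hmA
  obtain ⟨a, b, hab, hsub, hmem, hvol⟩ := exists_Icc_of_near_multiples hs hA hAsub h0 hLc hpos hdbl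
    hmA (by
      rintro d hd ⟨e, rfl⟩ hcon
      have he : 0 < e := Nat.pos_of_mul_pos_left hm
      have heq : ((d * e : ℕ) : ℝ) * s / e = d * s := by push_cast; field_simp
      refine hmin e (by nlinarith) ⟨he, ?_⟩
      rw [heq]
      exact hcon)
  have hAU : A ⊆ (fun j : ℕ => (j : ℝ) * s) '' {j | j < m + 1} + Icc a b := by
    intro x hx
    obtain ⟨k, hk⟩ := hmem x hx
    have hk8 := hsub hk
    have hxI := hAsub hx
    have hk0 : -1 < k := by
      have : (-1 : ℝ) < k := by
        by_contra! h
        nlinarith [hk8.2, hxI.1]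
      exact_mod_cast this
    have hkm : k < m + 1 := by
      have : (k : ℝ) < m + 1 := by
        by_contra! h
        nlinarith [hk8.1, hxI.2]
      exact_mod_cast this
    lift k to ℕ using by omega
    exact ⟨k * s, ⟨k, by simpa using (by omega : k < m + 1), rfl⟩, x - k * s, hk, by ring⟩
  refine ⟨s, m + 1, a, b, hAU, ?_⟩
  have hUvol := volume_progression_add_Icc_inter_Icc_le (m := m) (a := a) (b := b) hs
  set U := ((fun j : ℕ => (j : ℝ) * s) '' {j | j < m + 1} + Icc a b) ∩ Icc 0 (m * s) with hU
  have hsplit := measure_sdiff_add_inter (μ := volume) U hA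
  rw [inter_eq_right.2 (subset_inter hAU hAsub)] at hsplit
  calc volume (U \ A) + 3 * volume A = (volume (U \ A) + volume A) + 2 * volume A := by ring
    _ ≤ ENNReal.ofReal (m * (b - a)) + 2 * volume A := by rw [hsplit]; gcongr
    _ ≤ volume (A + A) := hvol

theorem stmt_18 :
    ∃ C : ℝ, 0 < C ∧
      ∀ A : Set ℝ, MeasurableSet A → Bornology.IsBounded A → 0 < volume A →
        ENNReal.ofReal C * volume A ≤ volume (convexHull ℝ A) →
        ∀ θ : ℝ, θ ∈ Set.Ico (0 : ℝ) 1 →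
          volume (A + A) ≤ ENNReal.ofReal (3 + θ) * volume A →
          ∃ (x₀ v : ℝ) (m : ℕ) (a b : ℝ),
            A ⊆ ((fun j : ℕ => x₀ + j * v) '' {j | j < m}) + Set.Icc a b ∧
            volume (((((fun j : ℕ => x₀ + j * v) '' {j | j < m}) + Set.Icc a b) ∩
                convexHull ℝ A) \ A) ≤ ENNReal.ofReal θ * volume A := by
  obtain ⟨C, hC, H⟩ := exists_nat_near_multiples
  refine ⟨C, hC, fun A hA hAb hpos hconv θ hθ hdbl => ?_⟩
  have hAf : volume A ≠ ⊤ := hAb.measure_lt_top.ne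
  have ha : 0 < volume.real A := ENNReal.toReal_pos hpos.ne' hAf
  have hne : A.Nonempty := nonempty_of_measure_ne_zero hpos.ne'
  set p := sInf A with hp
  set L := sSup A - p with hLdef
  have hAI : A ⊆ Icc p (p + L) := fun x hx =>
    ⟨csInf_le hAb.bddBelow hx, by rw [hLdef, add_sub_cancel]; exact le_csSup hAb.bddAbove hx⟩
  have hcoI : convexHull ℝ A ⊆ Icc p (p + L) := convexHull_min hAI (convex_Icc _ _)
  have hCL : ENNReal.ofReal C * volume A ≤ ENNReal.ofReal L := by
    refine hconv.trans ((measure_mono hcoI).trans ?_)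
    rw [Real.volume_Icc, add_sub_cancel_left]
  have hCLr : C * volume.real A ≤ L := by
    rw [← ENNReal.ofReal_toReal hAf, ← ENNReal.ofReal_mul hC.le] at hCL
    by_contra! h
    have := (ENNReal.ofReal_lt_ofReal_iff (by positivity)).2 h
    exact absurd hCL (not_le.2 this)
  have hL : 0 < L := lt_of_lt_of_le (by positivity) hCLr
  set A' := (fun x => p + x) ⁻¹' A with hA'
  have hA'm : MeasurableSet A' := hA.preimage (measurable_const_add p)
  have hA'vol : volume A' = volume A := measure_preimage_add _ _ _
  have hA'sub : A' ⊆ Icc 0 L := fun x hx =>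
    ⟨by linarith [(hAI hx).1], by linarith [(hAI hx).2]⟩
  have hclos : ∀ x, p + x ∈ closure A → x ∈ closure A' := fun x hx => by
    have := (Homeomorph.addLeft p).preimage_closure A
    exact this.subset hx
  have hA'add : volume (A' + A') = volume (A + A) := by
    rw [← measure_preimage_add volume (p + p) (A + A)]
    congr 1
    ext x
    simp only [mem_add, mem_preimage, hA']
    constructor
    · rintro ⟨y, hy, z, hz, rfl⟩
      exact ⟨_, hy, _, hz, by ring⟩
    · rintro ⟨y, hy, z, hz, h⟩
      exact ⟨y - p, by simpa using hy, z - p, by simpa using hz, by linarith⟩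
  have hdbl' : volume (A' + A') < 4 * volume A' := by
    rw [hA'add, hA'vol]
    refine hdbl.trans_lt (ENNReal.mul_lt_mul_left hpos.ne' hAf ?_)
    rw [show (4 : ENNReal) = ENNReal.ofReal 4 by simp]
    exact (ENNReal.ofReal_lt_ofReal_iff (by norm_num)).2 (by linarith [hθ.2])
  have h0 : 0 ∈ closure A' := hclos 0 (by
    rw [add_zero]; exact csInf_mem_closure hne hAb.bddBelow)
  have hLc : L ∈ closure A' := hclos L (by
    rw [hLdef, add_sub_cancel]; exact csSup_mem_closure hne hAb.bddAbove)
  have hA'pos : 0 < volume A' := hA'vol ▸ hpos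
  obtain ⟨s, n, a, b, hcov, hbound⟩ := exists_progression_of_near_multiples hL hA'm hA'sub h0 hLc
    hA'pos hdbl' (H L A' hL hA'm hA'sub h0 hLc hA'pos hdbl'
      (by rwa [Measure.real, hA'vol]))
  have hshift : ∀ x, p + x ∈ (fun j : ℕ => p + j * s) '' {j | j < n} + Icc a b ↔
      x ∈ (fun j : ℕ => (j : ℝ) * s) '' {j | j < n} + Icc a b := by
    intro x
    simp only [mem_add, mem_image]
    constructor
    · rintro ⟨_, ⟨j, hj, rfl⟩, y, hy, h⟩
      exact ⟨_, ⟨j, hj, rfl⟩, y, hy, by linarith⟩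
    · rintro ⟨_, ⟨j, hj, rfl⟩, y, hy, h⟩
      exact ⟨_, ⟨j, hj, rfl⟩, y, hy, by linarith⟩
  refine ⟨p, s, n, a, b, fun x hx => ?_, ?_⟩
  · have := (hshift (x - p)).2 (hcov (by simpa [hA'] using hx))
    rwa [add_sub_cancel] at this
  · rw [hA'add, hA'vol] at hbound
    have h3 := hbound.trans hdbl
    rw [add_comm 3 θ, ENNReal.ofReal_add hθ.1 (by norm_num), add_mul, ENNReal.ofReal_ofNat] at h3
    refine le_trans ?_ (ENNReal.le_of_add_le_add_right (ENNReal.mul_ne_top (by simp) hAf) h3)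
    rw [← measure_preimage_add volume p]
    refine measure_mono fun x hx => ⟨⟨(hshift x).1 hx.1.1, ?_⟩, hx.2⟩
    have := hcoI hx.1.2
    exact ⟨by linarith [this.1], by linarith [this.2]⟩
end

section
/- Let d, k ∈ ℕ with k+d ≥ 1, and let μ be the product of counting measure on ℤ^d with Lebesgue measure on ℝ^k, regarded as a measure on ℤ^d × ℝ^k (applied to arbitrary sets as outer measure). For I ⊆ {1,…,d} let π'_I : ℤ^d × ℝ^k → ℤ^{{1,…,d}∖I} × ℝ^k be the projection deleting the ℤ-coordinates indexed by I, and let μ_I denote the analogous product measure on the target. Then for all nonempty sets A, B ⊆ ℤ^d × ℝ^k of finite μ-measure, ∑_{I ⊆ {1,…,d}} μ_I(π'_I(A+B)) ≥ (μ(A)^{1/(k+d)} + μ(B)^{1/(k+d)})^{k+d}. -/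
open Set Pointwise MeasureTheory ENNReal

/-- The product of counting measure on `ℤ^d` with Lebesgue measure on `ℝ^k`. -/
noncomputable def prodMu (d k : ℕ) : Measure ((Fin d → ℤ) × (Fin k → ℝ)) :=
  (Measure.count : Measure (Fin d → ℤ)).prod (volume : Measure (Fin k → ℝ))

/-- The analogous product measure on the target of the projection deleting the
`ℤ`-coordinates indexed by `I`. -/
noncomputable def prodMuI (d k : ℕ) (I : Finset (Fin d)) :
    Measure (({i : Fin d // i ∉ I} → ℤ) × (Fin k → ℝ)) :=
  (Measure.count : Measure ({i : Fin d // i ∉ I} → ℤ)).prod (volume : Measure (Fin k → ℝ))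

/-- The projection `ℤ^d × ℝ^k → ℤ^{[d] ∖ I} × ℝ^k` deleting the `ℤ`-coordinates in `I`. -/
def projI (d k : ℕ) (I : Finset (Fin d)) :
    ((Fin d → ℤ) × (Fin k → ℝ)) → (({i : Fin d // i ∉ I} → ℤ) × (Fin k → ℝ)) :=
  fun p => (fun i => p.1 i.1, p.2)

open scoped NNReal Topology

section LayerCake

variable {γ : Type*} [MeasurableSpace γ]

theorem lintegral_eq_setLIntegral_Ioo_meas_lt (ν : Measure γ) {f : γ → ℝ≥0∞} (hf : Measurable f)
    (hf1 : ∀ x, f x ≤ 1) :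
    ∫⁻ x, f x ∂ν = ∫⁻ t in Ioo (0 : ℝ) 1, ν {x | ENNReal.ofReal t < f x} := by
  have hfin : ∀ x, f x ≠ ⊤ := fun x => ((hf1 x).trans_lt one_lt_top).ne
  have hofReal : ∀ x, f x = ENNReal.ofReal (f x).toReal := fun x => (ofReal_toReal (hfin x)).symm
  have hset : ∀ t : ℝ, 0 ≤ t → {x | ENNReal.ofReal t < f x} = {x | t < (f x).toReal} := by
    intro t ht
    ext x
    exact ofReal_lt_iff_lt_toReal ht (hfin x)
  rw [lintegral_congr hofReal, lintegral_eq_lintegral_meas_lt ν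
    (Filter.Eventually.of_forall fun x => toReal_nonneg) hf.ennreal_toReal.aemeasurable,
    ← lintegral_indicator measurableSet_Ioi, ← lintegral_indicator measurableSet_Ioo]
  refine lintegral_congr fun t => ?_
  by_cases ht0 : t ∈ Ioi (0 : ℝ)
  · by_cases ht1 : t < 1
    · rw [indicator_of_mem ht0, indicator_of_mem (show t ∈ Ioo (0 : ℝ) 1 from ⟨ht0, ht1⟩),
        hset t (le_of_lt ht0)]
    · have hempty : {x | t < (f x).toReal} = ∅ := by
        ext x
        simpa using (toReal_mono one_ne_top (hf1 x)).trans (by simpa using ht1)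
      rw [indicator_of_mem ht0, indicator_of_notMem fun h => ht1 h.2, hempty, measure_empty]
  · rw [indicator_of_notMem ht0, indicator_of_notMem fun h => ht0 h.1]

theorem lintegral_add_lintegral_le_of_min_le [Add γ] {ν : Measure γ} {c : ℝ≥0∞}
    (hν : ∀ S T : Set γ, MeasurableSet S → MeasurableSet T → S.Nonempty → T.Nonempty →
      ν S + ν T ≤ ν (S + T) + c)
    {f g h : γ → ℝ≥0∞} (hf : Measurable f) (hg : Measurable g) (hh : Measurable h)
    (hf1 : ⨆ x, f x = 1) (hg1 : ⨆ x, g x = 1) (hfgh : ∀ x y, min (f x) (g y) ≤ h (x + y)) :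
    ∫⁻ x, f x ∂ν + ∫⁻ x, g x ∂ν ≤ ∫⁻ x, h x ∂ν + c := by
  have hle : ∫⁻ x, min (h x) 1 ∂ν ≤ ∫⁻ x, h x ∂ν := lintegral_mono fun x => min_le_left _ _
  refine le_trans ?_ (add_le_add_left hle c)
  have hf1' : ∀ x, f x ≤ 1 := fun x => hf1 ▸ le_iSup f x
  have hg1' : ∀ x, g x ≤ 1 := fun x => hg1 ▸ le_iSup g x
  rw [lintegral_eq_setLIntegral_Ioo_meas_lt ν hf hf1',
    lintegral_eq_setLIntegral_Ioo_meas_lt ν hg hg1',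
    lintegral_eq_setLIntegral_Ioo_meas_lt ν (hh.min measurable_const) fun x => min_le_right _ _]
  calc _ ≤ ∫⁻ t in Ioo (0 : ℝ) 1,
        (ν {x | ENNReal.ofReal t < f x} + ν {x | ENNReal.ofReal t < g x}) := le_lintegral_add _ _
    _ ≤ ∫⁻ t in Ioo (0 : ℝ) 1, (ν {x | ENNReal.ofReal t < min (h x) 1} + c) := by
        refine setLIntegral_mono' measurableSet_Ioo fun t ht => ?_
        have ht1 : ENNReal.ofReal t < 1 := by simpa using ht.2
        refine (hν _ _ (measurableSet_lt measurable_const hf) (measurableSet_lt measurable_const hg)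
          (lt_iSup_iff.1 (ht1.trans_eq hf1.symm)) (lt_iSup_iff.1 (ht1.trans_eq hg1.symm))).trans
          (add_le_add_left (measure_mono ?_) c)
        rintro _ ⟨x, hx, y, hy, rfl⟩
        exact lt_min ((lt_min hx hy).trans_le (hfgh x y)) ht1
    _ = _ := by
        rw [lintegral_add_right _ measurable_const]
        simp

end LayerCake

/-- Radon's inequality for two summands. -/
theorem add_pow_succ_le_mul_div_add_div {α β : ℝ≥0} (hα : α ≠ 0) (hβ : β ≠ 0) (p q : ℝ≥0) (n : ℕ) :
    (p + q) ^ (n + 1) ≤ (α + β) ^ n * (p ^ (n + 1) / α ^ n + q ^ (n + 1) / β ^ n) := by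
  have hαβ : α + β ≠ 0 := by positivity
  have key := NNReal.pow_arith_mean_le_arith_mean_pow Finset.univ
    ![α / (α + β), β / (α + β)] ![p / α, q / β] (by simp; field_simp) (n + 1)
  simp only [Fin.sum_univ_two, Matrix.cons_val_zero, Matrix.cons_val_one] at key
  calc (p + q) ^ (n + 1)
      = (α + β) ^ (n + 1) * (α / (α + β) * (p / α) + β / (α + β) * (q / β)) ^ (n + 1) := by
        rw [← mul_pow]; congr 1; field_simp
    _ ≤ (α + β) ^ (n + 1) *
        (α / (α + β) * (p / α) ^ (n + 1) + β / (α + β) * (q / β) ^ (n + 1)) := by gcongr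
    _ = _ := by
        simp only [div_pow]
        field_simp
        ring

theorem exists_pow_eq_of_ne_zero {m : ℝ≥0∞} (n : ℕ) (h0 : m ≠ 0) (htop : m ≠ ⊤)
    (h1 : n = 0 → m = 1) : ∃ α : ℝ≥0, α ≠ 0 ∧ m = (α : ℝ≥0∞) ^ n := by
  lift m to ℝ≥0 using htop
  rcases eq_or_ne n 0 with rfl | hn
  · exact ⟨1, one_ne_zero, by simpa using h1 rfl⟩
  · have hpow : (m ^ ((n : ℝ)⁻¹)) ^ n = m := NNReal.rpow_inv_natCast_pow m hn
    refine ⟨m ^ ((n : ℝ)⁻¹), ?_, by exact_mod_cast hpow.symm⟩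
    intro h
    rw [h, zero_pow hn] at hpow
    exact h0 (by simp [← hpow])

/-- The inductive step of the Brunn-Minkowski inequality, in terms of the measures `a`, `b` and
(a lower bound) `h` of the fibres. -/
theorem mul_add_pow_succ_le_lintegral {γ : Type*} [MeasurableSpace γ] [Add γ] {ν : Measure γ}
    {c : ℝ≥0∞}
    (hν : ∀ S T : Set γ, MeasurableSet S → MeasurableSet T → S.Nonempty → T.Nonempty →
      ν S + ν T ≤ ν (S + T) + c)
    {n : ℕ} {a b h : γ → ℝ≥0∞} (ha : Measurable a) (hb : Measurable b) (hh : Measurable h)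
    (hatop : ⨆ x, a x ≠ ⊤) (hbtop : ⨆ x, b x ≠ ⊤)
    (ha0 : n = 0 → ∀ x, a x = 0 ∨ a x = 1) (hb0 : n = 0 → ∀ x, b x = 0 ∨ b x = 1)
    (hab : ∀ x y (s p q : ℝ≥0), s ≠ 0 → p ≠ 0 → q ≠ 0 → s * p ^ n ≤ a x → s * q ^ n ≤ b y →
      s * (p + q) ^ n ≤ h (x + y))
    {m : ℝ≥0∞} (hm : ∀ z, h z ≤ m)
    {s p q : ℝ≥0} (hs : s ≠ 0) (hp : p ≠ 0) (hq : q ≠ 0)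
    (hpa : s * p ^ (n + 1) ≤ ∫⁻ x, a x ∂ν) (hqb : s * q ^ (n + 1) ≤ ∫⁻ x, b x ∂ν) :
    s * (p + q) ^ (n + 1) ≤ ∫⁻ x, h x ∂ν + c * m := by
  have root : ∀ {f : γ → ℝ≥0∞} {r : ℝ≥0}, r ≠ 0 → ⨆ x, f x ≠ ⊤ →
      (n = 0 → ∀ x, f x = 0 ∨ f x = 1) → s * r ^ (n + 1) ≤ ∫⁻ x, f x ∂ν →
      ∃ α : ℝ≥0, α ≠ 0 ∧ ⨆ x, f x = (α : ℝ≥0∞) ^ n := by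
    intro f r hr htop hf0 hint
    have hne : ⨆ x, f x ≠ 0 := by
      intro h0
      rw [ENNReal.iSup_eq_zero] at h0
      simp [h0, hs, hr] at hint
    refine exists_pow_eq_of_ne_zero n hne htop fun hn => le_antisymm (iSup_le fun x => ?_) ?_
    · rcases hf0 hn x with h | h <;> simp [h]
    · obtain ⟨x, hx⟩ : ∃ x, f x ≠ 0 := by
        by_contra! h0
        exact hne (ENNReal.iSup_eq_zero.2 h0)
      exact ((hf0 hn x).resolve_left hx) ▸ le_iSup f x
  obtain ⟨α, hα, hsa⟩ := root hp hatop ha0 hpa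
  obtain ⟨β, hβ, hsb⟩ := root hq hbtop hb0 hqb
  have hαn : (α : ℝ≥0∞) ^ n ≠ 0 := by simp [hα]
  have hβn : (β : ℝ≥0∞) ^ n ≠ 0 := by simp [hβ]
  have hαt : (α : ℝ≥0∞) ^ n ≠ ⊤ := by simp
  have hβt : (β : ℝ≥0∞) ^ n ≠ ⊤ := by simp
  have hαβ : ((α : ℝ≥0∞) + β) ^ n ≠ 0 := by simp [hα]
  have hαβt : ((α : ℝ≥0∞) + β) ^ n ≠ ⊤ := by simp
  have hmin : ∀ x y, min (a x / α ^ n) (b y / β ^ n) ≤ h (x + y) / (α + β) ^ n := by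
    intro x y
    have htop : min (a x / α ^ n) (b y / β ^ n) ≠ ⊤ :=
      ne_top_of_le_ne_top (ENNReal.div_ne_top (ne_top_of_le_ne_top hatop (le_iSup a x)) hαn)
        (min_le_left _ _)
    generalize ht : min (a x / (α : ℝ≥0∞) ^ n) (b y / (β : ℝ≥0∞) ^ n) = t at htop
    lift t to ℝ≥0 using htop
    rcases eq_or_ne t 0 with rfl | ht0
    · simp
    rw [ENNReal.le_div_iff_mul_le (.inl hαβ) (.inl hαβt)]
    refine hab x y t α β ht0 hα hβ ?_ ?_
    · rw [← ENNReal.le_div_iff_mul_le (.inl hαn) (.inl hαt)]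
      exact ht ▸ min_le_left _ _
    · rw [← ENNReal.le_div_iff_mul_le (.inl hβn) (.inl hβt)]
      exact ht ▸ min_le_right _ _
  have hsup : ∀ {f : γ → ℝ≥0∞} {r : ℝ≥0∞}, r ≠ 0 → r ≠ ⊤ → ⨆ x, f x = r →
      ⨆ x, f x / r = 1 := by
    intro f r h0 ht hr
    rw [← ENNReal.iSup_div, hr, ENNReal.div_self h0 ht]
  have hint := lintegral_add_lintegral_le_of_min_le hν (ha.div_const _) (hb.div_const _)
    (hh.div_const _) (hsup hαn hαt hsa) (hsup hβn hβt hsb) hmin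
  have hdiv : ∀ (f : γ → ℝ≥0∞) (r : ℝ≥0∞), Measurable f →
      ∫⁻ x, f x / r ∂ν = (∫⁻ x, f x ∂ν) / r := by
    intro f r hf
    simp only [div_eq_mul_inv]
    exact lintegral_mul_const _ hf
  rw [hdiv _ _ ha, hdiv _ _ hb, hdiv _ _ hh] at hint
  have hcm : (α + β : ℝ≥0∞) ^ n ≤ m := by
    rw [← one_mul ((α + β : ℝ≥0∞) ^ n), ← ENNReal.le_div_iff_mul_le (.inl hαβ) (.inl hαβt)]
    refine le_of_forall_lt fun t ht => ?_
    obtain ⟨x, hx⟩ := lt_iSup_iff.1 (ht.trans_eq (hsup hαn hαt hsa).symm)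
    obtain ⟨y, hy⟩ := lt_iSup_iff.1 (ht.trans_eq (hsup hβn hβt hsb).symm)
    exact (lt_min hx hy).trans_le
      ((hmin x y).trans (ENNReal.div_le_div_right (hm _) _))
  calc (s : ℝ≥0∞) * (p + q) ^ (n + 1)
      ≤ s * ((α + β) ^ n * (p ^ (n + 1) / α ^ n + q ^ (n + 1) / β ^ n)) := by
        gcongr
        have := add_pow_succ_le_mul_div_add_div hα hβ p q n
        have h2 := ENNReal.coe_le_coe.2 this
        push_cast at h2
        rwa [ENNReal.coe_div (by positivity), ENNReal.coe_div (by positivity)] at h2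
    _ = (α + β) ^ n * ((s * p ^ (n + 1)) / α ^ n + (s * q ^ (n + 1)) / β ^ n) := by
        simp only [div_eq_mul_inv]; ring
    _ ≤ (α + β) ^ n * ((∫⁻ x, a x ∂ν) / α ^ n + (∫⁻ x, b x ∂ν) / β ^ n) := by
        gcongr
    _ ≤ (α + β) ^ n * ((∫⁻ x, h x ∂ν) / (α + β) ^ n + c) := by gcongr
    _ = ∫⁻ x, h x ∂ν + c * (α + β) ^ n := by
        rw [mul_add, ENNReal.mul_div_cancel hαβ hαβt, mul_comm _ c]
    _ ≤ _ := by gcongr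

theorem count_add_count_le_count_add (S T : Set ℤ) (hS : S.Nonempty) (hT : T.Nonempty) :
    Measure.count S + Measure.count T ≤ Measure.count (S + T) + 1 := by
  by_cases h : (S + T).Finite
  · obtain ⟨hSf, hTf⟩ | rfl | rfl := Set.finite_add.1 h
    · lift S to Finset ℤ using hSf
      lift T to Finset ℤ using hTf
      have key := cauchy_davenport_add_of_linearOrder_isCancelAdd (s := S) (t := T)
        (by simpa using hS) (by simpa using hT)
      rw [← Finset.coe_add, Measure.count_apply_finset, Measure.count_apply_finset,
        Measure.count_apply_finset]
      norm_cast
      omega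
    · simp at hS
    · simp at hT
  · rw [Measure.count_apply_infinite h]
    simp

theorem IsCompact.volume_add_volume_le {S T : Set ℝ} (hSc : IsCompact S) (hTc : IsCompact T)
    (hS : S.Nonempty) (hT : T.Nonempty) : volume S + volume T ≤ volume (S + T) := by
  obtain ⟨x, hxS, hx⟩ := hSc.exists_isGreatest hS
  obtain ⟨y, hyT, hy⟩ := hTc.exists_isLeast hT
  have hdisj : AEDisjoint volume (y +ᵥ S) (x +ᵥ T) := by
    refine measure_mono_null (t := {x + y}) ?_ (by simp)
    rintro _ ⟨⟨s, hs, rfl⟩, t, ht, hst⟩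
    have h1 := hx hs
    have h2 := hy ht
    simp only [vadd_eq_add, mem_singleton_iff] at hst ⊢
    linarith
  have hmeas : MeasurableSet (x +ᵥ T) := hTc.measurableSet.const_vadd x
  calc volume S + volume T = volume (y +ᵥ S) + volume (x +ᵥ T) := by
        simp only [measure_vadd]
    _ = volume ((y +ᵥ S) ∪ (x +ᵥ T)) := (measure_union₀ hmeas.nullMeasurableSet hdisj).symm
    _ ≤ volume (S + T) := by
        refine measure_mono (union_subset ?_ ?_)
        · rintro _ ⟨s, hs, rfl⟩
          exact ⟨s, hs, y, hyT, add_comm _ _⟩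
        · rintro _ ⟨t, ht, rfl⟩
          exact ⟨x, hxS, t, ht, rfl⟩

theorem Real.volume_add_volume_le {S T : Set ℝ} (hSm : MeasurableSet S) (hTm : MeasurableSet T)
    (hS : S.Nonempty) (hT : T.Nonempty) : volume S + volume T ≤ volume (S + T) := by
  rcases eq_or_ne (volume S) 0 with hS0 | hS0
  · obtain ⟨x, hx⟩ := hS
    rw [hS0, zero_add, ← measure_vadd volume x T]
    exact measure_mono (by rintro _ ⟨t, ht, rfl⟩; exact ⟨x, hx, t, ht, rfl⟩)
  rcases eq_or_ne (volume T) 0 with hT0 | hT0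
  · obtain ⟨y, hy⟩ := hT
    rw [hT0, add_zero, ← measure_vadd volume y S]
    exact measure_mono (by rintro _ ⟨t, ht, rfl⟩; exact ⟨t, ht, y, hy, add_comm _ _⟩)
  refine le_of_forall_lt fun r hr => ?_
  obtain ⟨u, hu, v, hv, huv⟩ := ENNReal.exists_lt_add_of_lt_add hr hS0 hT0
  obtain ⟨K, hKS, hK, huK⟩ := hSm.exists_lt_isCompact hu
  obtain ⟨L, hLT, hL, hvL⟩ := hTm.exists_lt_isCompact hv
  calc r < u + v := huv
    _ ≤ volume K + volume L := add_le_add huK.le hvL.le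
    _ ≤ volume (K + L) := hK.volume_add_volume_le hL
        (nonempty_of_measure_ne_zero (bot_lt_of_lt huK).ne')
        (nonempty_of_measure_ne_zero (bot_lt_of_lt hvL).ne')
    _ ≤ volume (S + T) := measure_mono (add_subset_add hKS hLT)

/-- The fibre of `K` over the first coordinate `x`. -/
def consFiber {n : ℕ} (K : Set (Fin (n + 1) → ℝ)) (x : ℝ) : Set (Fin n → ℝ) :=
  {w | (Fin.cons x w : Fin (n + 1) → ℝ) ∈ K}

theorem measurable_volume_consFiber {n : ℕ} {K : Set (Fin (n + 1) → ℝ)}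
    (hK : MeasurableSet K) :
    Measurable fun x : ℝ => volume (consFiber K x) := by
  have := measurable_measure_prodMk_left (ν := (volume : Measure (Fin n → ℝ)))
    ((MeasurableEquiv.piFinSuccAbove (fun _ : Fin (n + 1) => ℝ) 0).symm.measurable hK)
  simpa [MeasurableEquiv.piFinSuccAbove, Fin.consEquiv, consFiber, preimage] using this

theorem volume_eq_lintegral_consFiber {n : ℕ} {K : Set (Fin (n + 1) → ℝ)}
    (hK : MeasurableSet K) :
    volume K = ∫⁻ x : ℝ, volume (consFiber K x) := by
  have hpres := (volume_preserving_piFinSuccAbove (fun _ : Fin (n + 1) => ℝ) 0).symm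
  rw [← hpres.measure_preimage hK.nullMeasurableSet, Measure.volume_eq_prod,
    Measure.prod_apply (hpres.measurable hK)]
  simp [MeasurableEquiv.piFinSuccAbove, Fin.consEquiv, consFiber, preimage]

theorem volume_eq_zero_or_one_of_fin_zero (S : Set (Fin 0 → ℝ)) :
    volume S = 0 ∨ volume S = 1 := by
  rcases S.eq_empty_or_nonempty with rfl | hS
  · simp
  · rw [Subsingleton.eq_univ_of_nonempty hS]
    right
    simp [volume_pi]

/-- The Brunn-Minkowski inequality for compact sets. -/
theorem IsCompact.mul_add_pow_le_volume_add {n : ℕ} {K L : Set (Fin n → ℝ)} (hK : IsCompact K)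
    (hL : IsCompact L) {s p q : ℝ≥0} (hs : s ≠ 0) (hp : p ≠ 0) (hq : q ≠ 0)
    (hpK : s * p ^ n ≤ volume K) (hqL : s * q ^ n ≤ volume L) :
    s * (p + q) ^ n ≤ volume (K + L) := by
  induction n generalizing s p q with
  | zero =>
    have hne : ∀ {M : Set (Fin 0 → ℝ)} {r : ℝ≥0}, s * r ^ 0 ≤ volume M → M.Nonempty := by
      intro M r h
      refine nonempty_of_measure_ne_zero (μ := volume) (ne_of_gt (lt_of_lt_of_le ?_ h))
      simpa [pos_iff_ne_zero] using hs
    rw [Subsingleton.eq_univ_of_nonempty ((hne hpK).add (hne hqL)),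
      ← Subsingleton.eq_univ_of_nonempty (hne hpK)]
    simpa using hpK
  | succ n ih =>
    have hcont : ∀ x : ℝ, Continuous fun w : Fin n → ℝ => (Fin.cons x w : Fin (n + 1) → ℝ) :=
      fun x => Continuous.finCons continuous_const continuous_id
    have hsub : ∀ (M : Set (Fin (n + 1) → ℝ)) (x : ℝ),
        consFiber M x ⊆ Fin.tail '' M :=
      fun M x w hw => ⟨_, hw, Fin.tail_cons _ _⟩
    have htail : ∀ {M : Set (Fin (n + 1) → ℝ)}, IsCompact M →
        IsCompact ((Fin.tail : (Fin (n + 1) → ℝ) → Fin n → ℝ) '' M) :=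
      fun hM => hM.image (continuous_pi fun i => continuous_apply i.succ)
    have hfib : ∀ {M : Set (Fin (n + 1) → ℝ)}, IsCompact M → ∀ x : ℝ,
        IsCompact (consFiber M x) := fun hM x =>
      (htail hM).of_isClosed_subset (hM.isClosed.preimage (hcont x)) (hsub _ x)
    have hbdd : ∀ {M : Set (Fin (n + 1) → ℝ)}, IsCompact M →
        ⨆ x : ℝ, volume (consFiber M x) ≠ ⊤ := fun hM =>
      ne_top_of_le_ne_top (htail hM).measure_lt_top.ne (iSup_le fun x => measure_mono (hsub _ x))
    have hone : n = 0 → ∀ (M : Set (Fin (n + 1) → ℝ)) (x : ℝ),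
        volume (consFiber M x) = 0 ∨
        volume (consFiber M x) = 1 := by
      rintro rfl M x
      exact volume_eq_zero_or_one_of_fin_zero _
    have hKL := hK.add hL
    rw [volume_eq_lintegral_consFiber hK.measurableSet] at hpK
    rw [volume_eq_lintegral_consFiber hL.measurableSet] at hqL
    rw [volume_eq_lintegral_consFiber hKL.measurableSet]
    have key := mul_add_pow_succ_le_lintegral (ν := volume) (c := 0) (m := ⊤)
      (fun S T hS hT hSne hTne => by simpa using Real.volume_add_volume_le hS hT hSne hTne)
      (measurable_volume_consFiber hK.measurableSet)
      (measurable_volume_consFiber hL.measurableSet)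
      (measurable_volume_consFiber hKL.measurableSet)
      (hbdd hK) (hbdd hL) (fun hn => hone hn K) (fun hn => hone hn L) ?_ (fun _ => le_top)
      hs hp hq hpK hqL
    · simpa using key
    · intro x y s p q hs hp hq hx hy
      refine (ih (hfib hK x) (hfib hL y) hs hp hq hx hy).trans (measure_mono ?_)
      rintro _ ⟨v, hv, w, hw, rfl⟩
      refine ⟨_, hv, _, hw, ?_⟩
      ext i
      cases i using Fin.cases <;> simp

section Density

variable {k : ℕ}

/-- The points at which `S` has Lebesgue (outer) density one. -/
def densityPoints (S : Set (Fin k → ℝ)) : Set (Fin k → ℝ) :=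
  {x | Filter.Tendsto
    (fun r => volume (S ∩ Metric.closedBall x r) / volume (Metric.closedBall x r)) (𝓝[>] 0) (𝓝 1)}

theorem densityPoints_toMeasurable (S : Set (Fin k → ℝ)) :
    densityPoints (toMeasurable volume S) = densityPoints S := by
  unfold densityPoints
  simp only [Measure.measure_toMeasurable_inter_of_sFinite Metric.isClosed_closedBall.measurableSet]

theorem densityPoints_ae_eq {S : Set (Fin k → ℝ)} (hS : MeasurableSet S) :
    densityPoints S =ᵐ[volume] S := by
  filter_upwards [Besicovitch.ae_tendsto_measure_inter_div_of_measurableSet volume hS] with x hx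
  by_cases hxS : x ∈ S
  · rw [indicator_of_mem hxS] at hx
    exact propext ⟨fun _ => hxS, fun _ => hx⟩
  · rw [indicator_of_notMem hxS] at hx
    exact propext ⟨fun h => absurd (tendsto_nhds_unique hx h) zero_ne_one, fun h => absurd h hxS⟩

theorem measure_densityPoints {S : Set (Fin k → ℝ)} :
    volume (densityPoints S) = volume S := by
  rw [← densityPoints_toMeasurable, measure_congr (densityPoints_ae_eq
    (measurableSet_toMeasurable volume S)), measure_toMeasurable]

theorem densityPoints_add_subset {A B U : Set (Fin k → ℝ)} (hU : A + B ⊆ U) :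
    densityPoints A + B ⊆ densityPoints U := by
  rintro _ ⟨a, ha, b, hb, rfl⟩
  refine tendsto_of_tendsto_of_tendsto_of_le_of_le ha tendsto_const_nhds (fun r => ?_) fun r => ?_
  · have hball : Metric.closedBall (a + b) r = b +ᵥ Metric.closedBall a r := by
      rw [Metric.vadd_closedBall, vadd_eq_add, add_comm]
    simp only [hball, measure_vadd]
    refine ENNReal.div_le_div_right ?_ _
    rw [← measure_vadd volume b (A ∩ _), vadd_set_inter]
    refine measure_mono (inter_subset_inter_left _ ?_)
    rintro _ ⟨x, hx, rfl⟩
    exact hU ⟨x, hx, b, hb, add_comm _ _⟩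
  · exact ENNReal.div_le_of_le_mul (by simpa using measure_mono inter_subset_right)

theorem exists_isCompact_subset_densityPoints {S : Set (Fin k → ℝ)} {r : ℝ≥0∞}
    (hr : r < volume S) : ∃ K ⊆ densityPoints S, IsCompact K ∧ r < volume K := by
  have hnull : NullMeasurableSet (densityPoints S) volume := by
    rw [← densityPoints_toMeasurable]
    exact (measurableSet_toMeasurable volume S).nullMeasurableSet.congr
      (densityPoints_ae_eq (measurableSet_toMeasurable volume S)).symm
  obtain ⟨T, hTS, hT, hTeq⟩ := hnull.exists_measurable_subset_ae_eq
  rw [← measure_densityPoints, ← measure_congr hTeq] at hr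
  obtain ⟨K, hKT, hK, hrK⟩ := hT.exists_lt_isCompact hr
  exact ⟨K, hKT.trans hTS, hK, hrK⟩

/-- The Brunn-Minkowski inequality for the Lebesgue outer measure of arbitrary sets. -/
theorem mul_add_pow_le_volume_add {A B : Set (Fin k → ℝ)} {s p q : ℝ≥0} (hp : p ≠ 0)
    (hq : q ≠ 0) (hpA : s * p ^ k ≤ volume A) (hqB : s * q ^ k ≤ volume B) :
    s * (p + q) ^ k ≤ volume (A + B) := by
  have hlt : ∀ t : ℝ≥0, t < s → t * (p + q : ℝ≥0∞) ^ k ≤ volume (A + B) := by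
    intro t ht
    rcases eq_or_ne t 0 with rfl | ht0
    · simp
    have hstep : ∀ r : ℝ≥0, r ≠ 0 → (t : ℝ≥0∞) * r ^ k < s * r ^ k := fun r hr => by
      have : t * r ^ k < s * r ^ k := by gcongr
      exact_mod_cast this
    obtain ⟨K, hKA, hK, hpK⟩ := exists_isCompact_subset_densityPoints ((hstep p hp).trans_le hpA)
    obtain ⟨L, hLB, hL, hqL⟩ := exists_isCompact_subset_densityPoints ((hstep q hq).trans_le hqB)
    calc t * (p + q : ℝ≥0∞) ^ k ≤ volume (K + L) :=
          hK.mul_add_pow_le_volume_add hL ht0 hp hq hpK.le hqL.le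
      _ ≤ volume (densityPoints (densityPoints (A + B))) := by
          refine measure_mono ((add_subset_add hKA hLB).trans ?_)
          rw [add_comm]
          refine densityPoints_add_subset ?_
          rw [add_comm]
          exact densityPoints_add_subset subset_rfl
      _ = volume (A + B) := by simp only [measure_densityPoints]
  have h0 : (p + q : ℝ≥0∞) ^ k ≠ 0 := by simp [hp]
  have htop : (p + q : ℝ≥0∞) ^ k ≠ ⊤ := by simp
  rw [← ENNReal.le_div_iff_mul_le (.inl h0) (.inl htop)]
  refine ENNReal.le_of_forall_nnreal_lt fun t ht => ?_
  rw [ENNReal.le_div_iff_mul_le (.inl h0) (.inl htop)]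
  exact hlt t (by exact_mod_cast ht)

end Density

section Projections

variable {d k : ℕ}

/-- The union of the sets `C v` over all `v` agreeing with the partially defined tuple `u`: this is
a fibre of the projection deleting the coordinates at which `u` is undefined. -/
def partialFiber (C : (Fin d → ℤ) → Set (Fin k → ℝ)) (u : Fin d → Option ℤ) : Set (Fin k → ℝ) :=
  {x | ∃ v, (∀ i, ∀ z ∈ u i, v i = z) ∧ x ∈ C v}

theorem partialFiber_cons_none (C : (Fin (d + 1) → ℤ) → Set (Fin k → ℝ)) (u : Fin d → Option ℤ) :
    partialFiber C (Fin.cons none u) = partialFiber (fun w => ⋃ z : ℤ, C (Fin.cons z w)) u := by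
  ext x
  simp [partialFiber, Fin.forall_fin_succ, Fin.exists_fin_succ_pi, exists_comm (α := ℤ)]

theorem partialFiber_cons_some (C : (Fin (d + 1) → ℤ) → Set (Fin k → ℝ)) (z : ℤ)
    (u : Fin d → Option ℤ) :
    partialFiber C (Fin.cons (some z) u) = partialFiber (fun w => C (Fin.cons z w)) u := by
  ext x
  simp [partialFiber, Fin.forall_fin_succ, Fin.exists_fin_succ_pi, and_assoc]

theorem tsum_fin_succ_pi {β : Type*} (f : (Fin (d + 1) → β) → ℝ≥0∞) :
    ∑' v, f v = ∑' x : β, ∑' w : Fin d → β, f (Fin.cons x w) := by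
  rw [← (Fin.consEquiv fun _ : Fin (d + 1) => β).tsum_eq, ENNReal.tsum_prod']
  rfl

theorem tsum_option_eq {β : Type*} (f : Option β → ℝ≥0∞) :
    ∑' o, f o = f none + ∑' x, f (some x) := by
  rw [← (Equiv.optionEquivSumPUnit.{0} β).symm.tsum_eq,
    ENNReal.summable.tsum_sum ENNReal.summable, add_comm]
  simp

/-- The claimed inequality, for the families of `ℝ^k`-fibres over `ℤ^d` of the sets involved. -/
theorem mul_add_pow_le_tsum_partialFiber {A B C : (Fin d → ℤ) → Set (Fin k → ℝ)}
    (hABC : ∀ v w, A v + B w ⊆ C (v + w)) (hA : ∑' v, volume (A v) ≠ ⊤)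
    (hB : ∑' v, volume (B v) ≠ ⊤) {s p q : ℝ≥0} (hs : s ≠ 0) (hp : p ≠ 0) (hq : q ≠ 0)
    (hpA : s * p ^ (k + d) ≤ ∑' v, volume (A v)) (hqB : s * q ^ (k + d) ≤ ∑' v, volume (B v)) :
    s * (p + q) ^ (k + d) ≤ ∑' u, volume (partialFiber C u) := by
  induction d generalizing s p q with
  | zero =>
    rw [tsum_fintype, Fintype.sum_unique] at hpA hqB ⊢
    refine (mul_add_pow_le_volume_add hp hq hpA hqB).trans (measure_mono ?_)
    exact (hABC _ _).trans fun x hx => ⟨_, fun i => i.elim0, hx⟩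
  | succ d ih =>
    have hone : k + d = 0 → ∀ (M : (Fin (d + 1) → ℤ) → Set (Fin k → ℝ)) (x : ℤ),
        ∑' w : Fin d → ℤ, volume (M (Fin.cons x w)) = 0 ∨
        ∑' w : Fin d → ℤ, volume (M (Fin.cons x w)) = 1 := by
      intro hkd M x
      obtain ⟨rfl, rfl⟩ : k = 0 ∧ d = 0 := by omega
      rw [tsum_fintype, Fintype.sum_unique]
      exact volume_eq_zero_or_one_of_fin_zero _
    rw [tsum_fin_succ_pi] at hpA hqB hA hB
    have hle : ∀ (M : (Fin (d + 1) → ℤ) → Set (Fin k → ℝ)) (x : ℤ),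
        ∑' w : Fin d → ℤ, volume (M (Fin.cons x w)) ≤
          ∑' x : ℤ, ∑' w : Fin d → ℤ, volume (M (Fin.cons x w)) := fun M x =>
      ENNReal.le_tsum (f := fun x : ℤ => ∑' w : Fin d → ℤ, volume (M (Fin.cons x w))) x
    rw [tsum_fin_succ_pi, tsum_option_eq]
    simp only [partialFiber_cons_none, partialFiber_cons_some]
    rw [← lintegral_count] at hpA hqB
    rw [add_comm (tsum _), ← lintegral_count]
    have key := mul_add_pow_succ_le_lintegral (ν := Measure.count) (c := 1)
      (fun S T _ _ hS hT => count_add_count_le_count_add S T hS hT)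
      (measurable_of_countable _) (measurable_of_countable _)
      (measurable_of_countable fun z : ℤ =>
        ∑' u, volume (partialFiber (fun w : Fin d → ℤ => C (Fin.cons z w)) u))
      (ne_top_of_le_ne_top hA (iSup_le (hle A))) (ne_top_of_le_ne_top hB (iSup_le (hle B)))
      (fun hn => hone hn A) (fun hn => hone hn B) ?_
      (m := ∑' u, volume (partialFiber (fun w : Fin d → ℤ => ⋃ z : ℤ, C (Fin.cons z w)) u))
      (fun z => ?_) hs hp hq hpA hqB
    · rwa [one_mul] at key
    · intro x y s p q hs hp hq hx hy
      refine ih (fun v w => ?_) (ne_top_of_le_ne_top hA (hle A x))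
        (ne_top_of_le_ne_top hB (hle B y)) hs hp hq hx hy
      refine (hABC _ _).trans (subset_of_eq (congrArg C ?_))
      ext i
      cases i using Fin.cases <;> simp
    · refine ENNReal.tsum_le_tsum fun u => measure_mono ?_
      rintro x ⟨v, hv, hx⟩
      exact ⟨v, hv, mem_iUnion.2 ⟨z, hx⟩⟩

end Projections

theorem count_prod_apply {W X : Type*} [MeasurableSpace W] [Countable W]
    [MeasurableSingletonClass W] [MeasurableSpace X] (μ : Measure X) [SFinite μ] (S : Set (W × X)) :
    (Measure.count.prod μ) S = ∑' w, μ (Prod.mk w ⁻¹' S) := by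
  rw [Measure.count, Measure.prod_sum_left, Measure.sum_apply_of_countable]
  refine tsum_congr fun w => ?_
  rw [Measure.dirac_prod, MeasurableEmbedding.map_apply]
  exact measurableEmbedding_prodMk_left w

theorem tsum_partialFiber_le_sum_prodMuI (d k : ℕ) (C : Set ((Fin d → ℤ) × (Fin k → ℝ))) :
    ∑' u, volume (partialFiber (fun v => Prod.mk v ⁻¹' C) u) ≤
      ∑ I : Finset (Fin d), prodMuI d k I (projI d k I '' C) := by
  let toPartial : (Σ I : Finset (Fin d), ({i : Fin d // i ∉ I} → ℤ)) → Fin d → Option ℤ :=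
    fun a i => if h : i ∈ a.1 then none else some (a.2 ⟨i, h⟩)
  have hsurj : Function.Surjective toPartial := by
    intro u
    refine ⟨⟨Finset.univ.filter fun i => u i = none, fun i => (u i).getD 0⟩, ?_⟩
    funext i
    cases hi : u i <;> simp [toPartial, hi]
  obtain ⟨g, hg⟩ := hsurj.hasRightInverse
  calc ∑' u, volume (partialFiber (fun v => Prod.mk v ⁻¹' C) u)
      = ∑' u, volume (partialFiber (fun v => Prod.mk v ⁻¹' C) (toPartial (g u))) := by
        simp only [hg _]
    _ ≤ ∑' a, volume (partialFiber (fun v => Prod.mk v ⁻¹' C) (toPartial a)) :=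
        ENNReal.tsum_comp_le_tsum_of_injective hg.injective
          fun a => volume (partialFiber (fun v => Prod.mk v ⁻¹' C) (toPartial a))
    _ = ∑ I : Finset (Fin d), ∑' w : {i : Fin d // i ∉ I} → ℤ,
          volume (partialFiber (fun v => Prod.mk v ⁻¹' C) (toPartial ⟨I, w⟩)) := by
        rw [ENNReal.tsum_sigma', tsum_fintype]
    _ ≤ _ := by
        refine Finset.sum_le_sum fun I _ => ?_
        rw [prodMuI, count_prod_apply]
        refine ENNReal.tsum_le_tsum fun w => measure_mono ?_
        rintro x ⟨v, hv, hx⟩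
        refine ⟨(v, x), hx, Prod.ext (funext fun i => hv i.1 _ ?_) rfl⟩
        simp [toPartial, i.2]

theorem tsum_volume_le_tsum_partialFiber {d k : ℕ} (C : (Fin d → ℤ) → Set (Fin k → ℝ)) :
    ∑' v, volume (C v) ≤ ∑' u, volume (partialFiber C u) := by
  have hinj : Function.Injective fun (v : Fin d → ℤ) (i : Fin d) => some (v i) :=
    fun v w h => funext fun i => Option.some_injective _ (congrFun h i)
  refine le_trans (ENNReal.tsum_le_tsum fun v => measure_mono fun x hx => ?_)
    (ENNReal.tsum_comp_le_tsum_of_injective hinj fun u => volume (partialFiber C u))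
  exact ⟨v, by simp, hx⟩

theorem prodMu_eq_tsum (d k : ℕ) (A : Set ((Fin d → ℤ) × (Fin k → ℝ))) :
    prodMu d k A = ∑' v, volume (Prod.mk v ⁻¹' A) :=
  count_prod_apply _ A

theorem prodMu_le_prodMu_add_left {d k : ℕ} {A B : Set ((Fin d → ℤ) × (Fin k → ℝ))}
    (hA : A.Nonempty) : prodMu d k B ≤ prodMu d k (A + B) := by
  obtain ⟨⟨v, x⟩, hvx⟩ := hA
  rw [prodMu_eq_tsum, prodMu_eq_tsum,
    ← (Equiv.addLeft v).tsum_eq fun w => volume (Prod.mk w ⁻¹' (A + B))]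
  refine ENNReal.tsum_le_tsum fun w => ?_
  rw [← measure_vadd volume x]
  refine measure_mono ?_
  rintro _ ⟨y, hy, rfl⟩
  exact ⟨_, hvx, _, hy, rfl⟩

theorem stmt_19 (d k : ℕ) (h : 1 ≤ k + d) (A B : Set ((Fin d → ℤ) × (Fin k → ℝ)))
    (hA : A.Nonempty) (hB : B.Nonempty)
    (hAfin : prodMu d k A < ⊤) (hBfin : prodMu d k B < ⊤) :
    (prodMu d k A ^ (((k + d : ℕ) : ℝ))⁻¹ + prodMu d k B ^ (((k + d : ℕ) : ℝ))⁻¹) ^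
        ((k + d : ℕ) : ℝ) ≤
      ∑ I : Finset (Fin d), prodMuI d k I (projI d k I '' (A + B)) := by
  have hk : ((k + d : ℕ) : ℝ) ≠ 0 := by
    exact_mod_cast (by omega : k + d ≠ 0)
  refine le_trans ?_ (tsum_partialFiber_le_sum_prodMuI d k (A + B))
  have hadd : prodMu d k (A + B) ≤
      ∑' u, volume (partialFiber (fun v => Prod.mk v ⁻¹' (A + B)) u) :=
    (prodMu_eq_tsum d k _).trans_le (tsum_volume_le_tsum_partialFiber _)
  rcases eq_or_ne (prodMu d k A) 0 with hA0 | hA0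
  · rw [hA0, ENNReal.zero_rpow_of_pos (by positivity), zero_add, ENNReal.rpow_inv_rpow hk]
    exact (prodMu_le_prodMu_add_left hA).trans hadd
  rcases eq_or_ne (prodMu d k B) 0 with hB0 | hB0
  · rw [hB0, ENNReal.zero_rpow_of_pos (by positivity), add_zero, ENNReal.rpow_inv_rpow hk]
    exact (add_comm A B ▸ prodMu_le_prodMu_add_left hB).trans hadd
  obtain ⟨p, hp, hpA⟩ := exists_pow_eq_of_ne_zero (k + d) hA0 hAfin.ne (by omega)
  obtain ⟨q, hq, hqB⟩ := exists_pow_eq_of_ne_zero (k + d) hB0 hBfin.ne (by omega)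
  have key := mul_add_pow_le_tsum_partialFiber (s := 1) (p := p) (q := q)
    (A := fun v => Prod.mk v ⁻¹' A) (B := fun v => Prod.mk v ⁻¹' B)
    (C := fun v => Prod.mk v ⁻¹' (A + B))
    (by rintro v w _ ⟨x, hx, y, hy, rfl⟩; exact ⟨_, hx, _, hy, rfl⟩)
    (by rw [← prodMu_eq_tsum]; exact hAfin.ne) (by rw [← prodMu_eq_tsum]; exact hBfin.ne)
    one_ne_zero hp hq (by rw [← prodMu_eq_tsum, hpA]; simp) (by rw [← prodMu_eq_tsum, hqB]; simp)
  rw [hpA, hqB]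
  simp only [← ENNReal.rpow_natCast, ENNReal.rpow_rpow_inv hk] at key ⊢
  simpa using key
end
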